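/- arXiv:2503.13071 — 3 statements merged into one kernel-verified Lean document; each statement's English description precedes it below -/
import Mathlib

section
/- Let D ⊂ ℝ^d satisfy Assumption (D) with data (ε₀, η, n). Then there exist ε₁ > 0, η' > 0 and C > 0 such that: (i) for every x ∈ ∂D and every A ∈ I_x there is a three times continuously differentiable function ψ_{x,A} : B_{d−1}(0,ε₁) → [0,∞) with ψ_{x,A}(0) = 0, ∇ψ_{x,A}(0) = 0, w·Hess ψ_{x,A}(v) w ≥ η'|w|² for all v, w, ‖D²ψ_{x,A}(v)‖ + ‖D³ψ_{x,A}(v)‖ ≤ C for all v, and D_{x,A} ∩ B_d(0,ε₁) = { u ∈ B_d(0,ε₁) : u·e₁ > ψ_{x,A}(u·e₂, …, u·e_d) }; (ii) for all x ∈ ∂D, A ∈ I_x and u ∈ B_d(0,ε₁): (1/2)|u·e₁ − ψ_{x,A}(u·e₂,…,u·e_d)| ≤ dist(u, ∂D_{x,A}) ≤ |u·e₁ − ψ_{x,A}(u·e₂,…,u·e_d)|; (iii) for all x, x' ∈ ∂D, A ∈ I_x, A' ∈ I_{x'} and all v ∈ B_{d−1}(0,ε₁): |ψ_{x,A}(v)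 − ψ_{x',A'}(v)| ≤ C ρ(x,x',A,A') |v|². -/
open Metric Set Bornology
open scoped RealInnerProductSpace

noncomputable section

/-- The first vector of the canonical basis of `ℝ^d`. -/
def e1 (d : ℕ) : EuclideanSpace ℝ (Fin d) :=
  if h : 0 < d then EuclideanSpace.single (⟨0, h⟩ : Fin d) 1 else 0

/-- The projection `ℝ^d → ℝ^{d−1}`, `u ↦ (u·e₂, …, u·e_d)`. -/
def projTail (d : ℕ) (u : EuclideanSpace ℝ (Fin d)) :
    EuclideanSpace ℝ (Fin (d - 1)) :=
  (EuclideanSpace.equiv (Fin (d - 1)) ℝ).symm fun i => u ⟨i.1 + 1, by have := i.isLt; omega⟩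

/-- Assumption (D): `D ⊂ ℝ^d` (`d ≥ 2`) is nonempty, open, bounded and convex, `n x` is a
unit vector for `x ∈ ∂D`, and around each boundary point `x` the domain is, in suitable
isometric coordinates sending `e₁` to `n x`, the epigraph of a `C³` uniformly strongly
convex function `ψ` with `ψ(0)=0`, `∇ψ(0)=0`, `Hess ψ ≥ η`, `‖D²ψ‖+‖D³ψ‖ ≤ η⁻¹`. -/
structure AssumptionD (d : ℕ) (D : Set (EuclideanSpace ℝ (Fin d))) (ε₀ η : ℝ)
    (n : EuclideanSpace ℝ (Fin d) → EuclideanSpace ℝ (Fin d)) : Prop where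
  dim_ge : 2 ≤ d
  eps_pos : 0 < ε₀
  eps_lt_one : ε₀ < 1
  eta_pos : 0 < η
  nonempty : D.Nonempty
  isOpen : IsOpen D
  isBounded : Bornology.IsBounded D
  convex : Convex ℝ D
  normal_norm : ∀ x ∈ frontier D, ‖n x‖ = 1
  chart : ∀ x ∈ frontier D,
    ∃ A₀ : EuclideanSpace ℝ (Fin d) →ₗᵢ[ℝ] EuclideanSpace ℝ (Fin d),
      A₀ (e1 d) = n x ∧
      ∃ ψ : EuclideanSpace ℝ (Fin (d - 1)) → ℝ,
        ContDiffOn ℝ 3 ψ (Metric.ball (0 : EuclideanSpace ℝ (Fin (d - 1))) ε₀) ∧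
        (∀ v ∈ Metric.ball (0 : EuclideanSpace ℝ (Fin (d - 1))) ε₀, 0 ≤ ψ v) ∧
        ψ 0 = 0 ∧
        fderiv ℝ ψ 0 = 0 ∧
        (∀ v ∈ Metric.ball (0 : EuclideanSpace ℝ (Fin (d - 1))) ε₀,
          ∀ w : EuclideanSpace ℝ (Fin (d - 1)),
            η * ‖w‖ ^ 2 ≤ iteratedFDeriv ℝ 2 ψ v ![w, w]) ∧
        (∀ v ∈ Metric.ball (0 : EuclideanSpace ℝ (Fin (d - 1))) ε₀,
          ‖iteratedFDeriv ℝ 2 ψ v‖ + ‖iteratedFDeriv ℝ 3 ψ v‖ ≤ η⁻¹) ∧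
        D ∩ Metric.ball x ε₀ =
          (fun u : EuclideanSpace ℝ (Fin d) => x + A₀ u) ''
            {u : EuclideanSpace ℝ (Fin d) |
              u ∈ Metric.ball (0 : EuclideanSpace ℝ (Fin d)) ε₀ ∧
              ψ (projTail d u) < ⟪u, e1 d⟫}


structure Reg {F : Type*} [NormedAddCommGroup F] [NormedSpace ℝ F] (f : F → ℝ) (r M : ℝ) : Prop where
  rpos : 0 < r
  Mpos : 0 < M
  Mr : M * r ≤ 1
  zero : f 0 = 0
  dzero : fderiv ℝ f 0 = 0
  d1 : ∀ p ∈ ball (0 : F) r, DifferentiableAt ℝ f p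
  d2 : ∀ p ∈ ball (0 : F) r, DifferentiableAt ℝ (fderiv ℝ f) p
  l1 : ∀ p ∈ ball (0 : F) r, ∀ q ∈ ball (0 : F) r, ‖fderiv ℝ f p - fderiv ℝ f q‖ ≤ M * ‖p - q‖
  l2 : ∀ p ∈ ball (0 : F) r, ∀ q ∈ ball (0 : F) r,
    ‖fderiv ℝ (fderiv ℝ f) p - fderiv ℝ (fderiv ℝ f) q‖ ≤ M * ‖p - q‖

set_option maxSynthPendingDepth 6 in
theorem Reg.of_contDiffOn {F : Type*} [NormedAddCommGroup F] [NormedSpace ℝ F] {f : F → ℝ}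
    {r M : ℝ} (hr : 0 < r) (hM : 0 < M) (hMr : M * r ≤ 1) (h0 : f 0 = 0)
    (hd0 : fderiv ℝ f 0 = 0) (hc : ContDiffOn ℝ 3 f (ball 0 r))
    (hb : ∀ v ∈ ball (0 : F) r, ‖iteratedFDeriv ℝ 2 f v‖ + ‖iteratedFDeriv ℝ 3 f v‖ ≤ M) :
    Reg f r M := by
  have hca : ∀ p ∈ ball (0 : F) r, ContDiffAt ℝ 3 f p := fun p hp =>
    hc.contDiffAt (isOpen_ball.mem_nhds hp)
  have h1 : ∀ p ∈ ball (0 : F) r, ContDiffAt ℝ 2 (fderiv ℝ f) p := fun p hp =>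
    (hca p hp).fderiv_right (by norm_num)
  have h2 : ∀ p ∈ ball (0 : F) r, ContDiffAt ℝ 1 (fderiv ℝ (fderiv ℝ f)) p := fun p hp =>
    (h1 p hp).fderiv_right (by norm_num)
  have e2 : ∀ p, ‖fderiv ℝ (fderiv ℝ f) p‖ = ‖iteratedFDeriv ℝ 2 f p‖ := fun p => by
    rw [← norm_iteratedFDeriv_fderiv, norm_iteratedFDeriv_one]
  have e3 : ∀ p, ‖fderiv ℝ (fderiv ℝ (fderiv ℝ f)) p‖ = ‖iteratedFDeriv ℝ 3 f p‖ := fun p => by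
    rw [← norm_iteratedFDeriv_fderiv, ← norm_iteratedFDeriv_fderiv, norm_iteratedFDeriv_one]
  refine ⟨hr, hM, hMr, h0, hd0, fun p hp => (hca p hp).differentiableAt (by norm_num),
    fun p hp => (h1 p hp).differentiableAt (by norm_num), fun p hp q hq => ?_, fun p hp q hq => ?_⟩
  · refine (convex_ball (0 : F) r).norm_image_sub_le_of_norm_fderiv_le
      (fun z hz => (h1 z hz).differentiableAt (by norm_num)) (fun z hz => ?_) hq hp
    rw [e2]
    linarith [hb z hz, norm_nonneg (iteratedFDeriv ℝ 3 f z)]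
  · refine (convex_ball (0 : F) r).norm_image_sub_le_of_norm_fderiv_le
      (fun z hz => (h2 z hz).differentiableAt (by norm_num)) (fun z hz => ?_) hq hp
    rw [e3]
    linarith [hb z hz, norm_nonneg (iteratedFDeriv ℝ 2 f z)]

section
variable {F : Type*} [NormedAddCommGroup F] [NormedSpace ℝ F] {f : F → ℝ} {r M : ℝ}

theorem Reg.dle (h : Reg f r M) {p : F} (hp : p ∈ ball (0 : F) r) : ‖fderiv ℝ f p‖ ≤ M * ‖p‖ := by
  simpa [h.dzero] using h.l1 p hp 0 (mem_ball_self h.rpos)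

theorem Reg.lip (h : Reg f r M) {p q : F} (hp : p ∈ ball (0 : F) r) (hq : q ∈ ball (0 : F) r) :
    |f p - f q| ≤ ‖p - q‖ := by
  have := (convex_ball (0 : F) r).norm_image_sub_le_of_norm_fderiv_le (C := 1)
    (fun z hz => h.d1 z hz) (fun z hz => ?_) hq hp
  · simpa using this
  · refine (h.dle hz).trans (le_trans ?_ h.Mr)
    exact mul_le_mul_of_nonneg_left (mem_ball_zero_iff.1 hz).le h.Mpos.le

theorem Reg.le_norm (h : Reg f r M) {p : F} (hp : p ∈ ball (0 : F) r) : |f p| ≤ ‖p‖ := by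
  simpa [h.zero] using h.lip hp (mem_ball_self h.rpos)

theorem seg_norm {a b z : F} {R : ℝ} (hz : z ∈ segment ℝ a b) (ha : ‖a‖ ≤ R) (hb : ‖b‖ ≤ R) :
    ‖z‖ ≤ R := by
  have := (convex_closedBall (0 : F) R).segment_subset (by simpa using ha) (by simpa using hb) hz
  simpa using this

theorem Reg.le_sq (h : Reg f r M) {p : F} (hp : p ∈ ball (0 : F) r) : |f p| ≤ M * ‖p‖ ^ 2 := by
  have hp' := mem_ball_zero_iff.1 hp
  have hz' : ∀ z ∈ segment ℝ 0 p, ‖z‖ ≤ ‖p‖ := fun z hz => seg_norm hz (by simp) le_rfl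
  have := (convex_segment (0 : F) p).norm_image_sub_le_of_norm_fderiv_le (𝕜 := ℝ) (f := f)
    (C := M * ‖p‖)
    (fun z hz => h.d1 z (mem_ball_zero_iff.2 ((hz' z hz).trans_lt hp'))) (fun z hz => ?_)
    (left_mem_segment ℝ _ _) (right_mem_segment ℝ _ _)
  · simpa [h.zero, pow_two, mul_assoc] using this
  · refine (h.dle (mem_ball_zero_iff.2 ((hz' z hz).trans_lt hp'))).trans ?_
    exact mul_le_mul_of_nonneg_left (hz' z hz) h.Mpos.le

/-- first part -/
theorem Reg.part1 (h : Reg f r M) {b c v : F} (hcv : ‖c‖ ≤ ‖v‖) (hbv : ‖b‖ + ‖v‖ < r) :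
    |f (b + c) - f (b + v) - fderiv ℝ f b (c - v)| ≤ M * ‖v‖ * ‖c - v‖ := by
  have hz' : ∀ z ∈ segment ℝ v c, ‖z‖ ≤ ‖v‖ := fun z hz => seg_norm hz le_rfl hcv
  have hzb : ∀ z ∈ segment ℝ v c, b + z ∈ ball (0 : F) r := fun z hz => by
    rw [mem_ball_zero_iff]
    linarith [norm_add_le b z, hz' z hz]
  have hb : b ∈ ball (0 : F) r := by
    rw [mem_ball_zero_iff]; linarith [norm_nonneg v]
  have := (convex_segment (v : F) c).norm_image_sub_le_of_norm_hasFDerivWithin_le (𝕜 := ℝ)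
    (f := fun z => f (b + z) - fderiv ℝ f b z) (f' := fun z => fderiv ℝ f (b + z) - fderiv ℝ f b)
    (C := M * ‖v‖)
    (fun z hz => ?_) (fun z hz => ?_)
    (left_mem_segment ℝ _ _) (right_mem_segment ℝ _ _)
  · rw [Real.norm_eq_abs] at this
    convert this using 2
    simp only [map_sub]; ring
  · refine HasFDerivAt.hasFDerivWithinAt (HasFDerivAt.sub ?_ (fderiv ℝ f b).hasFDerivAt)
    have := (h.d1 _ (hzb z hz)).hasFDerivAt
    exact (hasFDerivAt_comp_add_left (f := f) b).2 this
  · refine (h.l1 _ (hzb z hz) _ hb).trans ?_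
    simpa using mul_le_mul_of_nonneg_left (hz' z hz) h.Mpos.le

theorem Reg.part2 (h : Reg f r M) {b v : F} (hbv : ‖b‖ + ‖v‖ < r) :
    |f (b + v) - f v - f b - fderiv ℝ f b v| ≤ M * ‖b‖ * ‖v‖ ^ 2 := by
  have hz' : ∀ z ∈ segment ℝ 0 v, ‖z‖ ≤ ‖v‖ := fun z hz => seg_norm hz (by simp) le_rfl
  have hzb : ∀ z ∈ segment ℝ 0 v, b + z ∈ ball (0 : F) r := fun z hz => by
    rw [mem_ball_zero_iff]
    linarith [norm_add_le b z, hz' z hz]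
  have hzz : ∀ z ∈ segment ℝ 0 v, z ∈ ball (0 : F) r := fun z hz => by
    rw [mem_ball_zero_iff]
    linarith [norm_nonneg b, hz' z hz]
  have key : ∀ z ∈ segment ℝ 0 v, ‖fderiv ℝ f (b + z) - fderiv ℝ f z - fderiv ℝ f b‖
      ≤ M * ‖b‖ * ‖v‖ := by
    intro z hz
    have hsub : segment ℝ 0 z ⊆ segment ℝ 0 v :=
      (convex_segment (0 : F) v).segment_subset (left_mem_segment ℝ _ _) hz
    have := (convex_segment (0 : F) z).norm_image_sub_le_of_norm_hasFDerivWithin_le (𝕜 := ℝ)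
      (f := fun y => fderiv ℝ f (b + y) - fderiv ℝ f y)
      (f' := fun y => fderiv ℝ (fderiv ℝ f) (b + y) - fderiv ℝ (fderiv ℝ f) y)
      (C := M * ‖b‖)
      (fun y hy => ?_) (fun y hy => ?_)
      (left_mem_segment ℝ _ _) (right_mem_segment ℝ _ _)
    · simp only [add_zero, h.dzero, sub_zero] at this
      refine this.trans ?_
      exact mul_le_mul_of_nonneg_left (hz' z hz) (mul_nonneg h.Mpos.le (norm_nonneg _))
    · refine HasFDerivAt.hasFDerivWithinAt (HasFDerivAt.sub ?_
        (h.d2 _ (hzz y (hsub hy))).hasFDerivAt)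
      exact (hasFDerivAt_comp_add_left (f := fderiv ℝ f) b).2 (h.d2 _ (hzb y (hsub hy))).hasFDerivAt
    · simpa using (h.l2 _ (hzb y (hsub hy)) _ (hzz y (hsub hy)))
  have := (convex_segment (0 : F) v).norm_image_sub_le_of_norm_hasFDerivWithin_le (𝕜 := ℝ)
    (f := fun z => f (b + z) - f z - fderiv ℝ f b z)
    (f' := fun z => fderiv ℝ f (b + z) - fderiv ℝ f z - fderiv ℝ f b)
    (C := M * ‖b‖ * ‖v‖)
    (fun z hz => ?_) key
    (left_mem_segment ℝ _ _) (right_mem_segment ℝ _ _)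
  · rw [Real.norm_eq_abs] at this
    convert this using 1
    · congr 1
      simp only [add_zero, h.zero, map_zero]; ring
    · simp; ring
  · refine HasFDerivAt.hasFDerivWithinAt (HasFDerivAt.sub (HasFDerivAt.sub ?_
      (h.d1 _ (hzz z hz)).hasFDerivAt) (fderiv ℝ f b).hasFDerivAt)
    exact (hasFDerivAt_comp_add_left (f := f) b).2 (h.d1 _ (hzb z hz)).hasFDerivAt

end

structure Spl {E F : Type*} [NormedAddCommGroup E] [InnerProductSpace ℝ E]
    [NormedAddCommGroup F] [InnerProductSpace ℝ F] (e : E) (P : E →L[ℝ] F) (J : F →ₗᵢ[ℝ] E) : Prop where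
  ne : ‖e‖ = 1
  nP : ∀ u, ‖P u‖ ≤ ‖u‖
  PJ : ∀ v, P (J v) = v
  Je : ∀ v, ⟪J v, e⟫ = 0
  Pe : P e = 0
  dec : ∀ u, ⟪u, e⟫ • e + J (P u) = u

section
variable {E F : Type*} [NormedAddCommGroup E] [InnerProductSpace ℝ E]
    [NormedAddCommGroup F] [InnerProductSpace ℝ F] {e : E} {P : E →L[ℝ] F} {J : F →ₗᵢ[ℝ] E}

theorem Spl.part3 (S : Spl e P J) {f g : F → ℝ} {r M ρ : ℝ} (hf : Reg f r M) (hg : Reg g r M)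
    (B : E →ₗᵢ[ℝ] E) (b : E) (hb : ‖b‖ ≤ ρ) (hρ : ρ ≤ r / 8) (hB : ∀ u, ‖B u - u‖ ≤ ρ * ‖u‖)
    (hid : ∀ v ∈ ball (0 : F) (r / 8),
      f (P (b + B (g v • e + J v))) = ⟪b + B (g v • e + J v), e⟫)
    (v : F) (hv : v ∈ ball (0 : F) (r / 8)) :
    |f v - g v| ≤ 4 * M * ρ * ‖v‖ ^ 2 := by
  have hr := hf.rpos
  have hM := hf.Mpos
  have hρ0 : 0 ≤ ρ := (norm_nonneg _).trans hb
  have hv' := mem_ball_zero_iff.1 hv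
  have hvr : v ∈ ball (0 : F) r := ball_subset_ball (by linarith) hv
  set a := P (B e) with ha
  set c := P (B (J v)) with hc
  set b' := P b with hb'
  have hnb : ‖b'‖ ≤ ρ := (S.nP b).trans hb
  have hna : ‖a‖ ≤ ρ := by
    have : a = P (B e - e) := by rw [map_sub, S.Pe, sub_zero]
    rw [this]
    refine (S.nP _).trans ((hB e).trans ?_)
    rw [S.ne, mul_one]
  have hna1 : ‖a‖ ≤ 1 := by
    refine (S.nP _).trans ?_
    rw [B.norm_map, S.ne]
  have hnc : ‖c‖ ≤ ‖v‖ := by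
    refine (S.nP _).trans ?_
    rw [B.norm_map, J.norm_map]
  have hcv : ‖c - v‖ ≤ ρ * ‖v‖ := by
    have : c - v = P (B (J v) - J v) := by rw [map_sub, S.PJ]
    rw [this]
    refine (S.nP _).trans ((hB _).trans ?_)
    rw [J.norm_map]
  have hB1 : |⟪B e, e⟫ - 1| ≤ ρ := by
    have : ⟪B e, e⟫ - 1 = ⟪B e - e, e⟫ := by
      rw [inner_sub_left, real_inner_self_eq_norm_sq, S.ne]; norm_num
    rw [this]
    refine (abs_real_inner_le_norm _ _).trans ?_
    have := hB e
    rw [S.ne] at *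
    linarith
  have hid' : ∀ w ∈ ball (0 : F) (r / 8),
      f (b' + g w • a + P (B (J w))) = ⟪b, e⟫ + g w * ⟪B e, e⟫ + ⟪B (J w), e⟫ := by
    intro w hw
    have := hid w hw
    simp only [map_add, map_smul, inner_add_left, inner_smul_left] at this
    rw [ha, hb', add_assoc, this]
    simp [add_assoc]
  have h0m : (0 : F) ∈ ball (0 : F) (r / 8) := mem_ball_self (by linarith)
  have i0 : f b' = ⟪b, e⟫ := by
    simpa [hg.zero] using hid' 0 h0m
  -- derivative identity
  have iD : fderiv ℝ f b' c = ⟪B (J v), e⟫ := by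
    have hbm : b' ∈ ball (0 : F) r := by rw [mem_ball_zero_iff]; linarith
    have hg0 : HasFDerivAt g (0 : F →L[ℝ] ℝ) 0 := by
      have := (hg.d1 0 (mem_ball_self hr)).hasFDerivAt
      rwa [hg.dzero] at this
    have hg1 : HasDerivAt (fun t : ℝ => g (t • v)) 0 0 := by
      have h1 : HasDerivAt (fun t : ℝ => t • v) v 0 := by
        simpa using (hasDerivAt_id (0 : ℝ)).smul_const v
      have h2 : HasFDerivAt g (0 : F →L[ℝ] ℝ) ((0 : ℝ) • v) := by simpa using hg0
      have h3 := h2.comp_hasDerivAt (0 : ℝ) h1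
      rw [ContinuousLinearMap.zero_apply] at h3
      exact h3
    have hL : HasDerivAt (fun t : ℝ => f (b' + g (t • v) • a + t • c)) (fderiv ℝ f b' c) 0 := by
      have h1 : HasDerivAt (fun t : ℝ => b' + g (t • v) • a + t • c) c 0 := by
        have := ((hg1.smul_const a).const_add b').add ((hasDerivAt_id (0 : ℝ)).smul_const c)
        rw [zero_smul, one_smul, zero_add] at this
        exact this
      have h2 : HasFDerivAt f (fderiv ℝ f b') (b' + g ((0 : ℝ) • v) • a + (0 : ℝ) • c) := by
        simpa [hg.zero] using (hf.d1 _ hbm).hasFDerivAt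
      exact h2.comp_hasDerivAt (0 : ℝ) h1
    have hR : HasDerivAt (fun t : ℝ => ⟪b, e⟫ + g (t • v) * ⟪B e, e⟫ + t * ⟪B (J v), e⟫)
        (⟪B (J v), e⟫) 0 := by
      have := ((hg1.mul_const ⟪B e, e⟫).const_add ⟪b, e⟫).add
        ((hasDerivAt_id (0 : ℝ)).mul_const ⟪B (J v), e⟫)
      rw [zero_mul, one_mul, zero_add] at this
      exact this
    refine hL.unique (hR.congr_of_eventuallyEq ?_)
    have hcont : Filter.Tendsto (fun t : ℝ => t • v) (nhds 0) (nhds 0) := by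
      have : Continuous (fun t : ℝ => t • v) := by fun_prop
      simpa using this.tendsto 0
    filter_upwards [hcont.eventually (isOpen_ball.mem_nhds h0m)] with t ht
    have := hid' (t • v) ht
    simp only [map_smul, inner_smul_left] at this
    simpa [hc] using this
  have i1 := hid' v hv
  rw [← i0, ← iD, ← hc] at i1
  have hgs := hg.le_sq hvr
  have hgn := hg.le_norm hvr
  have t1 : |(1 - ⟪B e, e⟫) * g v| ≤ ρ * (M * ‖v‖ ^ 2) := by
    rw [abs_mul, abs_sub_comm]
    exact mul_le_mul hB1 hgs (abs_nonneg _) hρ0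
  have hbc : b' + c ∈ ball (0 : F) r := by
    rw [mem_ball_zero_iff]; linarith [norm_add_le b' c]
  have hga : ‖g v • a‖ ≤ ‖v‖ := by
    rw [norm_smul, Real.norm_eq_abs]
    nlinarith [abs_nonneg (g v), norm_nonneg a]
  have hbca : b' + g v • a + c ∈ ball (0 : F) r := by
    rw [mem_ball_zero_iff]; linarith [norm_add_le (b' + g v • a) c, norm_add_le b' (g v • a)]
  have t2 : |f (b' + g v • a + c) - f (b' + c)| ≤ ρ * (M * ‖v‖ ^ 2) := by
    refine (hf.lip hbca hbc).trans ?_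
    have : b' + g v • a + c - (b' + c) = g v • a := by abel
    rw [this, norm_smul, mul_comm, Real.norm_eq_abs]
    exact mul_le_mul hna hgs (abs_nonneg _) hρ0
  have hbv : ‖b'‖ + ‖v‖ < r := by linarith
  have t3 := hf.part1 hnc hbv
  have t4 := hf.part2 hbv
  have t3' : M * ‖v‖ * ‖c - v‖ ≤ ρ * (M * ‖v‖ ^ 2) := by
    calc M * ‖v‖ * ‖c - v‖ ≤ M * ‖v‖ * (ρ * ‖v‖) := by gcongr
      _ = _ := by ring
  have t4' : M * ‖b'‖ * ‖v‖ ^ 2 ≤ ρ * (M * ‖v‖ ^ 2) := by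
    calc M * ‖b'‖ * ‖v‖ ^ 2 ≤ M * ρ * ‖v‖ ^ 2 := by gcongr
      _ = _ := by ring
  rw [map_sub] at t3
  rw [abs_le] at *
  constructor <;> nlinarith [t1.1, t1.2, t2.1, t2.2, t3.1, t3.2, t4.1, t4.2]

end

section
variable {E F : Type*} [NormedAddCommGroup E] [InnerProductSpace ℝ E]
    [NormedAddCommGroup F] [InnerProductSpace ℝ F] {e : E} {P : E →L[ℝ] F} {J : F →ₗᵢ[ℝ] E}

theorem Spl.abs_inner (S : Spl e P J) (u : E) : |⟪u, e⟫| ≤ ‖u‖ := by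
  simpa [S.ne] using abs_real_inner_le_norm u e

theorem Spl.mem (S : Spl e P J) {r : ℝ} {u : E} (hu : u ∈ ball (0 : E) r) :
    P u ∈ ball (0 : F) r := by
  rw [mem_ball_zero_iff] at *
  exact (S.nP u).trans_lt hu

theorem Spl.ee (S : Spl e P J) : ⟪e, e⟫ = 1 := by
  rw [real_inner_self_eq_norm_sq, S.ne]; norm_num

theorem Spl.front (S : Spl e P J) {f : F → ℝ} {r : ℝ} {D : Set E} (hD : IsOpen D)
    (hf : ∀ p ∈ ball (0 : F) r, ContinuousAt f p)
    (hi : ∀ u ∈ ball (0 : E) r, (u ∈ D ↔ f (P u) < ⟪u, e⟫)) {u : E} (hu : u ∈ ball (0 : E) r) :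
    u ∈ frontier D ↔ f (P u) = ⟪u, e⟫ := by
  have hc : ContinuousAt (fun w : E => f (P w)) u :=
    ContinuousAt.comp (f := fun w => P w) (g := f) (hf _ (S.mem hu)) P.continuous.continuousAt
  have hi' : ContinuousAt (fun w : E => ⟪w, e⟫) u := by fun_prop
  rw [hD.frontier_eq, mem_diff]
  constructor
  · rintro ⟨h1, h2⟩
    rw [hi u hu, not_lt] at h2
    refine (h2.antisymm ?_).symm
    by_contra hlt
    rw [not_le] at hlt
    have hev : ∀ᶠ w in nhds u, w ∉ D := by
      filter_upwards [hi'.eventually_lt hc hlt, isOpen_ball.mem_nhds hu] with w hw hwb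
      rw [hi w hwb, not_lt]
      exact hw.le
    rw [mem_closure_iff_frequently] at h1
    exact h1 hev
  · intro h
    refine ⟨?_, by rw [hi u hu, h]; exact lt_irrefl _⟩
    have hp : Continuous (fun t : ℝ => u + t • e) := by fun_prop
    have ht : Filter.Tendsto (fun t : ℝ => u + t • e) (nhdsWithin 0 (Ioi 0)) (nhds u) := by
      have := hp.tendsto 0
      simp only [zero_smul, add_zero] at this
      exact this.mono_left nhdsWithin_le_nhds
    refine mem_closure_of_tendsto ht ?_
    filter_upwards [ht.eventually (isOpen_ball.mem_nhds hu), self_mem_nhdsWithin] with t h1 h2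
    rw [hi _ h1, map_add, map_smul, S.Pe, smul_zero, add_zero, inner_add_left, inner_smul_left,
      S.ee, h]
    simpa using h2

theorem Spl.distC (S : Spl e P J) {f : F → ℝ} {r M : ℝ} {D : Set E} (hf : Reg f r M)
    (hfr : ∀ u ∈ ball (0 : E) r, (u ∈ frontier D ↔ f (P u) = ⟪u, e⟫)) {u : E}
    (hu : u ∈ ball (0 : E) (r / 8)) :
    1 / 2 * |⟪u, e⟫ - f (P u)| ≤ infDist u (frontier D) ∧
      infDist u (frontier D) ≤ |⟪u, e⟫ - f (P u)| := by
  have hr := hf.rpos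
  have hur : u ∈ ball (0 : E) r := ball_subset_ball (by linarith) hu
  have hun := mem_ball_zero_iff.1 hu
  have hfu := hf.le_norm (S.mem hur)
  have hPu := S.nP u
  constructor
  · have hne : (frontier D).Nonempty :=
      ⟨0, (hfr 0 (mem_ball_self hr)).2 (by simp [hf.zero])⟩
    rw [le_infDist hne]
    intro w hw
    rw [dist_eq_norm]
    by_cases hwr : w ∈ ball (0 : E) r
    · have h1 := (hfr w hwr).1 hw
      have h2 := hf.lip (S.mem hwr) (S.mem hur)
      have h3 : ‖P w - P u‖ ≤ ‖u - w‖ := by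
        rw [← map_sub, norm_sub_rev u w]; exact S.nP _
      have h4 := S.abs_inner (u - w)
      rw [inner_sub_left] at h4
      have h5 : ⟪u, e⟫ - f (P u) = (⟪u, e⟫ - ⟪w, e⟫) + (f (P w) - f (P u)) := by rw [h1]; ring
      rw [h5]
      have := abs_add_le (⟪u, e⟫ - ⟪w, e⟫) (f (P w) - f (P u))
      linarith
    · rw [mem_ball_zero_iff, not_lt] at hwr
      have h1 := abs_sub (⟪u, e⟫) (f (P u))
      have h2 := S.abs_inner u
      have h3 := norm_sub_norm_le w u
      rw [norm_sub_rev] at h3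
      linarith
  · set w := f (P u) • e + J (P u) with hw
    have hPw : P w = P u := by simp [hw, S.Pe, S.PJ]
    have hwe : ⟪w, e⟫ = f (P u) := by
      rw [hw, inner_add_left, inner_smul_left, S.ee, S.Je]; simp
    have hwb : w ∈ ball (0 : E) r := by
      rw [mem_ball_zero_iff]
      have : ‖w‖ ≤ |f (P u)| + ‖P u‖ := by
        refine (norm_add_le _ _).trans ?_
        rw [norm_smul, S.ne, J.norm_map, Real.norm_eq_abs, mul_one]
      linarith
    have hwf := (hfr w hwb).2 (by rw [hPw, hwe])
    refine (infDist_le_dist_of_mem hwf).trans (le_of_eq ?_)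
    have : u - w = (⟪u, e⟫ - f (P u)) • e := by
      have := S.dec u
      rw [hw, sub_smul]
      nth_rewrite 1 [← this]
      abel
    rw [dist_eq_norm, this, norm_smul, S.ne, mul_one, Real.norm_eq_abs]

theorem Spl.rot (S : Spl e P J) [FiniteDimensional ℝ E] [FiniteDimensional ℝ F]
    (A A₀ : E →ₗᵢ[ℝ] E) (h : A e = A₀ e) :
    ∃ (R : E →ₗᵢ[ℝ] E) (R' : F ≃ₗᵢ[ℝ] F), (∀ u, A₀ (R u) = A u) ∧ (∀ u, P (R u) = R' (P u)) ∧
      ∀ u, ⟪R u, e⟫ = ⟪u, e⟫ := by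
  set A₁ := A₀.toLinearIsometryEquiv rfl with hA₁
  have hA1 : ∀ u, A₁ u = A₀ u := fun u => rfl
  let R : E →ₗᵢ[ℝ] E := A₁.symm.toLinearIsometry.comp A
  have hR : ∀ u, A₀ (R u) = A u := fun u => by
    rw [← hA1]; exact A₁.apply_symm_apply _
  have hRe : R e = e := A₀.injective (by rw [hR, h])
  have hRi : ∀ u, ⟪R u, e⟫ = ⟪u, e⟫ := fun u => by
    nth_rewrite 1 [← hRe]; exact R.inner_map_map u e
  let L : F →ₗ[ℝ] F := P.toLinearMap ∘ₗ R.toLinearMap ∘ₗ J.toLinearMap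
  have hL : ∀ v, L v = P (R (J v)) := fun v => rfl
  let R₁ : F →ₗᵢ[ℝ] F := ⟨L, fun v => by
    have := S.dec (R (J v))
    rw [hRi, S.Je, zero_smul, zero_add] at this
    rw [hL, ← J.norm_map, this, R.norm_map, J.norm_map]⟩
  have hR1 : ∀ v, R₁ v = P (R (J v)) := fun v => rfl
  refine ⟨R, R₁.toLinearIsometryEquiv rfl, hR, fun u => ?_, hRi⟩
  change _ = R₁ (P u)
  rw [hR1]
  nth_rewrite 1 [← S.dec u]
  rw [map_add, map_add, map_smul, hRe, map_smul, S.Pe, smul_zero, zero_add]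

theorem iter2_comp (R : F ≃ₗᵢ[ℝ] F) (ψ : F → ℝ) (v w : F) :
    iteratedFDeriv ℝ 2 (fun z => ψ (R z)) v ![w, w] = iteratedFDeriv ℝ 2 ψ (R v) ![R w, R w] := by
  have := R.toContinuousLinearEquiv.iteratedFDerivWithin_comp_right ψ (s := univ)
    uniqueDiffOn_univ (mem_univ (R.toContinuousLinearEquiv v)) 2
  simp only [preimage_univ, iteratedFDerivWithin_univ] at this
  have h2 := congrArg (fun T => T ![w, w]) this
  simp only [ContinuousMultilinearMap.compContinuousLinearMap_apply] at h2
  refine h2.trans ?_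
  congr 1
  ext i
  fin_cases i <;> rfl

end

theorem exists_spl (d : ℕ) (hd : 2 ≤ d) :
    ∃ (P : EuclideanSpace ℝ (Fin d) →L[ℝ] EuclideanSpace ℝ (Fin (d - 1)))
      (J : EuclideanSpace ℝ (Fin (d - 1)) →ₗᵢ[ℝ] EuclideanSpace ℝ (Fin d)),
      Spl (e1 d) P J ∧ ∀ u, P u = projTail d u := by
  obtain ⟨m, rfl⟩ : ∃ m, d = m + 1 := ⟨d - 1, by omega⟩
  change ∃ (P : EuclideanSpace ℝ (Fin (m + 1)) →L[ℝ] EuclideanSpace ℝ (Fin m))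
      (J : EuclideanSpace ℝ (Fin m) →ₗᵢ[ℝ] EuclideanSpace ℝ (Fin (m + 1))),
      Spl (e1 (m + 1)) P J ∧ ∀ u, P u = projTail (m + 1) u
  have he : e1 (m + 1) = EuclideanSpace.single (0 : Fin (m + 1)) 1 := by
    simp [e1]
  let P₀ : EuclideanSpace ℝ (Fin (m + 1)) →ₗ[ℝ] EuclideanSpace ℝ (Fin m) :=
    { toFun := fun u => WithLp.toLp 2 (fun i => u i.succ)
      map_add' := fun u v => by ext i; simp
      map_smul' := fun c u => by ext i; simp }
  let J₀ : EuclideanSpace ℝ (Fin m) →ₗ[ℝ] EuclideanSpace ℝ (Fin (m + 1)) :=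
    { toFun := fun v => WithLp.toLp 2 (Fin.cons 0 (fun i => v i))
      map_add' := fun u v => by ext i; refine Fin.cases ?_ (fun j => ?_) i <;> simp
      map_smul' := fun c u => by ext i; refine Fin.cases ?_ (fun j => ?_) i <;> simp }
  have hP : ∀ u i, P₀ u i = u i.succ := fun u i => rfl
  have hJ0 : ∀ v, J₀ v 0 = 0 := fun v => rfl
  have hJs : ∀ v i, J₀ v (Fin.succ i) = v i := fun v i => rfl
  refine ⟨LinearMap.toContinuousLinearMap P₀, ⟨J₀, fun v => ?_⟩, ⟨?_, ?_, ?_, ?_, ?_, ?_⟩, ?_⟩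
  · rw [EuclideanSpace.norm_eq, EuclideanSpace.norm_eq, Fin.sum_univ_succ]
    simp [hJ0, hJs]
  · simp [he]
  · intro u
    change ‖P₀ u‖ ≤ _
    rw [EuclideanSpace.norm_eq, EuclideanSpace.norm_eq, Fin.sum_univ_succ]
    apply Real.sqrt_le_sqrt
    simp [hP]
    positivity
  · intro v; ext i; rfl
  · intro v
    change ⟪J₀ v, _⟫ = 0
    rw [he]
    simp [EuclideanSpace.inner_single_right, hJ0]
  · change P₀ _ = 0
    rw [he]; ext i
    simp [hP]
  · intro u
    change _ • _ + J₀ (P₀ u) = u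
    rw [he]
    ext i
    refine Fin.cases ?_ (fun j => ?_) i <;>
    simp [EuclideanSpace.inner_single_right, hJ0, hJs, hP]
  · intro u; ext i; rfl

theorem chartA {d : ℕ} {D : Set (EuclideanSpace ℝ (Fin d))} {ε₀ η : ℝ}
    {n : EuclideanSpace ℝ (Fin d) → EuclideanSpace ℝ (Fin d)}
    (hD : AssumptionD d D ε₀ η n)
    {P : EuclideanSpace ℝ (Fin d) →L[ℝ] EuclideanSpace ℝ (Fin (d - 1))}
    {J : EuclideanSpace ℝ (Fin (d - 1)) →ₗᵢ[ℝ] EuclideanSpace ℝ (Fin d)}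
    (S : Spl (e1 d) P J) (hP : ∀ u, P u = projTail d u)
    (x : EuclideanSpace ℝ (Fin d)) (A : EuclideanSpace ℝ (Fin d) →ₗᵢ[ℝ] EuclideanSpace ℝ (Fin d))
    (hx : x ∈ frontier D) (hA : A (e1 d) = n x) :
    ∃ f : EuclideanSpace ℝ (Fin (d - 1)) → ℝ,
      ContDiffOn ℝ 3 f (ball 0 ε₀) ∧ (∀ v ∈ ball 0 ε₀, 0 ≤ f v) ∧ f 0 = 0 ∧ fderiv ℝ f 0 = 0 ∧
      (∀ v ∈ ball 0 ε₀, ∀ w, η * ‖w‖ ^ 2 ≤ iteratedFDeriv ℝ 2 f v ![w, w]) ∧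
      (∀ v ∈ ball 0 ε₀, ‖iteratedFDeriv ℝ 2 f v‖ + ‖iteratedFDeriv ℝ 3 f v‖ ≤ η⁻¹) ∧
      ∀ u ∈ ball 0 ε₀, (x + A u ∈ D ↔ f (P u) < ⟪u, e1 d⟫) := by
  obtain ⟨A₀, hA₀, ψ, h1, h2, h3, h4, h5, h6, h7⟩ := hD.chart x hx
  obtain ⟨R, R', hR, hPR, hRi⟩ := S.rot A A₀ (by rw [hA, hA₀])
  have hb : ∀ v ∈ ball (0 : EuclideanSpace ℝ (Fin (d - 1))) ε₀, R' v ∈ ball 0 ε₀ := by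
    intro v hv
    rw [mem_ball_zero_iff] at *
    rwa [R'.norm_map]
  refine ⟨fun z => ψ (R' z), h1.comp R'.contDiff.contDiffOn hb, fun v hv => h2 _ (hb v hv),
    by simp [h3], ?_, ?_, ?_, ?_⟩
  · have hd : DifferentiableAt ℝ ψ (R' 0) :=
      (h1.contDiffAt (isOpen_ball.mem_nhds (hb 0 (mem_ball_self hD.eps_pos)))).differentiableAt
        (by norm_num)
    have := hd.hasFDerivAt.comp (0 : EuclideanSpace ℝ (Fin (d - 1)))
      R'.toContinuousLinearEquiv.hasFDerivAt
    have h := this.fderiv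
    rw [map_zero, h4, ContinuousLinearMap.zero_comp] at h
    exact h
  · intro v hv w
    rw [iter2_comp]
    have := h5 _ (hb v hv) (R' w)
    rwa [R'.norm_map] at this
  · intro v hv
    have e := fun k => R'.norm_iteratedFDeriv_comp_right ψ v k
    have e' : ∀ k, ‖iteratedFDeriv ℝ k (fun z => ψ (R' z)) v‖ = ‖iteratedFDeriv ℝ k ψ (R' v)‖ := e
    rw [e', e']
    exact h6 _ (hb v hv)
  · intro u hu
    have hRu : R u ∈ ball (0 : EuclideanSpace ℝ (Fin d)) ε₀ := by
      rw [mem_ball_zero_iff] at *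
      rwa [R.norm_map]
    have hm : x + A u ∈ ball x ε₀ := by
      rw [mem_ball_zero_iff] at hu
      rw [mem_ball, dist_eq_norm, add_sub_cancel_left, A.norm_map]
      exact hu
    have : x + A u ∈ D ↔ x + A u ∈ D ∩ ball x ε₀ := ⟨fun h => ⟨h, hm⟩, fun h => h.1⟩
    rw [this, h7]
    change _ ↔ ψ (R' (P u)) < _
    rw [← hPR, ← hRi u, ← hR]
    constructor
    · rintro ⟨u', ⟨-, hu'⟩, he⟩
      have : u' = R u := A₀.injective (add_left_cancel he)
      rwa [← this, hP]
    · intro h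
      refine ⟨R u, ⟨hRu, ?_⟩, rfl⟩
      rwa [← hP]

theorem front_pre {E : Type*} [NormedAddCommGroup E] [InnerProductSpace ℝ E]
    [FiniteDimensional ℝ E] (D : Set E) (x : E) (A : E →ₗᵢ[ℝ] E) (u : E) :
    u ∈ frontier {y | x + A y ∈ D} ↔ x + A u ∈ frontier D := by
  let Φ : E ≃ₜ E := (A.toLinearIsometryEquiv rfl).toHomeomorph.trans (Homeomorph.addLeft x)
  have := Φ.preimage_frontier D
  have h2 : Φ ⁻¹' D = {y | x + A y ∈ D} := rfl
  rw [← h2, ← this]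
  rfl

/-- uniform parameterization of the rotated domains `D_{x,A}`:
there exist `ε₁, η', C > 0` and, for each `x ∈ ∂D` and `A ∈ I_x`, a `C³` strongly convex
function `ψ_{x,A}` on `B_{d−1}(0,ε₁)` describing `D_{x,A}` near `0`, with (ii) comparison
between `dist(u, ∂D_{x,A})` and `|u·e₁ − ψ_{x,A}(u₂,…,u_d)|` and (iii) the Lipschitz
estimate `|ψ_{x,A}(v) − ψ_{x',A'}(v)| ≤ C ρ(x,x',A,A') |v|²`. -/
theorem stmt_12 (d : ℕ) (D : Set (EuclideanSpace ℝ (Fin d))) (ε₀ η : ℝ)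
    (n : EuclideanSpace ℝ (Fin d) → EuclideanSpace ℝ (Fin d))
    (hD : AssumptionD d D ε₀ η n) :
    ∃ ε₁ η' C : ℝ, 0 < ε₁ ∧ 0 < η' ∧ 0 < C ∧
      ∃ ψf : EuclideanSpace ℝ (Fin d) →
          (EuclideanSpace ℝ (Fin d) →ₗᵢ[ℝ] EuclideanSpace ℝ (Fin d)) →
          EuclideanSpace ℝ (Fin (d - 1)) → ℝ,
        (∀ x ∈ frontier D,
          ∀ A : EuclideanSpace ℝ (Fin d) →ₗᵢ[ℝ] EuclideanSpace ℝ (Fin d), A (e1 d) = n x →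
            ContDiffOn ℝ 3 (ψf x A) (Metric.ball (0 : EuclideanSpace ℝ (Fin (d - 1))) ε₁) ∧
            (∀ v ∈ Metric.ball (0 : EuclideanSpace ℝ (Fin (d - 1))) ε₁, 0 ≤ ψf x A v) ∧
            ψf x A 0 = 0 ∧
            fderiv ℝ (ψf x A) 0 = 0 ∧
            (∀ v ∈ Metric.ball (0 : EuclideanSpace ℝ (Fin (d - 1))) ε₁,
              ∀ w : EuclideanSpace ℝ (Fin (d - 1)),
                η' * ‖w‖ ^ 2 ≤ iteratedFDeriv ℝ 2 (ψf x A) v ![w, w]) ∧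
            (∀ v ∈ Metric.ball (0 : EuclideanSpace ℝ (Fin (d - 1))) ε₁,
              ‖iteratedFDeriv ℝ 2 (ψf x A) v‖ + ‖iteratedFDeriv ℝ 3 (ψf x A) v‖ ≤ C) ∧
            {y : EuclideanSpace ℝ (Fin d) | x + A y ∈ D} ∩
                Metric.ball (0 : EuclideanSpace ℝ (Fin d)) ε₁ =
              {u : EuclideanSpace ℝ (Fin d) |
                u ∈ Metric.ball (0 : EuclideanSpace ℝ (Fin d)) ε₁ ∧
                ψf x A (projTail d u) < ⟪u, e1 d⟫} ∧
            (∀ u ∈ Metric.ball (0 : EuclideanSpace ℝ (Fin d)) ε₁,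
              1 / 2 * |⟪u, e1 d⟫ - ψf x A (projTail d u)| ≤
                  Metric.infDist u
                    (frontier {y : EuclideanSpace ℝ (Fin d) | x + A y ∈ D}) ∧
                Metric.infDist u
                    (frontier {y : EuclideanSpace ℝ (Fin d) | x + A y ∈ D}) ≤
                  |⟪u, e1 d⟫ - ψf x A (projTail d u)|)) ∧
        (∀ x ∈ frontier D, ∀ x' ∈ frontier D,
          ∀ A : EuclideanSpace ℝ (Fin d) →ₗᵢ[ℝ] EuclideanSpace ℝ (Fin d), A (e1 d) = n x →
          ∀ A' : EuclideanSpace ℝ (Fin d) →ₗᵢ[ℝ] EuclideanSpace ℝ (Fin d), A' (e1 d) = n x' →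
          ∀ v ∈ Metric.ball (0 : EuclideanSpace ℝ (Fin (d - 1))) ε₁,
            |ψf x A v - ψf x' A' v| ≤
              C * (‖x - x'‖ + ‖A.toContinuousLinearMap - A'.toContinuousLinearMap‖)
                * ‖v‖ ^ 2) := by
  obtain ⟨P, J, S, hP⟩ := exists_spl d hD.dim_ge
  have hch := fun x A hx hA => chartA hD S hP x A hx hA
  choose! f h1 h2 h3 h4 h5 h6 h7 using hch
  have hη := hD.eta_pos
  have hε := hD.eps_pos
  set M := η⁻¹ with hM
  have hM0 : 0 < M := inv_pos.2 hη
  set r := min ε₀ η with hr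
  have hr0 : 0 < r := lt_min hε hη
  have hrε : r ≤ ε₀ := min_le_left _ _
  have hMr : M * r ≤ 1 := by
    rw [hM, inv_mul_le_iff₀ hη, mul_one]; exact min_le_right _ _
  have hsub : ∀ {G : Type} [NormedAddCommGroup G], ball (0 : G) (r / 8) ⊆ ball (0 : G) ε₀ :=
    fun {G} _ => ball_subset_ball (by linarith)
  have hsub' : ∀ {G : Type} [NormedAddCommGroup G], ball (0 : G) r ⊆ ball (0 : G) ε₀ :=
    fun {G} _ => ball_subset_ball hrε
  have hreg : ∀ x A, x ∈ frontier D → A (e1 d) = n x → Reg (f x A) r M := fun x A hx hA =>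
    Reg.of_contDiffOn hr0 hM0 hMr (h3 x A hx hA) (h4 x A hx hA) ((h1 x A hx hA).mono hsub')
      (fun v hv => h6 x A hx hA v (hsub' hv))
  have hfr : ∀ x A, x ∈ frontier D → A (e1 d) = n x → ∀ u ∈ ball (0 : EuclideanSpace ℝ (Fin d)) r,
      (u ∈ frontier {y | x + A y ∈ D} ↔ f x A (P u) = ⟪u, e1 d⟫) := fun x A hx hA u hu =>
    S.front (hD.isOpen.preimage (by fun_prop : Continuous fun y => x + A y))
      (fun p hp => ((hreg x A hx hA).d1 p hp).continuousAt)
      (fun w hw => h7 x A hx hA w (hsub' hw)) hu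
  refine ⟨r / 8, η, 4 * M + 16 * M / r, by positivity, hη, by positivity, f, ?_, ?_⟩
  · intro x hx A hA
    refine ⟨(h1 x A hx hA).mono hsub, fun v hv => h2 x A hx hA v (hsub hv), h3 x A hx hA,
      h4 x A hx hA, fun v hv => h5 x A hx hA v (hsub hv), fun v hv =>
      (h6 x A hx hA v (hsub hv)).trans ?_, ?_, ?_⟩
    · have : 0 < 16 * M / r := by positivity
      linarith
    · ext u
      constructor
      · rintro ⟨ha, hb⟩
        exact ⟨hb, by rw [← hP]; exact (h7 x A hx hA u (hsub hb)).1 ha⟩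
      · rintro ⟨hb, ha⟩
        rw [← hP] at ha
        exact ⟨(h7 x A hx hA u (hsub hb)).2 ha, hb⟩
    · intro u hu
      rw [← hP]
      exact S.distC (hreg x A hx hA) (hfr x A hx hA) hu
  · intro x hx x' hx' A hA A' hA' v hv
    have hf := hreg x A hx hA
    have hg := hreg x' A' hx' hA'
    have hvr : v ∈ ball (0 : EuclideanSpace ℝ (Fin (d - 1))) r :=
      ball_subset_ball (by linarith) hv
    set ρ := ‖x - x'‖ + ‖A.toContinuousLinearMap - A'.toContinuousLinearMap‖ with hρ
    have hρ0 : 0 ≤ ρ := by positivity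
    by_cases hc : ρ ≤ r / 8
    · have hAA : ∀ u, ‖A' u - A u‖ ≤ ρ * ‖u‖ := by
        intro u
        have h := (A.toContinuousLinearMap - A'.toContinuousLinearMap).le_opNorm u
        have h' : ‖A u - A' u‖ ≤
          ‖A.toContinuousLinearMap - A'.toContinuousLinearMap‖ * ‖u‖ := h
        rw [norm_sub_rev]
        refine h'.trans ?_
        gcongr
        rw [hρ]; linarith [norm_nonneg (x - x')]
      let A₁ := A.toLinearIsometryEquiv rfl
      have hA1 : ∀ u, A₁ u = A u := fun u => rfl
      let B : EuclideanSpace ℝ (Fin d) →ₗᵢ[ℝ] EuclideanSpace ℝ (Fin d) :=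
        A₁.symm.toLinearIsometry.comp A'
      have hB : ∀ u, A (B u) = A' u := fun u => A₁.apply_symm_apply _
      have hb : A (A₁.symm (x' - x)) = x' - x := A₁.apply_symm_apply _
      have key := S.part3 hf hg B (A₁.symm (x' - x)) (ρ := ρ) ?_ hc ?_ ?_ v hv
      · refine key.trans ?_
        have : 0 ≤ 16 * M / r * ρ * ‖v‖ ^ 2 := by positivity
        nlinarith
      · rw [A₁.symm.norm_map, norm_sub_rev, hρ]
        linarith [norm_nonneg (A.toContinuousLinearMap - A'.toContinuousLinearMap)]
      · intro u
        rw [← A.norm_map, map_sub, hB]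
        exact hAA u
      · intro w hw
        have hwn := mem_ball_zero_iff.1 hw
        have hwr : w ∈ ball (0 : EuclideanSpace ℝ (Fin (d - 1))) r :=
          ball_subset_ball (by linarith) hw
        set p := f x' A' w • e1 d + J w with hp
        have hpn : ‖p‖ ≤ ‖w‖ + ‖w‖ := by
          refine (norm_add_le _ _).trans ?_
          rw [norm_smul, S.ne, J.norm_map, Real.norm_eq_abs, mul_one]
          linarith [hg.le_norm hwr]
        have hPp : P p = w := by simp [hp, S.Pe, S.PJ]
        have hpe : ⟪p, e1 d⟫ = f x' A' w := by
          rw [hp, inner_add_left, inner_smul_left, S.ee, S.Je]; simp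
        have hpf := (hfr x' A' hx' hA' p (by rw [mem_ball_zero_iff]; linarith)).2
          (by rw [hPp, hpe])
        rw [front_pre] at hpf
        refine (hfr x A hx hA _ ?_).1 ?_
        · rw [mem_ball_zero_iff]
          refine (norm_add_le _ _).trans_lt ?_
          rw [A₁.symm.norm_map, B.norm_map, norm_sub_rev]
          have : ‖x - x'‖ ≤ ρ := by
            rw [hρ]
            linarith [norm_nonneg (A.toContinuousLinearMap - A'.toContinuousLinearMap)]
          linarith
        · rw [front_pre, map_add, hb, hB]
          convert hpf using 1
          abel
    · rw [not_le] at hc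
      have a1 := hf.le_sq hvr
      have a2 := hg.le_sq hvr
      have a3 := abs_sub (f x A v) (f x' A' v)
      have a4 : 2 ≤ 16 / r * ρ := by
        rw [div_mul_eq_mul_div, le_div_iff₀ hr0]; linarith
      have a5 : 2 * (M * ‖v‖ ^ 2) ≤ 16 / r * ρ * (M * ‖v‖ ^ 2) := by gcongr
      have a6 : 0 ≤ 4 * M * ρ * ‖v‖ ^ 2 := by positivity
      have a7 : (4 * M + 16 * M / r) * ρ * ‖v‖ ^ 2 =
        4 * M * ρ * ‖v‖ ^ 2 + 16 / r * ρ * (M * ‖v‖ ^ 2) := by ring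
      rw [a7]
      linarith
end
end

section
/- Let D ⊂ ℝ^d satisfy Assumption (D) with data (ε₀, η, n). Then there exists M > 0 such that for all x, x' ∈ ∂D, all A ∈ I_x and A' ∈ I_{x'}, every y ∈ D_{x,A} ∩ D_{x',A'} and every v ∈ closure(D_{x',A'}) ∖ D_{x,A}, the segment [y,v] meets ∂D_{x,A} at a unique point a = a(x,y,v), and |a − v| · dist(y, ∂D_{x,A}) ≤ M ρ(x,x',A,A') |y| |y − v|. -/
open Metric Set Bornology
open scoped RealInnerProductSpace

noncomputable section

section calc3
variable {F : Type*} [NormedAddCommGroup F] [NormedSpace ℝ F]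

set_option maxSynthPendingDepth 5 in
set_option synthInstance.maxHeartbeats 200000 in
theorem calcA {ψ : F → ℝ} {ε L : ℝ} 
    (hc : ContDiffOn ℝ 3 ψ (ball (0:F) ε))
    (hb : ∀ v ∈ ball (0:F) ε, ‖iteratedFDeriv ℝ 2 ψ v‖ + ‖iteratedFDeriv ℝ 3 ψ v‖ ≤ L) :
    (∀ z ∈ ball (0:F) ε, HasFDerivAt ψ (fderiv ℝ ψ z) z) ∧
    (∀ z ∈ ball (0:F) ε, HasFDerivAt (fderiv ℝ ψ) (fderiv ℝ (fderiv ℝ ψ) z) z) ∧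
    (∀ z ∈ ball (0:F) ε, ∀ w ∈ ball (0:F) ε, ‖fderiv ℝ ψ z - fderiv ℝ ψ w‖ ≤ L * ‖z - w‖) ∧
    (∀ z ∈ ball (0:F) ε, ∀ w ∈ ball (0:F) ε,
      ‖fderiv ℝ (fderiv ℝ ψ) z - fderiv ℝ (fderiv ℝ ψ) w‖ ≤ L * ‖z - w‖) := by
  have ho : IsOpen (ball (0:F) ε) := isOpen_ball
  have h1 : ContDiffOn ℝ 2 (fderiv ℝ ψ) (ball (0:F) ε) := hc.fderiv_of_isOpen ho (by norm_num)
  have h2 : ContDiffOn ℝ 1 (fderiv ℝ (fderiv ℝ ψ)) (ball (0:F) ε) :=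
    h1.fderiv_of_isOpen ho (by norm_num)
  have d0 : ∀ z ∈ ball (0:F) ε, HasFDerivAt ψ (fderiv ℝ ψ z) z := fun z hz =>
    ((hc.differentiableOn (by norm_num)).differentiableAt (ho.mem_nhds hz)).hasFDerivAt
  have d1 : ∀ z ∈ ball (0:F) ε, HasFDerivAt (fderiv ℝ ψ) (fderiv ℝ (fderiv ℝ ψ) z) z :=
    fun z hz => ((h1.differentiableOn (by norm_num)).differentiableAt (ho.mem_nhds hz)).hasFDerivAt
  have d2 : ∀ z ∈ ball (0:F) ε, HasFDerivAt (fderiv ℝ (fderiv ℝ ψ)) 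
      (fderiv ℝ (fderiv ℝ (fderiv ℝ ψ)) z) z :=
    fun z hz => ((h2.differentiableOn (by norm_num)).differentiableAt (ho.mem_nhds hz)).hasFDerivAt
  have b1 : ∀ z ∈ ball (0:F) ε, ‖fderiv ℝ (fderiv ℝ ψ) z‖ ≤ L := by
    intro z hz
    have := hb z hz
    rw [← norm_iteratedFDeriv_one, norm_iteratedFDeriv_fderiv]
    have h0 := norm_nonneg (iteratedFDeriv ℝ 3 ψ z)
    change ‖iteratedFDeriv ℝ 2 ψ z‖ ≤ L
    linarith
  have b2 : ∀ z ∈ ball (0:F) ε, ‖fderiv ℝ (fderiv ℝ (fderiv ℝ ψ)) z‖ ≤ L := by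
    intro z hz
    have := hb z hz
    rw [← norm_iteratedFDeriv_one, norm_iteratedFDeriv_fderiv, norm_iteratedFDeriv_fderiv]
    have h0 := norm_nonneg (iteratedFDeriv ℝ 2 ψ z)
    change ‖iteratedFDeriv ℝ 3 ψ z‖ ≤ L
    linarith
  refine ⟨d0, d1, ?_, ?_⟩
  · intro z hz w hw
    exact (convex_ball (0:F) ε).norm_image_sub_le_of_norm_hasFDerivWithin_le
      (fun x hx => (d1 x hx).hasFDerivWithinAt) b1 hw hz
  · intro z hz w hw
    exact (convex_ball (0:F) ε).norm_image_sub_le_of_norm_hasFDerivWithin_le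
      (fun x hx => (d2 x hx).hasFDerivWithinAt) b2 hw hz

/-- remainder comparison -/
theorem calcB {ψ : F → ℝ} {g : F → F →L[ℝ] ℝ} {H : F → F →L[ℝ] F →L[ℝ] ℝ} {ε L : ℝ} (hL : 0 ≤ L)
    (d0 : ∀ z ∈ ball (0:F) ε, HasFDerivAt ψ (g z) z)
    (d1 : ∀ z ∈ ball (0:F) ε, HasFDerivAt g (H z) z)
    (l2 : ∀ z ∈ ball (0:F) ε, ∀ w ∈ ball (0:F) ε, ‖H z - H w‖ ≤ L * ‖z - w‖)
    (h0 : ψ 0 = 0) (g0 : g 0 = 0) (b q : F) (hbq : ‖b‖ + ‖q‖ < ε) :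
    |ψ (b + q) - ψ b - g b q - ψ q| ≤ L * ‖b‖ * ‖q‖ ^ 2 := by
  have hq0 := norm_nonneg q
  have hb0 := norm_nonneg b
  have mem1 : ∀ z ∈ closedBall (0:F) ‖q‖, z ∈ ball (0:F) ε := by
    intro z hz; simp at hz ⊢; linarith
  have mem2 : ∀ z ∈ closedBall (0:F) ‖q‖, b + z ∈ ball (0:F) ε := by
    intro z hz; simp at hz ⊢; linarith [norm_add_le b z]
  have bm : b ∈ ball (0:F) ε := by simp; linarith
  have zm : (0:F) ∈ closedBall (0:F) ‖q‖ := by simp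
  have qm : q ∈ closedBall (0:F) ‖q‖ := by simp
  have A : ∀ z ∈ closedBall (0:F) ‖q‖, ‖g (b + z) - g b - g z‖ ≤ L * ‖b‖ * ‖q‖ := by
    intro z hz
    have := (convex_closedBall (0:F) ‖q‖).norm_image_sub_le_of_norm_hasFDerivWithin_le
      (f := fun z => g (b + z) - g z) (f' := fun z => H (b + z) - H z) (C := L * ‖b‖)
      (fun x hx => by
        have e1 := (d1 (b + x) (mem2 x hx)).comp x ((hasFDerivAt_id x).const_add b)
        exact (e1.sub (d1 x (mem1 x hx))).hasFDerivWithinAt)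
      (fun x hx => by simpa using l2 (b + x) (mem2 x hx) x (mem1 x hx)) zm hz
    simp only [add_zero, g0, sub_zero] at this
    have e : g (b + z) - g b - g z = g (b + z) - g z - g b := by abel
    rw [e]
    refine this.trans ?_
    have : ‖z‖ ≤ ‖q‖ := by simpa using hz
    gcongr
  have := (convex_closedBall (0:F) ‖q‖).norm_image_sub_le_of_norm_hasFDerivWithin_le
      (f := fun z => ψ (b + z) - ψ b - g b z - ψ z) (f' := fun z => g (b + z) - g b - g z)
      (C := L * ‖b‖ * ‖q‖)
      (fun x hx => by
        have e1 := (d0 (b + x) (mem2 x hx)).comp x ((hasFDerivAt_id x).const_add b)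
        exact (((e1.sub_const (ψ b)).sub (g b).hasFDerivAt).sub (d0 x (mem1 x hx))).hasFDerivWithinAt)
      A zm qm
  simp [h0] at this
  calc _ ≤ _ := this
    _ = _ := by ring

theorem calcC {ψ : F → ℝ} {g : F → F →L[ℝ] ℝ} {ε L : ℝ} (hL : 0 ≤ L)
    (d0 : ∀ z ∈ ball (0:F) ε, HasFDerivAt ψ (g z) z)
    (l1 : ∀ z ∈ ball (0:F) ε, ∀ w ∈ ball (0:F) ε, ‖g z - g w‖ ≤ L * ‖z - w‖)
    (g0 : g 0 = 0) (p q : F) (r : ℝ) (hr : r < ε) (hp : ‖p‖ ≤ r) (hq : ‖q‖ ≤ r) :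
    |ψ p - ψ q| ≤ L * r * ‖p - q‖ := by
  have mem1 : ∀ z ∈ closedBall (0:F) r, z ∈ ball (0:F) ε := by
    intro z hz; simp at hz ⊢; linarith
  have z0 : (0:F) ∈ ball (0:F) ε := by simp; linarith [norm_nonneg p]
  exact (convex_closedBall (0:F) r).norm_image_sub_le_of_norm_hasFDerivWithin_le
    (fun x hx => (d0 x (mem1 x hx)).hasFDerivWithinAt)
    (fun x hx => by
      have := l1 x (mem1 x hx) 0 z0
      simp only [g0, sub_zero] at this
      refine this.trans ?_
      have : ‖x‖ ≤ r := by simpa using hx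
      gcongr) (by simpa using hq) (by simpa using hp)

theorem calcD {ψ : F → ℝ} {g : F → F →L[ℝ] ℝ} {H : F → F →L[ℝ] F →L[ℝ] ℝ} {ε η : ℝ}
    (d0 : ∀ z ∈ ball (0:F) ε, HasFDerivAt ψ (g z) z)
    (d1 : ∀ z ∈ ball (0:F) ε, HasFDerivAt g (H z) z)
    (hH : ∀ z ∈ ball (0:F) ε, ∀ w, η * ‖w‖ ^ 2 ≤ H z w w)
    (h0 : ψ 0 = 0) (g0 : g 0 = 0) (q : F) (hq : ‖q‖ < ε) :
    η / 2 * ‖q‖ ^ 2 ≤ ψ q := by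
  have mem : ∀ t ∈ Icc (0:ℝ) 1, t • q ∈ ball (0:F) ε := by
    intro t ht
    simp only [mem_ball_zero_iff, norm_smul, Real.norm_eq_abs, abs_of_nonneg ht.1]
    nlinarith [ht.1, ht.2, norm_nonneg q]
  have lin : ∀ t : ℝ, HasDerivAt (fun t : ℝ => t • q) q t := fun t => by
    simpa using (hasDerivAt_id t).smul_const q
  have e1 : ∀ t ∈ Icc (0:ℝ) 1, HasDerivAt (fun t : ℝ => g (t • q) q - η * ‖q‖^2 * t)
      (H (t • q) q q - η * ‖q‖^2) t := by
    intro t ht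
    have a := (d1 _ (mem t ht)).comp_hasDerivAt t (lin t)
    have b := a.clm_apply (hasDerivAt_const t q)
    have c := b.sub ((hasDerivAt_id t).const_mul (η * ‖q‖^2))
    refine HasDerivAt.congr_deriv (f := fun t : ℝ => g (t • q) q - η * ‖q‖^2 * t) c ?_
    simp
  have m1 : MonotoneOn (fun t : ℝ => g (t • q) q - η * ‖q‖^2 * t) (Icc 0 1) := by
    refine monotoneOn_of_hasDerivWithinAt_nonneg (convex_Icc 0 1)
      (fun t ht => (e1 t ht).continuousAt.continuousWithinAt)
      (fun t ht => (e1 t (interior_subset ht)).hasDerivWithinAt) (fun t ht => ?_)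
    linarith [hH _ (mem t (interior_subset ht)) q]
  have e2 : ∀ t ∈ Icc (0:ℝ) 1, HasDerivAt (fun t : ℝ => ψ (t • q) - η * ‖q‖^2 / 2 * t ^ 2)
      (g (t • q) q - η * ‖q‖^2 * t) t := by
    intro t ht
    have a := (d0 _ (mem t ht)).comp_hasDerivAt t (lin t)
    have c := a.sub (((hasDerivAt_id t).pow 2).const_mul (η * ‖q‖^2/2))
    refine HasDerivAt.congr_deriv (f := fun t : ℝ => ψ (t • q) - η * ‖q‖^2 / 2 * t ^ 2) c ?_
    simp only [id_eq]; ring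
  have m2 : MonotoneOn (fun t : ℝ => ψ (t • q) - η * ‖q‖^2 / 2 * t ^ 2) (Icc 0 1) := by
    refine monotoneOn_of_hasDerivWithinAt_nonneg (convex_Icc 0 1)
      (fun t ht => (e2 t ht).continuousAt.continuousWithinAt)
      (fun t ht => (e2 t (interior_subset ht)).hasDerivWithinAt) (fun t ht => ?_)
    have := m1 (left_mem_Icc.2 zero_le_one) (interior_subset ht) (interior_subset ht).1
    simpa [g0] using this
  have := m2 (left_mem_Icc.2 zero_le_one) (right_mem_Icc.2 zero_le_one) zero_le_one
  simp [h0] at this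
  linarith

end calc3

section linalg

theorem pt_add (d : ℕ) (u w : EuclideanSpace ℝ (Fin d)) :
    projTail d (u + w) = projTail d u + projTail d w := by
  ext i; simp [projTail]

theorem pt_smul (d : ℕ) (c : ℝ) (u : EuclideanSpace ℝ (Fin d)) :
    projTail d (c • u) = c • projTail d u := by
  ext i; simp [projTail]

theorem pt_sub (d : ℕ) (u w : EuclideanSpace ℝ (Fin d)) :
    projTail d (u - w) = projTail d u - projTail d w := by
  ext i; simp [projTail]

theorem pt_e1 (d : ℕ) : projTail d (e1 d) = 0 := by
  ext i
  have : 0 < d := by have := i.isLt; omega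
  simp [projTail, e1, this]

theorem e1_norm (d : ℕ) (h : 2 ≤ d) : ‖e1 d‖ = 1 := by
  have : 0 < d := by omega
  simp [e1, this]

theorem e1_inner (d : ℕ) (h : 2 ≤ d) : ⟪e1 d, e1 d⟫ = (1:ℝ) := by
  rw [real_inner_self_eq_norm_sq, e1_norm d h]; norm_num

theorem inner_dec (d : ℕ) (h : 2 ≤ d) (u w : EuclideanSpace ℝ (Fin d)) :
    ⟪u, w⟫ = ⟪u, e1 d⟫ * ⟪w, e1 d⟫ + ⟪projTail d u, projTail d w⟫ := by
  obtain ⟨m, rfl⟩ : ∃ m, d = m + 1 := ⟨d - 1, by omega⟩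
  have : ∀ u : EuclideanSpace ℝ (Fin (m+1)), ⟪u, e1 (m+1)⟫ = u 0 := by
    intro u
    simp [e1, EuclideanSpace.inner_single_right]
  rw [this, this]
  simp only [PiLp.inner_apply, Fin.sum_univ_succ]
  simp [projTail, mul_comm]
  rfl

theorem norm_dec (d : ℕ) (h : 2 ≤ d) (u : EuclideanSpace ℝ (Fin d)) :
    ‖u‖ ^ 2 = ⟪u, e1 d⟫ ^ 2 + ‖projTail d u‖ ^ 2 := by
  rw [← real_inner_self_eq_norm_sq, inner_dec d h, real_inner_self_eq_norm_sq]; ring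

theorem pt_norm_le (d : ℕ) (h : 2 ≤ d) (u : EuclideanSpace ℝ (Fin d)) :
    ‖projTail d u‖ ≤ ‖u‖ := by
  have := norm_dec d h u
  apply le_of_sq_le_sq _ (norm_nonneg u)
  nlinarith [sq_nonneg ⟪u, e1 d⟫]

theorem e1_abs_le (d : ℕ) (h : 2 ≤ d) (u : EuclideanSpace ℝ (Fin d)) :
    |⟪u, e1 d⟫| ≤ ‖u‖ := by
  simpa [e1_norm d h] using abs_real_inner_le_norm u (e1 d)

theorem norm_le_dec (d : ℕ) (h : 2 ≤ d) (u : EuclideanSpace ℝ (Fin d)) :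
    ‖u‖ ≤ |⟪u, e1 d⟫| + ‖projTail d u‖ := by
  have := norm_dec d h u
  apply le_of_sq_le_sq _ (by positivity)
  rw [this, ← sq_abs ⟪u, e1 d⟫]
  nlinarith [mul_nonneg (abs_nonneg ⟪u, e1 d⟫) (norm_nonneg (projTail d u))]

theorem lift_ex (d : ℕ) (h : 2 ≤ d) (s : ℝ) (z : EuclideanSpace ℝ (Fin (d-1))) :
    ∃ u : EuclideanSpace ℝ (Fin d), projTail d u = z ∧ ⟪u, e1 d⟫ = s := by
  obtain ⟨m, rfl⟩ : ∃ m, d = m + 1 := ⟨d - 1, by omega⟩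
  refine ⟨WithLp.toLp 2 (Fin.cons s (fun i => z i)), ?_, ?_⟩
  · ext i
    simp only [projTail]
    rfl
  · simp [e1, EuclideanSpace.inner_single_right]

theorem pt_cont (d : ℕ) : Continuous (projTail d) := by
  unfold projTail
  fun_prop

end linalg

structure ChartP (d : ℕ) (D : Set (EuclideanSpace ℝ (Fin d))) (x nx : EuclideanSpace ℝ (Fin d))
    (ε η L : ℝ)
    (A₀ : EuclideanSpace ℝ (Fin d) ≃ₗᵢ[ℝ] EuclideanSpace ℝ (Fin d))
    (ψ : EuclideanSpace ℝ (Fin (d - 1)) → ℝ)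
    (g : EuclideanSpace ℝ (Fin (d - 1)) → EuclideanSpace ℝ (Fin (d - 1)) →L[ℝ] ℝ)
    (H : EuclideanSpace ℝ (Fin (d - 1)) → EuclideanSpace ℝ (Fin (d - 1)) →L[ℝ]
      EuclideanSpace ℝ (Fin (d - 1)) →L[ℝ] ℝ) : Prop where
  he : A₀ (e1 d) = nx
  d0 : ∀ z ∈ ball (0 : EuclideanSpace ℝ (Fin (d - 1))) ε, HasFDerivAt ψ (g z) z
  d1 : ∀ z ∈ ball (0 : EuclideanSpace ℝ (Fin (d - 1))) ε, HasFDerivAt g (H z) z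
  l1 : ∀ z ∈ ball (0 : EuclideanSpace ℝ (Fin (d - 1))) ε,
    ∀ w ∈ ball (0 : EuclideanSpace ℝ (Fin (d - 1))) ε, ‖g z - g w‖ ≤ L * ‖z - w‖
  l2 : ∀ z ∈ ball (0 : EuclideanSpace ℝ (Fin (d - 1))) ε,
    ∀ w ∈ ball (0 : EuclideanSpace ℝ (Fin (d - 1))) ε, ‖H z - H w‖ ≤ L * ‖z - w‖
  nn : ∀ z ∈ ball (0 : EuclideanSpace ℝ (Fin (d - 1))) ε, 0 ≤ ψ z
  h0 : ψ 0 = 0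
  g0 : g 0 = 0
  low : ∀ z : EuclideanSpace ℝ (Fin (d - 1)), ‖z‖ < ε → η / 2 * ‖z‖ ^ 2 ≤ ψ z
  mem : ∀ u, ‖u‖ < ε → (x + A₀ u ∈ D ↔ ψ (projTail d u) < ⟪u, e1 d⟫)
  fr : ∀ u, ‖u‖ < ε → (x + A₀ u ∈ frontier D ↔ ψ (projTail d u) = ⟪u, e1 d⟫)

theorem chart_ex {d : ℕ} {D : Set (EuclideanSpace ℝ (Fin d))} {ε η : ℝ}
    {n : EuclideanSpace ℝ (Fin d) → EuclideanSpace ℝ (Fin d)}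
    (hD : AssumptionD d D ε η n) (x : EuclideanSpace ℝ (Fin d)) (hx : x ∈ frontier D) :
    ∃ A₀ ψ g H, ChartP d D x (n x) ε η η⁻¹ A₀ ψ g H := by
  obtain ⟨A₁, hA, ψ, hc, hnn, h0, g0, hH, hb, him⟩ := hD.chart x hx
  have hd := hD.dim_ge
  obtain ⟨d0, d1, l1, l2⟩ := calcA hc hb
  let A₀ := A₁.toLinearIsometryEquiv rfl
  have mem : ∀ u, ‖u‖ < ε → (x + A₀ u ∈ D ↔ ψ (projTail d u) < ⟪u, e1 d⟫) := by
    intro u hu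
    constructor
    · intro h
      have : x + A₀ u ∈ D ∩ ball x ε := ⟨h, by simpa using hu⟩
      rw [him] at this
      obtain ⟨u', ⟨-, hu'⟩, e⟩ := this
      have : u' = u := A₀.injective (add_left_cancel e)
      rwa [← this]
    · intro h
      have : x + A₀ u ∈ D ∩ ball x ε := by
        rw [him]
        exact ⟨u, ⟨by simpa using hu, h⟩, rfl⟩
      exact this.1
  refine ⟨A₀, ψ, fderiv ℝ ψ, fderiv ℝ (fderiv ℝ ψ), hA, d0, d1, l1, l2, hnn, h0, g0, ?_, mem, ?_⟩
  · intro z hz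
    refine calcD d0 d1 (fun z hz w => ?_) h0 g0 z hz
    have := hH z hz w
    rw [iteratedFDeriv_two_apply] at this
    simpa using this
  · intro u hu
    have hpu : projTail d u ∈ ball (0 : EuclideanSpace ℝ (Fin (d - 1))) ε := by
      simpa using (pt_norm_le d hd u).trans_lt hu
    constructor
    · intro h
      have hnD : x + A₀ u ∉ D := fun h' => (hD.isOpen.frontier_eq ▸ h).2 h'
      rw [mem u hu, not_lt] at hnD
      refine le_antisymm ?_ hnD
      by_contra hlt
      push Not at hlt
      have c1 : ContinuousAt (fun u => ψ (projTail d u) - ⟪u, e1 d⟫) u := by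
        have := (d0 _ hpu).continuousAt
        have h2 := ContinuousAt.comp (f := projTail d) (x := u) this (pt_cont d).continuousAt
        exact h2.sub (by fun_prop)
      have ev : ∀ᶠ w in nhds u, 0 < ψ (projTail d w) - ⟪w, e1 d⟫ :=
        c1.eventually_const_lt (by linarith)
      have ev2 : ∀ᶠ w in nhds u, ‖w‖ < ε :=
        (continuous_norm.continuousAt (x := u)).eventually_lt_const hu
      have ev3 : ∀ᶠ w in nhds u, x + A₀ w ∉ D := by
        filter_upwards [ev, ev2] with w h1 h2
        rw [mem w h2]; linarith
      have hcl : x + A₀ u ∈ closure D := h.1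
      have tend : Filter.Tendsto (fun z => A₀.symm (z - x)) (nhds (x + A₀ u)) (nhds u) := by
        have : ContinuousAt (fun z => A₀.symm (z - x)) (x + A₀ u) := by fun_prop
        simpa [ContinuousAt] using this
      have ev4 := tend.eventually ev3
      have := (mem_closure_iff_frequently.1 hcl).and_eventually ev4
      obtain ⟨z, hz, hz'⟩ := this.exists
      simp at hz'
      exact hz' hz
    · intro h
      have hnD : x + A₀ u ∉ D := by rw [mem u hu]; linarith
      rw [hD.isOpen.frontier_eq]
      refine ⟨?_, hnD⟩
      have c : Filter.Tendsto (fun t : ℝ => x + A₀ (u + t • e1 d)) (nhdsWithin 0 (Ioi 0))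
          (nhds (x + A₀ u)) := by
        have : Continuous (fun t : ℝ => x + A₀ (u + t • e1 d)) := by fun_prop
        simpa using (this.tendsto 0).mono_left nhdsWithin_le_nhds
      refine mem_closure_of_tendsto c ?_
      have c2 : Filter.Tendsto (fun t : ℝ => ‖u + t • e1 d‖) (nhdsWithin 0 (Ioi 0))
          (nhds ‖u‖) := by
        have : Continuous (fun t : ℝ => ‖u + t • e1 d‖) := by fun_prop
        simpa using (this.tendsto 0).mono_left nhdsWithin_le_nhds
      filter_upwards [c2.eventually_lt_const hu, self_mem_nhdsWithin] with t ht ht0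
      rw [mem _ ht, pt_add, pt_smul, pt_e1, inner_add_left, inner_smul_left, e1_inner d hd]
      simp at ht0 ⊢
      linarith

section geo

theorem seg_frontier {E : Type*} [NormedAddCommGroup E] [NormedSpace ℝ E] {D : Set E}
    (ho : IsOpen D) {P Q : E} (hP : P ∈ D) (hQ : Q ∉ D) : ∃ Z ∈ segment ℝ P Q, Z ∈ frontier D := by
  by_contra hcon
  push Not at hcon
  have hpre : IsPreconnected (segment ℝ P Q) := (convex_segment P Q).isPreconnected
  have := hpre D (closure D)ᶜ ho isClosed_closure.isOpen_compl
    (fun z hz => by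
      by_contra h
      simp only [mem_union, mem_compl_iff, not_or, not_not] at h
      exact hcon z hz (by rw [ho.frontier_eq]; exact ⟨h.2, h.1⟩))
    ⟨P, left_mem_segment ℝ P Q, hP⟩
    ⟨Q, right_mem_segment ℝ P Q, fun h => hcon Q (right_mem_segment ℝ P Q)
      (by rw [ho.frontier_eq]; exact ⟨h, hQ⟩)⟩
  obtain ⟨z, -, h1, h2⟩ := this
  exact h2 (subset_closure h1)

theorem infDist_le_of_not_mem {E : Type*} [NormedAddCommGroup E] [NormedSpace ℝ E] {D : Set E}
    (ho : IsOpen D) {P Q : E} (hP : P ∈ D) (hQ : Q ∉ D) : infDist P (frontier D) ≤ ‖Q - P‖ := by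
  obtain ⟨Z, hZ, hf⟩ := seg_frontier ho hP hQ
  refine (infDist_le_dist_of_mem hf).trans ?_
  rw [segment_eq_image'] at hZ
  obtain ⟨t, ht, rfl⟩ := hZ
  simp only [dist_self_add_right, norm_smul, Real.norm_eq_abs, abs_of_nonneg ht.1]
  nlinarith [norm_nonneg (Q - P), ht.2]

variable {d : ℕ} {D : Set (EuclideanSpace ℝ (Fin d))} {ε η : ℝ}
    {n : EuclideanSpace ℝ (Fin d) → EuclideanSpace ℝ (Fin d)}

theorem fr_nonempty (hD : AssumptionD d D ε η n) : (frontier D).Nonempty := by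
  obtain ⟨P, hP⟩ := hD.nonempty
  obtain ⟨R, hR⟩ := hD.isBounded.subset_ball 0
  have hd := hD.dim_ge
  have : (|R| • e1 d) ∉ D := fun h => by
    have := hR h
    simp [norm_smul, e1_norm d hd] at this
    linarith [le_abs_self R]
  obtain ⟨Z, -, h⟩ := seg_frontier hD.isOpen hP this
  exact ⟨Z, h⟩

theorem strong (hD : AssumptionD d D ε η n) : ∃ c > 0, ∀ a ∈ frontier D, ∀ y ∈ closure D,
    c * ‖y - a‖ ^ 2 ≤ ⟪y - a, n a⟫ := by
  obtain ⟨R, hR0, hR⟩ : ∃ R > 0, ∀ a ∈ closure D, ∀ y ∈ closure D, ‖y - a‖ ≤ R := by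
    obtain ⟨R, hR⟩ := (isBounded_iff.1 hD.isBounded.closure)
    refine ⟨|R| + 1, by positivity, fun a ha y hy => ?_⟩
    rw [← dist_eq_norm]
    linarith [hR hy ha, le_abs_self R]
  have hd := hD.dim_ge
  have heps := hD.eps_pos
  have heps1 := hD.eps_lt_one
  have heta := hD.eta_pos
  set θ := ε / (R + 1) with hθ
  have θ0 : 0 < θ := by positivity
  have θ1 : θ < 1 := by rw [hθ, div_lt_one (by positivity)]; linarith
  have θR : θ * R < ε := by
    rw [hθ, div_mul_eq_mul_div, div_lt_iff₀ (by positivity)]; nlinarith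
  set κ := θ * η / 2 with hκ
  have κ0 : 0 < κ := by positivity
  refine ⟨1 / (R + 1 / κ), by positivity, fun a ha => ?_⟩
  obtain ⟨A₀, ψ, g, H, C⟩ := chart_ex hD a ha
  have main : ∀ y ∈ D, 1 / (R + 1 / κ) * ‖y - a‖ ^ 2 ≤ ⟪y - a, n a⟫ := by
    intro y hy
    obtain ⟨u, hu⟩ : ∃ u, A₀ u = y - a := ⟨A₀.symm (y - a), by simp⟩
    have hy' : y = a + A₀ u := by rw [hu]; abel
    have hun : ‖u‖ ≤ R := by
      rw [← A₀.norm_map u, hu]; exact hR a ha.1 y (subset_closure hy)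
    have hθu : ‖θ • u‖ < ε := by
      rw [norm_smul, Real.norm_eq_abs, abs_of_pos θ0]; nlinarith
    have hmem : a + A₀ (θ • u) ∈ D := by
      have := hD.convex.combo_closure_interior_mem_interior ha.1 (hD.isOpen.interior_eq.symm ▸ hy)
        (a := 1 - θ) (b := θ) (by linarith) θ0 (by ring)
      rw [hD.isOpen.interior_eq] at this
      convert this using 1
      rw [hy', map_smul]; module
    have h1 := (C.mem _ hθu).1 hmem
    have h2 := C.low (projTail d (θ • u)) ((pt_norm_le d hd _).trans_lt hθu)
    rw [pt_smul] at h1 h2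
    rw [inner_smul_left] at h1
    rw [norm_smul, Real.norm_eq_abs, abs_of_pos θ0] at h2
    have h3 : κ * ‖projTail d u‖ ^ 2 ≤ ⟪u, e1 d⟫ := by
      have : θ * (κ * ‖projTail d u‖ ^ 2) ≤ θ * ⟪u, e1 d⟫ := by
        rw [hκ]; simp at h1; nlinarith
      exact le_of_mul_le_mul_left this θ0
    have h4 : ⟪y - a, n a⟫ = ⟪u, e1 d⟫ := by
      rw [← hu, ← C.he, A₀.inner_map_map]
    have h5 := (le_abs_self _).trans (e1_abs_le d hd u)
    have h6 : 0 ≤ ⟪u, e1 d⟫ := le_trans (by positivity) h3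
    rw [h4, ← hu, A₀.norm_map, norm_dec d hd, one_div_mul_eq_div, div_le_iff₀ (by positivity)]
    have h7 : ‖projTail d u‖ ^ 2 ≤ ⟪u, e1 d⟫ * (1 / κ) := by
      rw [mul_one_div, le_div_iff₀ κ0]; linarith
    nlinarith
  intro y hy
  have cl : IsClosed {y | 1 / (R + 1 / κ) * ‖y - a‖ ^ 2 ≤ ⟪y - a, n a⟫} :=
    isClosed_le (by fun_prop) (by fun_prop)
  exact closure_minimal main cl hy

theorem infDist_le_inner (hD : AssumptionD d D ε η n) {c : ℝ} (hc : 0 < c)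
    (hs : ∀ a ∈ frontier D, ∀ y ∈ closure D, c * ‖y - a‖ ^ 2 ≤ ⟪y - a, n a⟫)
    (a : EuclideanSpace ℝ (Fin d)) (ha : a ∈ frontier D) (P : EuclideanSpace ℝ (Fin d))
    (hP : P ∈ D) : infDist P (frontier D) ≤ ⟪P - a, n a⟫ := by
  have haD : a ∉ D := (hD.isOpen.frontier_eq ▸ ha).2
  have nn := hD.normal_norm a ha
  set s := ⟪P - a, n a⟫ with hsdef
  have s0 : 0 ≤ s := le_trans (by positivity) (hs a ha P (subset_closure hP))
  have hQ : P - s • n a ∉ D := by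
    intro h
    have := hs a ha _ (subset_closure h)
    have e : ⟪P - s • n a - a, n a⟫ = 0 := by
      have : P - s • n a - a = (P - a) - s • n a := by abel
      rw [this, inner_sub_left, inner_smul_left, real_inner_self_eq_norm_sq, nn]
      simp [hsdef]
    rw [e] at this
    have h3 : ‖P - s • n a - a‖ ^ 2 ≤ 0 := by
      by_contra h4
      push Not at h4
      nlinarith [mul_pos hc h4]
    have h4 : P - s • n a - a = 0 := by
      rw [← norm_eq_zero]; nlinarith [norm_nonneg (P - s • n a - a)]
    rw [sub_eq_zero] at h4
    exact haD (h4 ▸ h)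
  refine (infDist_le_of_not_mem hD.isOpen hP hQ).trans ?_
  have : P - s • n a - P = -(s • n a) := by abel
  rw [this, norm_neg, norm_smul, nn, Real.norm_eq_abs, abs_of_nonneg s0]; simp

theorem conc (hD : AssumptionD d D ε η n) {c : ℝ} (hc : 0 < c)
    (hs : ∀ a ∈ frontier D, ∀ y ∈ closure D, c * ‖y - a‖ ^ 2 ≤ ⟪y - a, n a⟫)
    (P Q : EuclideanSpace ℝ (Fin d)) (hP : P ∈ D) (hQ : Q ∈ closure D) (t : ℝ)
    (ht : t ∈ Icc (0:ℝ) 1) :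
    (1 - t) * infDist P (frontier D) ≤ infDist (P + t • (Q - P)) (frontier D) ∧
    c * (t * (1 - t)) * ‖Q - P‖ ^ 2 ≤ infDist (P + t • (Q - P)) (frontier D) := by
  have key : ∀ a ∈ frontier D, (1 - t) * ⟪P - a, n a⟫ + t * ⟪Q - a, n a⟫
      ≤ dist (P + t • (Q - P)) a := by
    intro a ha
    have := real_inner_le_norm (P + t • (Q - P) - a) (n a)
    rw [hD.normal_norm a ha, mul_one, ← dist_eq_norm] at this
    refine le_trans (le_of_eq ?_) this
    have e : P + t • (Q - P) - a = (1 - t) • (P - a) + t • (Q - a) := by module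
    rw [e, inner_add_left, inner_smul_left, inner_smul_left]; simp
  have t0 := ht.1
  have t1 : 0 ≤ 1 - t := by linarith [ht.2]
  constructor
  · refine (le_infDist (fr_nonempty hD)).2 fun a ha => le_trans ?_ (key a ha)
    have h1 := infDist_le_inner hD hc hs a ha P hP
    have h2 : 0 ≤ ⟪Q - a, n a⟫ := le_trans (by positivity) (hs a ha Q hQ)
    nlinarith [mul_le_mul_of_nonneg_left h1 t1, mul_nonneg t0 h2]
  · refine (le_infDist (fr_nonempty hD)).2 fun a ha => le_trans ?_ (key a ha)
    have h1 := mul_le_mul_of_nonneg_left (hs a ha P (subset_closure hP)) t1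
    have h2 := mul_le_mul_of_nonneg_left (hs a ha Q hQ) t0
    have id : (1 - t) * ‖P - a‖ ^ 2 + t * ‖Q - a‖ ^ 2
        = ‖(1 - t) • (P - a) + t • (Q - a)‖ ^ 2 + t * (1 - t) * ‖Q - P‖ ^ 2 := by
      have e : Q - P = (Q - a) - (P - a) := by abel
      rw [e]
      generalize P - a = p
      generalize Q - a = q
      rw [norm_add_sq_real, norm_sub_sq_real, norm_smul, norm_smul, inner_smul_left,
        inner_smul_right, Real.norm_eq_abs, Real.norm_eq_abs, mul_pow, mul_pow, sq_abs, sq_abs,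
        real_inner_comm]
      simp; ring
    have h3 := mul_nonneg hc.le (sq_nonneg ‖(1 - t) • (P - a) + t • (Q - a)‖)
    calc _ ≤ c * (‖(1 - t) • (P - a) + t • (Q - a)‖ ^ 2 + t * (1 - t) * ‖Q - P‖ ^ 2) := by
          linarith
      _ = _ := by rw [← id]
      _ ≤ _ := by linarith

end geo

section cmp
variable {d : ℕ} {D : Set (EuclideanSpace ℝ (Fin d))} {ε η L : ℝ}
    {n : EuclideanSpace ℝ (Fin d) → EuclideanSpace ℝ (Fin d)}
    {x nx : EuclideanSpace ℝ (Fin d)}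
    {A₀ : EuclideanSpace ℝ (Fin d) ≃ₗᵢ[ℝ] EuclideanSpace ℝ (Fin d)}
    {ψ : EuclideanSpace ℝ (Fin (d - 1)) → ℝ}
    {g : EuclideanSpace ℝ (Fin (d - 1)) → EuclideanSpace ℝ (Fin (d - 1)) →L[ℝ] ℝ}
    {H : EuclideanSpace ℝ (Fin (d - 1)) → EuclideanSpace ℝ (Fin (d - 1)) →L[ℝ]
      EuclideanSpace ℝ (Fin (d - 1)) →L[ℝ] ℝ}

theorem ChartP.up (C : ChartP d D x nx ε η L A₀ ψ g H) (hL : 0 ≤ L)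
    (z : EuclideanSpace ℝ (Fin (d - 1))) (r : ℝ) (hr : r < ε) (hz : ‖z‖ ≤ r) :
    ψ z ≤ L * r ^ 2 := by
  have hr0 : 0 ≤ r := (norm_nonneg z).trans hz
  have := calcC hL C.d0 C.l1 C.g0 z 0 r hr hz (by simpa using hr0)
  rw [C.h0, sub_zero, sub_zero] at this
  have h2 := (le_abs_self _).trans this
  nlinarith [mul_le_mul_of_nonneg_left hz (mul_nonneg hL hr0)]

theorem ChartP.near (C : ChartP d D x nx ε η L A₀ ψ g H) (hd : 2 ≤ d) (hL : 0 ≤ L) (hε1 : ε < 1)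
    (r : ℝ) (hr : 0 < r) (hrε : 4 * (1 + L) * r ≤ ε) (p : EuclideanSpace ℝ (Fin d))
    (hp : ‖p‖ ≤ 2 * r) : infDist (x + A₀ p) (frontier D) ≤ |⟪p, e1 d⟫ - ψ (projTail d p)| := by
  have hLr : 0 ≤ L * r := by positivity
  have hpt := (pt_norm_le d hd p).trans hp
  have h1 := C.up hL _ _ (by nlinarith) hpt
  have h2 := C.nn (projTail d p) (by simp; nlinarith)
  set s := ⟪p, e1 d⟫ - ψ (projTail d p) with hs
  have e1' : projTail d (p - s • e1 d) = projTail d p := by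
    rw [pt_sub, pt_smul, pt_e1]; simp
  have e2 : ⟪p - s • e1 d, e1 d⟫ = ψ (projTail d p) := by
    rw [inner_sub_left, inner_smul_left, e1_inner d hd]; simp [hs]
  have hn : ‖p - s • e1 d‖ < ε := by
    have := norm_le_dec d hd (p - s • e1 d)
    rw [e1', e2, abs_of_nonneg h2] at this
    nlinarith
  have := (C.fr _ hn).2 (by rw [e1', e2])
  refine (infDist_le_dist_of_mem this).trans (le_of_eq ?_)
  rw [dist_add_left, A₀.dist_map, dist_eq_norm, sub_sub_cancel, norm_smul, e1_norm d hd]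
  simp

/-- the normal at another boundary point read in the chart -/
theorem ChartP.normal (C : ChartP d D x nx ε η L A₀ ψ g H) (hd : 2 ≤ d)
    (N b : EuclideanSpace ℝ (Fin d)) (hb : ‖b‖ < ε) (hbf : x + A₀ b ∈ frontier D)
    (hN : ∀ z ∈ closure D, 0 ≤ ⟪z - (x + A₀ b), A₀ N⟫) (q : EuclideanSpace ℝ (Fin (d - 1))) :
    ⟪N, e1 d⟫ * g (projTail d b) q + ⟪projTail d N, q⟫ = 0 := by
  have hb1 := (C.fr b hb).1 hbf
  have hbm : projTail d b ∈ ball (0 : EuclideanSpace ℝ (Fin (d - 1))) ε := by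
    simpa using (pt_norm_le d hd b).trans_lt hb
  have hder := ((C.d0 _ hbm).const_mul ⟪N, e1 d⟫).add
    (innerSL ℝ (projTail d N)).hasFDerivAt
  have hmin : IsLocalMin (fun z => ⟪N, e1 d⟫ * ψ z + ⟪projTail d N, z⟫) (projTail d b) := by
    have cψ := (C.d0 _ hbm).continuousAt
    have ev : ∀ᶠ z in nhds (projTail d b), ψ z ^ 2 + ‖z‖ ^ 2 < ε ^ 2 := by
      have : ContinuousAt (fun z => ψ z ^ 2 + ‖z‖ ^ 2) (projTail d b) := by fun_prop
      refine this.eventually_lt_const ?_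
      change ψ (projTail d b) ^ 2 + ‖projTail d b‖ ^ 2 < ε ^ 2
      rw [hb1, ← norm_dec d hd]
      nlinarith [norm_nonneg b]
    filter_upwards [ev] with z hz
    obtain ⟨u, hu1, hu2⟩ := lift_ex d hd (ψ z) z
    have hun : ‖u‖ < ε := by
      have := norm_dec d hd u
      rw [hu1, hu2] at this
      have he : 0 < ε := (norm_nonneg b).trans_lt hb
      nlinarith [norm_nonneg u]
    have huf := (C.fr u hun).2 (by rw [hu1, hu2])
    have := hN _ huf.1
    rw [add_sub_add_left_eq_sub, ← map_sub, A₀.inner_map_map, inner_dec d hd, pt_sub, hu1,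
      inner_sub_left, hu2, ← hb1, inner_sub_left, 
      real_inner_comm (projTail d N) z, real_inner_comm (projTail d N) (projTail d b)] at this
    linarith
  have := hmin.hasFDerivAt_eq_zero hder
  have := DFunLike.congr_fun this q
  simpa using this

set_option maxHeartbeats 1000000 in
theorem near_cmp (hL : 0 ≤ L) (hd : 2 ≤ d) (hε1 : ε < 1) (C : ChartP d D x nx ε η L A₀ ψ g H) 
    (r : ℝ) (hr : 0 < r) (hrε : 4 * (1 + L) * r ≤ ε) (ρ : ℝ) (hρ : ρ < r)
    (u w b N : EuclideanSpace ℝ (Fin d))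
    (hu : ‖u‖ < r) (hwu : ‖w‖ = ‖u‖) (hw : ‖w - u‖ ≤ ρ * ‖u‖) (hb : ‖b‖ ≤ ρ)
    (hNρ : ‖N - e1 d‖ ≤ ρ) (hN1 : ⟪w, N⟫ = ⟪u, e1 d⟫)
    (huf : x + A₀ u ∈ frontier D) (hbf : x + A₀ b ∈ frontier D)
    (hN : ∀ z ∈ closure D, 0 ≤ ⟪z - (x + A₀ b), A₀ N⟫) :
    infDist (x + A₀ (b + w)) (frontier D) ≤ 6 * L * ρ * ‖u‖ ^ 2 := by
  have hLr : 0 ≤ L * r := by positivity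
  have hρ0 : 0 ≤ ρ := (norm_nonneg b).trans hb
  have hu0 := norm_nonneg u
  have hr4 : 4 * r ≤ ε := by nlinarith
  refine (C.near hd hL hε1 r hr hrε (b + w) ((norm_add_le _ _).trans (by linarith))).trans ?_
  have hnorm := C.normal hd N b (by linarith) hbf hN (projTail d w)
  have hb1 := (C.fr b (by linarith)).1 hbf
  have hu1 := (C.fr u (by linarith)).1 huf
  have hpw : ‖projTail d w‖ ≤ ‖u‖ := (pt_norm_le d hd w).trans hwu.le
  have hpu : ‖projTail d u‖ ≤ ‖u‖ := pt_norm_le d hd u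
  have hpb : ‖projTail d b‖ ≤ ρ := (pt_norm_le d hd b).trans hb
  have hpwu : ‖projTail d u - projTail d w‖ ≤ ρ * ‖u‖ := by
    rw [← pt_sub]
    refine (pt_norm_le d hd _).trans ?_
    rwa [norm_sub_rev]
  have B := calcB hL C.d0 C.d1 C.l2 C.h0 C.g0 (projTail d b) (projTail d w) (by linarith)
  have B' : L * ‖projTail d b‖ * ‖projTail d w‖ ^ 2 ≤ L * ρ * ‖u‖ ^ 2 := by gcongr
  have CC := calcC hL C.d0 C.l1 C.g0 (projTail d u) (projTail d w) ‖u‖ (by linarith) hpu hpw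
  have CC' : L * ‖u‖ * ‖projTail d u - projTail d w‖ ≤ L * ρ * ‖u‖ ^ 2 := by
    calc _ ≤ L * ‖u‖ * (ρ * ‖u‖) := by gcongr
      _ = _ := by ring
  have U := C.up hL (projTail d w) ‖u‖ (by linarith) hpw
  have U0 := C.nn (projTail d w) (by simp; linarith)
  have N1 : |⟪N, e1 d⟫ - 1| ≤ ρ := by
    have := (e1_abs_le d hd (N - e1 d)).trans hNρ
    rwa [inner_sub_left, e1_inner d hd] at this
  rw [inner_dec d hd, real_inner_comm (projTail d N)] at hN1
  rw [inner_add_left, pt_add, ← hb1]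
  set ν := ⟪N, e1 d⟫
  set G := ψ (projTail d b) + ⟪w, e1 d⟫ - ψ (projTail d b + projTail d w) with hG
  set R := ψ (projTail d b + projTail d w) - ψ (projTail d b) - g (projTail d b) (projTail d w)
    - ψ (projTail d w) with hR
  have id : ν * G = (ψ (projTail d u) - ψ (projTail d w)) + (1 - ν) * ψ (projTail d w) - ν * R := by
    rw [hG, hR, hu1]
    linear_combination hN1 - hnorm
  have ν1 : 1 / 2 ≤ ν := by
    have := (abs_le.1 N1).1
    nlinarith
  have ν2 : ν ≤ 2 := by
    have := (abs_le.1 N1).2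
    nlinarith
  have hT : 0 ≤ L * ρ * ‖u‖ ^ 2 := by positivity
  have b1 := CC.trans CC'
  have b2 : |(1 - ν) * ψ (projTail d w)| ≤ L * ρ * ‖u‖ ^ 2 := by
    rw [abs_mul, abs_sub_comm, abs_of_nonneg U0]
    calc _ ≤ ρ * (L * ‖u‖ ^ 2) := by gcongr
      _ = _ := by ring
  have b3 := B.trans B'
  have b4 : |ν * G| ≤ 2 * (L * ρ * ‖u‖ ^ 2) + ν * (L * ρ * ‖u‖ ^ 2) := by
    rw [id]
    refine (abs_sub _ _).trans ?_
    have := abs_add_le (ψ (projTail d u) - ψ (projTail d w)) ((1 - ν) * ψ (projTail d w))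
    rw [abs_mul ν, abs_of_pos (by linarith : 0 < ν)]
    have := mul_le_mul_of_nonneg_left b3 (by linarith : 0 ≤ ν)
    linarith
  rw [abs_mul, abs_of_pos (by linarith : 0 < ν)] at b4
  have hν : 0 < ν := by linarith
  refine le_of_mul_le_mul_left (b4.trans ?_) hν
  have := mul_le_mul_of_nonneg_right ν1 hT
  linarith

end cmp

section final
variable {d : ℕ} {D : Set (EuclideanSpace ℝ (Fin d))} {ε η : ℝ}
    {n : EuclideanSpace ℝ (Fin d) → EuclideanSpace ℝ (Fin d)}

theorem op_bd (A A' : EuclideanSpace ℝ (Fin d) →ₗᵢ[ℝ] EuclideanSpace ℝ (Fin d))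
    (a : EuclideanSpace ℝ (Fin d)) :
    ‖A' a - A a‖ ≤ ‖A.toContinuousLinearMap - A'.toContinuousLinearMap‖ * ‖a‖ := by
  rw [norm_sub_rev]
  exact (A.toContinuousLinearMap - A'.toContinuousLinearMap).le_opNorm a

set_option maxHeartbeats 1000000 in
theorem lemC (hD : AssumptionD d D ε η n) : ∃ C > 0, ∀ x ∈ frontier D, ∀ x' ∈ frontier D,
      ∀ A : EuclideanSpace ℝ (Fin d) →ₗᵢ[ℝ] EuclideanSpace ℝ (Fin d), A (e1 d) = n x →
      ∀ A' : EuclideanSpace ℝ (Fin d) →ₗᵢ[ℝ] EuclideanSpace ℝ (Fin d), A' (e1 d) = n x' →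
      ∀ a : EuclideanSpace ℝ (Fin d), x + A a ∈ frontier D →
      infDist (x' + A' a) (frontier D) ≤
        C * (‖x - x'‖ + ‖A.toContinuousLinearMap - A'.toContinuousLinearMap‖) * ‖a‖ ^ 2 := by
  have hd := hD.dim_ge
  have heps := hD.eps_pos
  have heps1 := hD.eps_lt_one
  have heta := hD.eta_pos
  obtain ⟨L, hLdef⟩ : ∃ L, L = η⁻¹ := ⟨_, rfl⟩
  have hL : 0 < L := by rw [hLdef]; positivity
  obtain ⟨r, hrdef⟩ : ∃ r, r = ε / (4 * (1 + L)) := ⟨_, rfl⟩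
  have hr : 0 < r := by rw [hrdef]; positivity
  have hrε : 4 * (1 + L) * r ≤ ε := by rw [hrdef]; exact (mul_div_cancel₀ _ (by positivity)).le
  have hr4 : 4 * r ≤ ε := by nlinarith [mul_pos hL hr]
  obtain ⟨c, hc, hs⟩ := strong hD
  refine ⟨6 * L + 2 * L / r + (1 / r ^ 2 + 1 / r), by positivity, ?_⟩
  intro x hx x' hx' A hA A' hA' a ha
  obtain ⟨ρ, hρ⟩ : ∃ ρ, ρ = ‖x - x'‖ + ‖A.toContinuousLinearMap - A'.toContinuousLinearMap‖ :=
    ⟨_, rfl⟩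
  rw [← hρ]
  have h1 : ‖x' - x‖ ≤ ρ := by rw [hρ, norm_sub_rev]; linarith [norm_nonneg (A.toContinuousLinearMap - A'.toContinuousLinearMap)]
  have h2 : ∀ z, ‖A' z - A z‖ ≤ ρ * ‖z‖ := fun z => (op_bd A A' z).trans (by
    have := norm_nonneg (x - x')
    gcongr; linarith)
  have hρ0 : 0 ≤ ρ := (norm_nonneg _).trans h1
  clear hρ
  have a0 := norm_nonneg a
  have T1 : 0 ≤ 6 * L * ρ * ‖a‖ ^ 2 := by positivity
  have T2 : 0 ≤ 2 * L / r * ρ * ‖a‖ ^ 2 := by positivity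
  have T3 : 0 ≤ (1 / r ^ 2 + 1 / r) * ρ * ‖a‖ ^ 2 := by positivity
  have ex : (6 * L + 2 * L / r + (1 / r ^ 2 + 1 / r)) * ρ * ‖a‖ ^ 2
    = 6 * L * ρ * ‖a‖ ^ 2 + 2 * L / r * ρ * ‖a‖ ^ 2 + (1 / r ^ 2 + 1 / r) * ρ * ‖a‖ ^ 2 := by ring
  rw [ex]
  rcases le_or_gt r ‖a‖ with har | har
  · suffices infDist (x' + A' a) (frontier D) ≤ (1 / r ^ 2 + 1 / r) * ρ * ‖a‖ ^ 2 by linarith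
    refine (infDist_le_dist_of_mem ha).trans ?_
    have e : x' + A' a - (x + A a) = (x' - x) + (A' a - A a) := by abel
    rw [dist_eq_norm, e]
    refine (norm_add_le _ _).trans ((add_le_add h1 (h2 a)).trans ?_)
    have q : 1 ≤ ‖a‖ / r := by rwa [one_le_div hr]
    have q2 : 1 ≤ (‖a‖ / r) ^ 2 := one_le_pow₀ q
    have q3 := mul_le_mul_of_nonneg_left q2 hρ0
    have q4 := mul_le_mul_of_nonneg_left q (mul_nonneg hρ0 a0)
    have e3 : (1 / r ^ 2 + 1 / r) * ρ * ‖a‖ ^ 2 = ρ * (‖a‖ / r) ^ 2 + ρ * ‖a‖ * (‖a‖ / r) := by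
      field_simp
    linarith
  · obtain ⟨A₀, ψ, g, H, C⟩ := chart_ex hD x hx
    rw [← hLdef] at C
    obtain ⟨u, hu⟩ : ∃ u, A₀ u = A a := ⟨A₀.symm (A a), by simp⟩
    have hun : ‖u‖ = ‖a‖ := by rw [← A₀.norm_map, hu, A.norm_map]
    rw [← hu] at ha
    have hae : ⟪a, e1 d⟫ = ⟪u, e1 d⟫ := by
      rw [← A.inner_map_map, hA, ← C.he, ← hu, A₀.inner_map_map]
    rcases le_or_gt r ρ with hρr | hρr
    · suffices infDist (x' + A' a) (frontier D) ≤ 2 * L / r * ρ * ‖a‖ ^ 2 by linarith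
      obtain ⟨A₁, ψ', g', H', C'⟩ := chart_ex hD x' hx'
      rw [← hLdef] at C'
      obtain ⟨w, hw⟩ : ∃ w, A₁ w = A' a := ⟨A₁.symm (A' a), by simp⟩
      have hwn : ‖w‖ = ‖a‖ := by rw [← A₁.norm_map, hw, A'.norm_map]
      have haw : ⟪a, e1 d⟫ = ⟪w, e1 d⟫ := by
        rw [← A'.inner_map_map, hA', ← C'.he, ← hw, A₁.inner_map_map]
      rw [← hw]
      refine (C'.near hd hL.le heps1 r hr hrε w (by linarith)).trans ?_
      rw [← haw, hae, ← (C.fr u (by linarith)).1 ha]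
      have pu := pt_norm_le d hd u
      have pw := pt_norm_le d hd w
      have u1 := C.up hL.le (projTail d u) ‖a‖ (by linarith) (by linarith)
      have u2 := C'.up hL.le (projTail d w) ‖a‖ (by linarith) (by linarith)
      have u3 := C.nn (projTail d u) (by simp; linarith)
      have u4 := C'.nn (projTail d w) (by simp; linarith)
      have q : 1 ≤ ρ / r := by rwa [one_le_div hr]
      have q2 := mul_le_mul_of_nonneg_left q (by positivity : 0 ≤ 2 * (L * ‖a‖ ^ 2))
      have e3 : 2 * L / r * ρ * ‖a‖ ^ 2 = 2 * (L * ‖a‖ ^ 2) * (ρ / r) := by field_simp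
      rw [e3, abs_le]
      constructor <;> linarith
    · suffices infDist (x' + A' a) (frontier D) ≤ 6 * L * ρ * ‖a‖ ^ 2 by linarith
      obtain ⟨w, hw⟩ : ∃ w, A₀ w = A' a := ⟨A₀.symm (A' a), by simp⟩
      obtain ⟨b, hb⟩ : ∃ b, A₀ b = x' - x := ⟨A₀.symm (x' - x), by simp⟩
      obtain ⟨N, hN⟩ : ∃ N, A₀ N = n x' := ⟨A₀.symm (n x'), by simp⟩
      have exb : x + A₀ b = x' := by rw [hb]; abel
      have := near_cmp hL.le hd heps1 C r hr hrε ρ hρr u w b N (by linarith)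
        (by rw [hun, ← A₀.norm_map, hw, A'.norm_map])
        (by rw [← A₀.norm_map, map_sub, hw, hu, hun]; exact h2 a)
        (by rw [← A₀.norm_map, hb]; exact h1)
        (by
          rw [← A₀.norm_map, map_sub, hN, C.he, ← hA, ← hA']
          simpa [e1_norm d hd] using h2 (e1 d))
        (by rw [← hae, ← A₀.inner_map_map, hw, hN, ← hA', A'.inner_map_map])
        ha (by rw [exb]; exact hx')
        (fun z hz => by
          rw [exb, hN]
          exact le_trans (by positivity) (hs x' hx' z hz))
      rw [map_add, ← add_assoc, exb, hw, hun] at this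
      exact this

theorem pre_facts (x : EuclideanSpace ℝ (Fin d))
    (A : EuclideanSpace ℝ (Fin d) →ₗᵢ[ℝ] EuclideanSpace ℝ (Fin d)) :
    (∀ w, w ∈ frontier {w | x + A w ∈ D} ↔ x + A w ∈ frontier D) ∧
    (∀ w, w ∈ closure {w | x + A w ∈ D} ↔ x + A w ∈ closure D) ∧
    (∀ w, infDist w (frontier {w | x + A w ∈ D}) = infDist (x + A w) (frontier D)) := by
  let B := A.toLinearIsometryEquiv rfl
  let Φ : EuclideanSpace ℝ (Fin d) ≃ₜ EuclideanSpace ℝ (Fin d) :=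
    B.toHomeomorph.trans (Homeomorph.addLeft x)
  have f1 : frontier {w | x + A w ∈ D} = Φ ⁻¹' frontier D := (Φ.preimage_frontier D).symm
  have f2 : closure {w | x + A w ∈ D} = Φ ⁻¹' closure D := (Φ.preimage_closure D).symm
  refine ⟨fun w => by rw [f1]; rfl, fun w => by rw [f2]; rfl, fun w => ?_⟩
  have iso : Isometry Φ := Isometry.of_dist_eq fun a b => by
    change dist (x + A a) (x + A b) = dist a b
    simp
  rw [f1, ← infDist_image iso, Φ.image_preimage]
  rfl

end final

/-- under Assumption (D) there is `M > 0` such that for all `x, x' ∈ ∂D`,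
`A ∈ I_x`, `A' ∈ I_{x'}`, every `y ∈ D_{x,A} ∩ D_{x',A'}` and every
`v ∈ closure(D_{x',A'}) ∖ D_{x,A}`, the segment `[y,v]` meets `∂D_{x,A}` at a unique
point `a`, and `|a − v| · dist(y,∂D_{x,A}) ≤ M ρ(x,x',A,A') |y| |y − v|`. -/
theorem stmt_13 (d : ℕ) (D : Set (EuclideanSpace ℝ (Fin d))) (ε₀ η : ℝ)
    (n : EuclideanSpace ℝ (Fin d) → EuclideanSpace ℝ (Fin d))
    (hD : AssumptionD d D ε₀ η n) :
    ∃ M : ℝ, 0 < M ∧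
      ∀ x ∈ frontier D, ∀ x' ∈ frontier D,
      ∀ A : EuclideanSpace ℝ (Fin d) →ₗᵢ[ℝ] EuclideanSpace ℝ (Fin d), A (e1 d) = n x →
      ∀ A' : EuclideanSpace ℝ (Fin d) →ₗᵢ[ℝ] EuclideanSpace ℝ (Fin d), A' (e1 d) = n x' →
      ∀ y : EuclideanSpace ℝ (Fin d), x + A y ∈ D → x' + A' y ∈ D →
      ∀ v : EuclideanSpace ℝ (Fin d),
        v ∈ closure {w : EuclideanSpace ℝ (Fin d) | x' + A' w ∈ D} → x + A v ∉ D →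
        (∃! a : EuclideanSpace ℝ (Fin d), a ∈ segment ℝ y v ∧
          a ∈ frontier {w : EuclideanSpace ℝ (Fin d) | x + A w ∈ D}) ∧
        (∀ a : EuclideanSpace ℝ (Fin d), a ∈ segment ℝ y v →
          a ∈ frontier {w : EuclideanSpace ℝ (Fin d) | x + A w ∈ D} →
          ‖a - v‖ * Metric.infDist y (frontier {w : EuclideanSpace ℝ (Fin d) | x + A w ∈ D})
            ≤ M * (‖x - x'‖ + ‖A.toContinuousLinearMap - A'.toContinuousLinearMap‖)
              * ‖y‖ * ‖y - v‖) := by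
  have heps := hD.eps_pos
  obtain ⟨C, hC, hlem⟩ := lemC hD
  obtain ⟨c, hc, hs⟩ := strong hD
  obtain ⟨R, hR0, hR⟩ : ∃ R > 0, ∀ a ∈ closure D, ∀ y ∈ closure D, ‖y - a‖ ≤ R := by
    obtain ⟨R, hR⟩ := (isBounded_iff.1 hD.isBounded.closure)
    refine ⟨|R| + 1, by positivity, fun a ha y hy => ?_⟩
    rw [← dist_eq_norm]
    linarith [hR hy ha, le_abs_self R]
  refine ⟨8 * C * R + 4 * C / c, by positivity, ?_⟩
  intro x hx x' hx' A hA A' hA' y hy hy' v hv hv'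
  obtain ⟨F1, F2, F3⟩ := pre_facts (D := D) x A
  obtain ⟨F1', F2', F3'⟩ := pre_facts (D := D) x' A'
  rw [F2'] at hv
  simp only [F1, F3]
  have hfr : ∀ z, z ∈ frontier D → z ∉ D := fun z hz => (hD.isOpen.frontier_eq ▸ hz).2
  refine ⟨?_, ?_⟩
  · obtain ⟨Z, hZ, hZf⟩ := seg_frontier hD.isOpen hy hv'
    rw [segment_eq_image'] at hZ
    obtain ⟨t, ht, rfl⟩ := hZ
    have key : ∀ s ∈ Icc (0:ℝ) 1, ∀ t ∈ Icc (0:ℝ) 1, s < t →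
        x + A (y + s • (v - y)) ∈ frontier D → x + A (y + t • (v - y)) ∈ frontier D → False := by
      intro s hs t ht hst h1 h2
      apply hfr _ h1
      have t0 : 0 < t := hs.1.trans_lt hst
      have := hD.convex.combo_closure_interior_mem_interior h2.1 (hD.isOpen.interior_eq.symm ▸ hy)
        (a := s / t) (b := 1 - s / t) (by have := hs.1; positivity)
        (by rw [sub_pos, div_lt_one t0]; exact hst) (by ring)
      rw [hD.isOpen.interior_eq] at this
      convert this using 1
      simp only [map_add, map_smul]
      have e : (s / t) • (x + (A y + t • A (v - y))) = (s / t) • (x + A y) + s • A (v - y) := by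
        rw [← add_assoc, smul_add _ (x + A y), smul_smul, div_mul_cancel₀ _ t0.ne']
      rw [e]; module
    have e0 : x + A (y + t • (v - y)) = x + A y + t • (x + A v - (x + A y)) := by
      simp only [map_add, map_smul, map_sub]; module
    refine ⟨y + t • (v - y), ⟨?_, ?_⟩, ?_⟩
    · rw [segment_eq_image']; exact ⟨t, ht, rfl⟩
    · rw [e0]; exact hZf
    · rintro a ⟨ha, haf⟩
      rw [segment_eq_image'] at ha
      obtain ⟨s, hs, rfl⟩ := ha
      simp only at haf ⊢
      rcases lt_trichotomy s t with h | h | h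
      · exact (key s hs t ht h haf (by rw [e0]; exact hZf)).elim
      · rw [h]
      · exact (key t ht s hs h (by rw [e0]; exact hZf) haf).elim
  · intro a ha haf
    rw [segment_eq_image'] at ha
    obtain ⟨t, ht, rfl⟩ := ha
    simp only at haf ⊢
    have t0 := ht.1
    have t1 : 0 ≤ 1 - t := by linarith [ht.2]
    have hq := hlem x hx x' hx' A hA A' hA' _ haf
    have e1' : x' + A' (y + t • (v - y)) = x' + A' y + t • (x' + A' v - (x' + A' y)) := by
      simp only [map_add, map_smul, map_sub]; module
    rw [e1'] at hq
    obtain ⟨k1, k2⟩ := conc hD hc hs _ _ hy' hv t ht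
    have e2 : ‖x' + A' v - (x' + A' y)‖ = ‖v - y‖ := by
      rw [add_sub_add_left_eq_sub, ← map_sub, A'.norm_map]
    rw [e2] at k2
    have e3 : ‖y + t • (v - y) - v‖ = (1 - t) * ‖v - y‖ := by
      have : y + t • (v - y) - v = (-(1 - t)) • (v - y) := by module
      rw [this, norm_smul, norm_neg, Real.norm_eq_abs, abs_of_nonneg t1]
    rw [e3, norm_sub_rev y v]
    have hyR : ‖y‖ ≤ R := by
      have := hR x hx.1 _ (subset_closure hy)
      rwa [add_sub_cancel_left, A.norm_map] at this
    have haN : ‖y + t • (v - y)‖ ≤ ‖y‖ + t * ‖v - y‖ := by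
      refine (norm_add_le _ _).trans ?_
      rw [norm_smul, Real.norm_eq_abs, abs_of_nonneg t0]
    have dy : infDist (x + A y) (frontier D) ≤ ‖y‖ := by
      refine (infDist_le_dist_of_mem hx).trans ?_
      simp
    have dy' : infDist (x' + A' y) (frontier D) ≤ ‖y‖ := by
      refine (infDist_le_dist_of_mem hx').trans ?_
      simp
    obtain ⟨ρ, hρ⟩ : ∃ ρ, ρ = ‖x - x'‖ + ‖A.toContinuousLinearMap - A'.toContinuousLinearMap‖ :=
      ⟨_, rfl⟩
    have hρ0 : 0 ≤ ρ := by rw [hρ]; positivity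
    have cmp : infDist (x + A y) (frontier D) ≤ infDist (x' + A' y) (frontier D)
        + 4 * C * ρ * ‖y‖ ^ 2 := by
      obtain ⟨b, hb, hbe⟩ := isClosed_frontier.exists_infDist_eq_dist (fr_nonempty hD) (x' + A' y)
      let B := A'.toLinearIsometryEquiv rfl
      obtain ⟨β, hβ⟩ : ∃ β, A' β = b - x' := ⟨B.symm (b - x'), B.apply_symm_apply _⟩
      have hb2 : b = x' + A' β := by rw [hβ]; abel
      have hd1 : infDist (x' + A' y) (frontier D) = ‖y - β‖ := by
        rw [hbe, hb2, dist_add_left, A'.dist_map, dist_eq_norm]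
      have hβn : ‖β‖ ≤ 2 * ‖y‖ := by
        have : β = y - (y - β) := by abel
        have h2 := norm_sub_le y (y - β)
        rw [← this] at h2
        linarith
      have h3 := hlem x' hx' x hx A' hA' A hA β (hb2 ▸ hb)
      rw [norm_sub_rev x' x, norm_sub_rev A'.toContinuousLinearMap, ← hρ] at h3
      have h4 := infDist_le_infDist_add_dist (s := frontier D) (x := x + A y) (y := x + A β)
      rw [dist_add_left, A.dist_map, dist_eq_norm, ← hd1] at h4
      have h5 : C * ρ * ‖β‖ ^ 2 ≤ C * ρ * (2 * ‖y‖) ^ 2 := by gcongr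
      nlinarith
    rw [← hρ] at hq ⊢
    clear hρ
    set δ := infDist (x + A y) (frontier D)
    set δ' := infDist (x' + A' y) (frontier D)
    set q := infDist (x' + A' y + t • (x' + A' v - (x' + A' y))) (frontier D)
    set l := ‖v - y‖
    have l0 : 0 ≤ l := norm_nonneg _
    have y0 : 0 ≤ ‖y‖ := norm_nonneg _
    have δ0 : 0 ≤ δ := infDist_nonneg
    have hq2 : q ≤ C * ρ * (‖y‖ + t * l) ^ 2 := hq.trans (by gcongr)
    suffices (1 - t) * δ ≤ (8 * C * R + 4 * C / c) * ρ * ‖y‖ by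
      have := mul_le_mul_of_nonneg_right this l0
      linarith
    have P1 : 0 ≤ 8 * C * R * ρ * ‖y‖ := by positivity
    have P2 : 0 ≤ 4 * C / c * ρ * ‖y‖ := by positivity
    have P3 : C * ρ * ‖y‖ ^ 2 ≤ C * ρ * ‖y‖ * R := by
      have := mul_le_mul_of_nonneg_left hyR (by positivity : 0 ≤ C * ρ * ‖y‖)
      linarith
    rcases le_or_gt (t * l) ‖y‖ with h | h
    · have h1 : C * ρ * (‖y‖ + t * l) ^ 2 ≤ C * ρ * (2 * ‖y‖) ^ 2 := by
        gcongr; linarith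
      have h2 : (1 - t) * δ ≤ (1 - t) * δ' + 4 * C * ρ * ‖y‖ ^ 2 := by
        have a1 := mul_le_mul_of_nonneg_left cmp t1
        have a2 : 0 ≤ t * (4 * C * ρ * ‖y‖ ^ 2) := by positivity
        linarith
      linarith
    · have tl : 0 < t * l := y0.trans_lt h
      have h1 : C * ρ * (‖y‖ + t * l) ^ 2 ≤ C * ρ * (2 * (t * l)) ^ 2 := by
        gcongr; linarith
      have h2 : c * (1 - t) * (t * l) ^ 2 ≤ 4 * C * ρ * (t * l) ^ 2 := by
        have : c * (1 - t) * (t * l) ^ 2 ≤ c * (t * (1 - t)) * l ^ 2 := by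
          have a1 : 0 ≤ (1 - t) * (c * (1 - t) * t * l ^ 2) := by positivity
          linarith
        linarith
      have h3 : c * (1 - t) ≤ 4 * C * ρ := le_of_mul_le_mul_right h2 (by positivity)
      have h4 : (1 - t) ≤ 4 * C / c * ρ := by
        rw [div_mul_eq_mul_div, le_div_iff₀ hc]; linarith
      have h5 := mul_le_mul h4 dy δ0 (by positivity)
      linarith
end
end

section
/- Let D ⊂ ℝ^d satisfy Assumption (D) with data (ε₀, η, n). There exists a constant C > 0 such that for all x, x' ∈ ∂D, all A ∈ I_x and A' ∈ I_{x'}: (i) for all y, z ∈ ℝ^d such that x+Ay ∈ D, x'+A'y ∈ D, x+Az ∉ D and x'+A'z ∉ D, | |Λ(x+Ay, x+Az) − Λ(x'+A'y, x'+A'z)| − |x−x'| | ≤ C ρ(x,x',A,A') ( min(|z|,1) + |y| min(|y−z|,1) / min( δ(x+Ay), δ(x'+A'y) ) ); and (iii) for all z ∈ ℝ^d such that x+Az ∉ D and x'+A'z ∉ D, | |Λ(x, x+Az) − Λ(x', x'+A'z)| − |x−x'| | ≤ C ρ(x,x',A,A'). -/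
open Metric Set Bornology
open scoped RealInnerProductSpace

noncomputable section

/-- `lamT D y z` is the largest `t ∈ [0,1]` such that `y + t • (z - y) ∈ closure D`. -/
def lamT {d : ℕ} (D : Set (EuclideanSpace ℝ (Fin d)))
    (y z : EuclideanSpace ℝ (Fin d)) : ℝ :=
  sSup {t : ℝ | t ∈ Set.Icc (0 : ℝ) 1 ∧ y + t • (z - y) ∈ closure D}

/-- The cutoff map `Λ`. -/
def Lam {d : ℕ} (D : Set (EuclideanSpace ℝ (Fin d)))
    (y z : EuclideanSpace ℝ (Fin d)) : EuclideanSpace ℝ (Fin d) :=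
  y + lamT D y z • (z - y)


theorem taylor_lower {k k1 k2 : ℝ → ℝ} {m : ℝ}
    (h1 : ∀ s ∈ Icc (0:ℝ) 1, HasDerivAt k (k1 s) s)
    (h2 : ∀ s ∈ Icc (0:ℝ) 1, HasDerivAt k1 (k2 s) s)
    (hm : ∀ s ∈ Icc (0:ℝ) 1, m ≤ k2 s) (h0 : k 0 = 0) (h10 : k1 0 = 0) : m / 2 ≤ k 1 := by
  have a1 : ∀ s ∈ Icc (0:ℝ) 1, m * s ≤ k1 s := by
    intro s hs
    refine image_le_of_deriv_right_le_deriv_boundary (f := fun s => m * s) (f' := fun _ => m)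
      (a := 0) (b := 1) (B := k1) (B' := k2) (by fun_prop) ?_ (by simp [h10])
      (fun s hs => (h2 s hs).continuousAt.continuousWithinAt) ?_ ?_ hs
    · intro s hs
      simpa using ((hasDerivAt_id s).const_mul m).hasDerivWithinAt
    · intro s hs
      exact (h2 s (Ico_subset_Icc_self hs)).hasDerivWithinAt
    · intro s hs
      exact hm s (Ico_subset_Icc_self hs)
  have := image_le_of_deriv_right_le_deriv_boundary (f := fun s => m / 2 * s ^ 2)
      (f' := fun s => m * s)
      (a := 0) (b := 1) (B := k) (B' := k1) (by fun_prop) ?_ (by simp [h0])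
      (fun s hs => (h1 s hs).continuousAt.continuousWithinAt) ?_ ?_ (right_mem_Icc.2 zero_le_one)
  · simpa using this
  · intro s hs
    have := ((hasDerivAt_pow 2 s).const_mul (m/2)).hasDerivWithinAt (s := Ici s)
    have e : m / 2 * (((2:ℕ):ℝ) * s ^ (2 - 1)) = m * s := by norm_num; ring
    rw [e] at this
    exact this
  · intro s hs
    exact (h1 s (Ico_subset_Icc_self hs)).hasDerivWithinAt
  · intro s hs
    exact a1 s (Ico_subset_Icc_self hs)

/-- local defining function. -/
structure LChart {E : Type*} [NormedAddCommGroup E] [InnerProductSpace ℝ E] (D : Set E)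
    (x N : E) (ε K c : ℝ) (Φ : E → ℝ) (Φ1 : E → E →L[ℝ] ℝ) (Φ2 : E → E →L[ℝ] E →L[ℝ] ℝ) :
    Prop where
  d1 : ∀ w ∈ ball x ε, HasFDerivAt Φ (Φ1 w) w
  d2 : ∀ w ∈ ball x ε, HasFDerivAt Φ1 (Φ2 w) w
  bd : ∀ w ∈ ball x ε, ‖Φ2 w‖ ≤ K
  lip : ∀ w ∈ ball x ε, ∀ w' ∈ ball x ε, ‖Φ2 w - Φ2 w'‖ ≤ K * ‖w - w'‖
  zero : Φ x = 0
  grad : ∀ v, Φ1 x v = ⟪N, v⟫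
  gradN : ∀ w ∈ ball x ε, Φ1 w N = 1
  trans : ∀ w (s : ℝ), Φ (w + s • N) = Φ w + s
  low : ∀ w ∈ ball x ε, 0 < Φ w → c * ‖w - x‖ ^ 2 ≤ ⟪N, w - x⟫
  mem : ∀ w ∈ ball x ε, (w ∈ D ↔ 0 < Φ w)

set_option maxSynthPendingDepth 4 in
theorem lchart_of_psi {E F : Type*} [NormedAddCommGroup E] [InnerProductSpace ℝ E]
    [NormedAddCommGroup F] [InnerProductSpace ℝ F] (D : Set E) (x N : E) (ε η : ℝ)
    (hε : 0 < ε) (hε1 : ε < 1) (hη : 0 < η) (hN : ‖N‖ = 1)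
    (P : E →L[ℝ] F) (hP : ∀ u, ‖u‖ ^ 2 = ⟪N, u⟫ ^ 2 + ‖P u‖ ^ 2) (ψ : F → ℝ)
    (hψ : ContDiffOn ℝ 3 ψ (ball (0 : F) ε)) (h0 : ψ 0 = 0) (h1 : fderiv ℝ ψ 0 = 0)
    (hl : ∀ v ∈ ball (0 : F) ε, ∀ w, η * ‖w‖ ^ 2 ≤ iteratedFDeriv ℝ 2 ψ v ![w, w])
    (hu : ∀ v ∈ ball (0 : F) ε, ‖iteratedFDeriv ℝ 2 ψ v‖ + ‖iteratedFDeriv ℝ 3 ψ v‖ ≤ η⁻¹)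
    (hm : ∀ w ∈ ball x ε, (w ∈ D ↔ ψ (P (w - x)) < ⟪N, w - x⟫)) :
    ∃ Φ Φ1 Φ2, LChart D x N ε η⁻¹ (min 1 (η / 2) / 2) Φ Φ1 Φ2 := by
  have hPle : ∀ u, ‖P u‖ ≤ ‖u‖ := by
    intro u
    have := hP u
    apply le_of_sq_le_sq _ (norm_nonneg _)
    nlinarith [sq_nonneg ⟪N, u⟫]
  have hPn : ‖P‖ ≤ 1 := P.opNorm_le_bound zero_le_one (fun u => by simpa using hPle u)
  have hPN : P N = 0 := by
    have := hP N
    rw [real_inner_self_eq_norm_sq, hN] at this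
    have : ‖P N‖ ^ 2 = 0 := by linarith
    simpa using this
  have hb : ∀ w ∈ ball x ε, P (w - x) ∈ ball (0 : F) ε := by
    intro w hw
    rw [mem_ball_zero_iff]
    rw [mem_ball, dist_eq_norm] at hw
    exact (hPle _).trans_lt hw
  have c3 : ∀ v ∈ ball (0 : F) ε, ContDiffAt ℝ 3 ψ v := fun v hv =>
    hψ.contDiffAt (isOpen_ball.mem_nhds hv)
  have e1 : ∀ v ∈ ball (0 : F) ε, HasFDerivAt ψ (fderiv ℝ ψ v) v := fun v hv =>
    ((c3 v hv).differentiableAt (by norm_num)).hasFDerivAt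
  have c2 : ∀ v ∈ ball (0 : F) ε, ContDiffAt ℝ 2 (fderiv ℝ ψ) v := fun v hv =>
    (c3 v hv).fderiv_right (by norm_num)
  have e2 : ∀ v ∈ ball (0 : F) ε, HasFDerivAt (fderiv ℝ ψ) (fderiv ℝ (fderiv ℝ ψ) v) v :=
    fun v hv => ((c2 v hv).differentiableAt (by norm_num)).hasFDerivAt
  have c1 : ∀ v ∈ ball (0 : F) ε, ContDiffAt ℝ 1 (fderiv ℝ (fderiv ℝ ψ)) v := fun v hv =>
    (c2 v hv).fderiv_right (by norm_num)
  have n2 : ∀ v ∈ ball (0 : F) ε, ‖fderiv ℝ (fderiv ℝ ψ) v‖ ≤ η⁻¹ := by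
    intro v hv
    rw [← norm_iteratedFDeriv_one, norm_iteratedFDeriv_fderiv]
    have := hu v hv
    have h5 := norm_nonneg (iteratedFDeriv ℝ 3 ψ v)
    change ‖iteratedFDeriv ℝ 2 ψ v‖ ≤ _
    linarith
  have n3 : ∀ v ∈ ball (0 : F) ε, ‖fderiv ℝ (fderiv ℝ (fderiv ℝ ψ)) v‖ ≤ η⁻¹ := by
    intro v hv
    rw [← norm_iteratedFDeriv_one, norm_iteratedFDeriv_fderiv, norm_iteratedFDeriv_fderiv]
    have := hu v hv
    have h5 := norm_nonneg (iteratedFDeriv ℝ 2 ψ v)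
    change ‖iteratedFDeriv ℝ 3 ψ v‖ ≤ _
    linarith
  have lipψ : ∀ v ∈ ball (0 : F) ε, ∀ v' ∈ ball (0 : F) ε,
      ‖fderiv ℝ (fderiv ℝ ψ) v - fderiv ℝ (fderiv ℝ ψ) v'‖ ≤ η⁻¹ * ‖v - v'‖ := by
    intro v hv v' hv'
    exact (convex_ball (0:F) ε).norm_image_sub_le_of_norm_fderiv_le (𝕜 := ℝ)
      (fun y hy => (c1 y hy).differentiableAt (by norm_num)) n3 hv' hv
  have lowψ : ∀ v ∈ ball (0 : F) ε, η * ‖v‖ ^ 2 / 2 ≤ ψ v := by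
    intro v hv
    have hsv : ∀ s ∈ Icc (0:ℝ) 1, s • v ∈ ball (0:F) ε := by
      intro s hs
      rw [mem_ball_zero_iff] at *
      rw [norm_smul, Real.norm_of_nonneg hs.1]
      nlinarith [norm_nonneg v, hs.2]
    have hd : ∀ s : ℝ, HasDerivAt (fun s : ℝ => s • v) v s := fun s => by
      simpa using (hasDerivAt_id s).smul_const v
    have := taylor_lower (k := fun s => ψ (s • v)) (k1 := fun s => fderiv ℝ ψ (s • v) v)
      (k2 := fun s => fderiv ℝ (fderiv ℝ ψ) (s • v) v v) (m := η * ‖v‖ ^ 2)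
      (fun s hs => (e1 _ (hsv s hs)).comp_hasDerivAt s (hd s)) ?_ ?_ (by simp [h0]) (by simp [h1])
    · simpa using this
    · intro s hs
      have := (e2 _ (hsv s hs)).comp_hasDerivAt s (hd s)
      exact ((ContinuousLinearMap.apply ℝ ℝ v).hasFDerivAt.comp_hasDerivAt s this)
    · intro s hs
      have := hl _ (hsv s hs) v
      rw [iteratedFDeriv_two_apply] at this
      simpa using this
  let T : (F →L[ℝ] ℝ) →L[ℝ] (E →L[ℝ] ℝ) := (ContinuousLinearMap.compL ℝ E F ℝ).flip P
  have hT : ∀ L v, T L v = L (P v) := fun L v => rfl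
  let Ψ2 : E → E →L[ℝ] E →L[ℝ] ℝ := fun w => - (T.comp ((fderiv ℝ (fderiv ℝ ψ) (P (w - x))).comp P))
  have hQ : ∀ (L : F →L[ℝ] F →L[ℝ] ℝ), ‖T.comp (L.comp P)‖ ≤ ‖L‖ := by
    intro L
    refine ContinuousLinearMap.opNorm_le_bound _ (norm_nonneg _) fun u => ?_
    refine ContinuousLinearMap.opNorm_le_bound _ (by positivity) fun v => ?_
    calc ‖L (P u) (P v)‖ ≤ ‖L (P u)‖ * ‖P v‖ := (L (P u)).le_opNorm _
      _ ≤ (‖L‖ * ‖P u‖) * ‖P v‖ := by gcongr; exact L.le_opNorm _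
      _ ≤ _ := by gcongr <;> apply hPle
  have hPd : ∀ w, HasFDerivAt (fun w => P (w - x)) P w := fun w =>
    P.hasFDerivAt.comp w ((hasFDerivAt_id w).sub_const x)
  refine ⟨fun w => ⟪N, w - x⟫ - ψ (P (w - x)),
    fun w => innerSL ℝ N - T (fderiv ℝ ψ (P (w - x))), Ψ2, ?_⟩
  refine ⟨?_, ?_, ?_, ?_, ?_, ?_, ?_, ?_, ?_, ?_⟩
  · intro w hw
    refine HasFDerivAt.sub ?_ ((e1 _ (hb w hw)).comp w (hPd w))
    exact (innerSL ℝ N).hasFDerivAt.comp w ((hasFDerivAt_id w).sub_const x)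
  · intro w hw
    have := T.hasFDerivAt.comp w ((e2 _ (hb w hw)).comp w (hPd w))
    exact this.const_sub _
  · intro w hw
    change ‖-_‖ ≤ _
    rw [norm_neg]
    exact (hQ _).trans (n2 _ (hb w hw))
  · intro w hw w' hw'
    have : Ψ2 w - Ψ2 w' = - (T.comp ((fderiv ℝ (fderiv ℝ ψ) (P (w - x)) -
      fderiv ℝ (fderiv ℝ ψ) (P (w' - x))).comp P)) := by
      ext u v; simp [Ψ2, hT]; ring
    rw [this, norm_neg]
    refine (hQ _).trans ((lipψ _ (hb w hw) _ (hb w' hw')).trans ?_)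
    rw [← map_sub]
    have := hPle (w - w')
    have e : w - x - (w' - x) = w - w' := by abel
    rw [e]
    gcongr
  · simp [h0]
  · intro v; simp [h1]
  · intro w hw
    simp [hT, hPN, hN]
  · intro w s
    have : w + s • N - x = (w - x) + s • N := by abel
    rw [this, inner_add_right, map_add, map_smul, hPN, inner_smul_right,
      real_inner_self_eq_norm_sq, hN]
    simp; ring
  · intro w hw hpos
    have a := lowψ _ (hb w hw)
    have b := hP (w - x)
    rw [mem_ball, dist_eq_norm] at hw
    have h3 : ⟪N, w - x⟫ ≤ 1 := by
      have := real_inner_le_norm N (w - x)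
      rw [hN] at this; linarith
    have h4 : 0 ≤ ⟪N, w - x⟫ := by
      have : 0 ≤ η * ‖P (w-x)‖ ^ 2 / 2 := by positivity
      linarith
    have m1 := min_le_left 1 (η/2)
    have m2 := min_le_right 1 (η/2)
    rw [b]
    nlinarith [sq_nonneg ‖P (w-x)‖, sq_nonneg ⟪N, w - x⟫, mul_le_mul_of_nonneg_right m2 (sq_nonneg ‖P (w-x)‖), mul_le_mul_of_nonneg_right m1 (sq_nonneg ⟪N, w - x⟫)]
  · intro w hw
    rw [hm w hw]; simp

section geo
variable {E : Type*} [NormedAddCommGroup E] [InnerProductSpace ℝ E]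

theorem LChart.closure_nonneg {D : Set E} {x N : E} {ε K c : ℝ} {Φ : E → ℝ}
    {Φ1 : E → E →L[ℝ] ℝ} {Φ2 : E → E →L[ℝ] E →L[ℝ] ℝ} (h : LChart D x N ε K c Φ Φ1 Φ2)
    {w : E} (hw : w ∈ ball x ε) (hc : w ∈ closure D) : 0 ≤ Φ w := by
  by_contra hneg
  push Not at hneg
  have h1 : ∀ᶠ z in nhds w, Φ z < 0 := (h.d1 w hw).continuousAt.eventually_lt_const hneg
  have h2 : ∀ᶠ z in nhds w, z ∈ ball x ε := isOpen_ball.mem_nhds hw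
  obtain ⟨z, hz, hz1, hz2⟩ := ((mem_closure_iff_frequently.1 hc).and_eventually (h1.and h2)).exists
  have := (h.mem z hz2).1 hz
  linarith

theorem LChart.frontier_zero {D : Set E} {x N : E} {ε K c : ℝ} {Φ : E → ℝ}
    {Φ1 : E → E →L[ℝ] ℝ} {Φ2 : E → E →L[ℝ] E →L[ℝ] ℝ} (h : LChart D x N ε K c Φ Φ1 Φ2)
    (ho : IsOpen D)
    {w : E} (hw : w ∈ ball x ε) (hc : w ∈ frontier D) : Φ w = 0 := by
  rw [ho.frontier_eq] at hc
  have h1 := h.closure_nonneg hw hc.1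
  have h2 := mt (h.mem w hw).2 hc.2
  linarith

theorem LChart.enter {D : Set E} {x N : E} {ε K c : ℝ} {Φ : E → ℝ}
    {Φ1 : E → E →L[ℝ] ℝ} {Φ2 : E → E →L[ℝ] E →L[ℝ] ℝ} (h : LChart D x N ε K c Φ Φ1 Φ2)
    (ho : IsOpen D)
    {b v : E} (hb : b ∈ ball x ε) (hc : b ∈ frontier D) (hv : 0 < Φ1 b v) :
    ∀ᶠ s in nhdsWithin (0:ℝ) (Ioi 0), b + s • v ∈ D := by
  have hd : HasDerivAt (fun s : ℝ => b + s • v) v 0 := by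
    simpa using ((hasDerivAt_id (0:ℝ)).smul_const v).const_add b
  have hk : HasDerivAt (fun s : ℝ => Φ (b + s • v)) (Φ1 b v) 0 := by
    refine HasFDerivAt.comp_hasDerivAt (f := fun s : ℝ => b + s • v) (0:ℝ) ?_ hd
    simpa using h.d1 b hb
  have h1 := (hasDerivAt_iff_tendsto_slope.1 hk).eventually_const_lt hv
  have h1 : ∀ᶠ s in nhdsWithin (0:ℝ) (Ioi 0),
      0 < slope (fun s : ℝ => Φ (b + s • v)) 0 s :=
    h1.filter_mono (nhdsWithin_mono _ (fun s hs => ne_of_gt hs))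
  have h2 : ∀ᶠ s in nhdsWithin (0:ℝ) (Ioi 0), b + s • v ∈ ball x ε := by
    apply Filter.Eventually.filter_mono nhdsWithin_le_nhds
    apply hd.continuousAt.eventually
    simp only [zero_smul, add_zero]
    exact isOpen_ball.mem_nhds hb
  filter_upwards [h1, h2, self_mem_nhdsWithin] with s a1 a2 a3
  rw [h.mem _ a2]
  simp only [slope_def_field, zero_smul, add_zero, sub_zero, h.frontier_zero ho hb hc] at a1
  exact (div_pos_iff_of_pos_right a3).1 a1

theorem supp_global {D : Set E} {n : E → E} {ε K c B : ℝ} (ho : IsOpen D) (hcv : Convex ℝ D)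
    (hε : 0 < ε) (hε1 : ε < 1) (hB1 : 1 ≤ B)
    (hB : ∀ p ∈ closure D, ∀ q ∈ closure D, ‖p - q‖ ≤ B)
    {x : E} (hx : x ∈ frontier D) {Φ : E → ℝ}
    {Φ1 : E → E →L[ℝ] ℝ} {Φ2 : E → E →L[ℝ] E →L[ℝ] ℝ} (h : LChart D x (n x) ε K c Φ Φ1 Φ2)
    {w : E} (hw : w ∈ closure D) : c * (ε / (2 * B)) * ‖w - x‖ ^ 2 ≤ ⟪n x, w - x⟫ := by
  have key : ∀ w ∈ D, c * (ε / (2 * B)) * ‖w - x‖ ^ 2 ≤ ⟪n x, w - x⟫ := by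
    intro w hw
    set s := ε / (2 * B) with hs
    have hs0 : 0 < s := by positivity
    have hs1 : s ≤ 1 := by rw [hs, div_le_one (by positivity)]; linarith
    have hm : x + s • (w - x) ∈ D := by
      have := hcv.add_smul_sub_mem_interior' (frontier_subset_closure hx)
        (by rwa [ho.interior_eq]) (t := s) ⟨hs0, hs1⟩
      rwa [ho.interior_eq] at this
    have hn := hB w (subset_closure hw) x (frontier_subset_closure hx)
    have e : x + s • (w - x) - x = s • (w - x) := by abel
    have hbl : x + s • (w - x) ∈ ball x ε := by
      rw [mem_ball, dist_eq_norm, e, norm_smul, Real.norm_of_nonneg hs0.le]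
      calc s * ‖w - x‖ ≤ s * B := by gcongr
        _ = ε / 2 := by rw [hs]; field_simp
        _ < ε := by linarith
    have := h.low _ hbl ((h.mem _ hbl).1 hm)
    rw [e, norm_smul, Real.norm_of_nonneg hs0.le, inner_smul_right] at this
    have : s * (c * s * ‖w - x‖ ^ 2) ≤ s * ⟪n x, w - x⟫ := by nlinarith
    exact le_of_mul_le_mul_left this hs0
  have hcl : IsClosed {w : E | c * (ε / (2 * B)) * ‖w - x‖ ^ 2 ≤ ⟪n x, w - x⟫} :=
    isClosed_le (by fun_prop) (by fun_prop)
  exact closure_minimal key hcl hw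

theorem parallel {L : E →L[ℝ] ℝ} {M v0 : E} (h0 : L v0 = 1)
    (h : ∀ v, 0 < L v → 0 ≤ ⟪M, v⟫) : ∀ v, ⟪M, v⟫ = ⟪M, v0⟫ * L v := by
  have hk : ∀ k, L k = 0 → 0 ≤ ⟪M, k⟫ := by
    intro k hk
    by_contra hn
    push Not at hn
    have a0 := h v0 (by rw [h0]; norm_num)
    have := h (v0 + ((⟪M, v0⟫ + 1) / (-⟪M, k⟫)) • k) (by simp [hk, h0])
    rw [inner_add_right, inner_smul_right] at this
    have e : (⟪M, v0⟫ + 1) / (-⟪M, k⟫) * ⟪M, k⟫ = -(⟪M, v0⟫ + 1) := by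
      have : ⟪M, k⟫ ≠ 0 := hn.ne
      field_simp
    rw [e] at this
    linarith
  intro v
  have a := hk (v - L v • v0) (by simp [h0])
  have b := hk (-(v - L v • v0)) (by simp [h0])
  rw [inner_neg_right] at b
  rw [inner_sub_right, inner_smul_right] at a b
  linarith

set_option maxHeartbeats 800000 in
theorem fact2 {D : Set E} {n : E → E} {ε K c c' : ℝ} (ho : IsOpen D)
    (hε : 0 < ε) (hε1 : ε < 1) (hK : 0 < K) (hc' : 0 < c') 
    (hn : ∀ x ∈ frontier D, ‖n x‖ = 1)
    (hS : ∀ x ∈ frontier D, ∀ w ∈ closure D, c' * ‖w - x‖ ^ 2 ≤ ⟪n x, w - x⟫)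
    {x : E} (hx : x ∈ frontier D) {Φ : E → ℝ}
    {Φ1 : E → E →L[ℝ] ℝ} {Φ2 : E → E →L[ℝ] E →L[ℝ] ℝ} (h : LChart D x (n x) ε K c Φ Φ1 Φ2)
    {x' : E} (hx' : x' ∈ frontier D) {e : E} (A A' : E →ₗᵢ[ℝ] E) (hA : A e = n x)
    (hA' : A' e = n x') {w : E} (hw : x' + A' w ∈ closure D) :
    ∃ g ∈ closure D, ‖x + A w - g‖ ≤ (128 / ε ^ 2 + 4 * K / ε + 2 * K) *
      (‖x - x'‖ + ‖A.toContinuousLinearMap - A'.toContinuousLinearMap‖) * ‖w‖ ^ 2 := by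
  set α := ‖A.toContinuousLinearMap - A'.toContinuousLinearMap‖ with hα
  have hα0 : 0 ≤ α := norm_nonneg _
  have hAA : ∀ u, ‖A u - A' u‖ ≤ α * ‖u‖ := fun u =>
    (A.toContinuousLinearMap - A'.toContinuousLinearMap).le_opNorm u
  have hr0 : 0 ≤ ‖x - x'‖ := norm_nonneg _
  set ρ := ‖x - x'‖ + α with hρ
  have hρ0 : 0 ≤ ρ := by positivity
  have he1 : ‖e‖ = 1 := by rw [← A.norm_map, hA, hn x hx]
  by_cases hwl : ε / 8 ≤ ‖w‖
  · refine ⟨_, hw, ?_⟩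
    have e1 : x + A w - (x' + A' w) = (x - x') + (A w - A' w) := by abel
    rw [e1]
    have h1 : ‖x - x' + (A w - A' w)‖ ≤ ‖x - x'‖ + α * ‖w‖ :=
      (norm_add_le _ _).trans (by gcongr; exact hAA w)
    have h2 : 1 ≤ (8 / ε) * ‖w‖ := by
      rw [div_mul_eq_mul_div, le_div_iff₀ hε]; linarith
    have h3 : (8/ε)^2 = 64 / ε^2 := by rw [div_pow]; norm_num
    have h4 : 1 ≤ 64 / ε^2 * ‖w‖^2 := by rw [← h3]; nlinarith
    have h5 : ‖w‖ ≤ 64 / ε^2 * ‖w‖^2 := by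
      rw [← h3]
      have : 1 ≤ 8 / ε := by rw [le_div_iff₀ hε]; linarith
      nlinarith [norm_nonneg w, mul_nonneg (norm_nonneg w) (sub_nonneg.2 h2)]
    have h6 : ‖x - x'‖ + α * ‖w‖ ≤ ρ * (64 / ε^2 * ‖w‖^2) := by
      rw [hρ]; nlinarith
    have h7 : 0 ≤ (64 / ε ^ 2 + 4 * K / ε + 2 * K) * ρ * ‖w‖ ^ 2 := by positivity
    have h8 : (128 / ε ^ 2 : ℝ) = 2 * (64 / ε^2) := by ring
    rw [h8]
    nlinarith
  push Not at hwl
  have hw1 : ‖w‖ ≤ 1 := by linarith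
  -- it suffices to bound Φ from below
  suffices hΦ : ∃ η, 0 ≤ η ∧ η ≤ (4 * K / ε + 2 * K) * ρ * ‖w‖ ^ 2 ∧ -η ≤ Φ (x + A w) by
    obtain ⟨η, h0, h1, h2⟩ := hΦ
    have h3 : 0 ≤ 128 / ε ^ 2 * ρ * ‖w‖ ^ 2 := by positivity
    by_cases hbig : ε / 8 ≤ η
    · refine ⟨x, frontier_subset_closure hx, ?_⟩
      rw [add_sub_cancel_left, A.norm_map]
      linarith
    · push Not at hbig
      refine ⟨x + A w + η • n x, ?_, ?_⟩
      · rw [Metric.mem_closure_iff]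
        intro δ hδ
        set τ := min (δ / 2) (ε / 8) with hτ
        have hτ0 : 0 < τ := by positivity
        have hτ1 := min_le_left (δ/2) (ε/8)
        have hτ2 := min_le_right (δ/2) (ε/8)
        refine ⟨x + A w + (η + τ) • n x, ?_, ?_⟩
        · rw [h.mem]
          · rw [h.trans]; linarith
          · rw [mem_ball, dist_eq_norm]
            have : x + A w + (η + τ) • n x - x = A w + (η + τ) • n x := by abel
            rw [this]
            refine (norm_add_le _ _).trans_lt ?_
            rw [A.norm_map, norm_smul, hn x hx, Real.norm_of_nonneg (by positivity)]
            linarith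
        · rw [dist_eq_norm]
          have : x + A w + η • n x - (x + A w + (η + τ) • n x) = -(τ • n x) := by
            rw [add_smul]; abel
          rw [this, norm_neg, norm_smul, hn x hx, Real.norm_of_nonneg hτ0.le]
          linarith
      · have : x + A w - (x + A w + η • n x) = -(η • n x) := by abel
        rw [this, norm_neg, norm_smul, hn x hx, Real.norm_of_nonneg h0]
        linarith
  have hseg : ∀ s ∈ Icc (0:ℝ) 1, x + s • A w ∈ ball x ε := by
    intro s hs
    rw [mem_ball, dist_eq_norm, add_sub_cancel_left, norm_smul, A.norm_map,
      Real.norm_of_nonneg hs.1]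
    nlinarith [norm_nonneg w, hs.2]
  have hd : ∀ (p q : E) (s : ℝ), HasDerivAt (fun s : ℝ => p + s • q) q s := fun p q s => by
    simpa using ((hasDerivAt_id s).smul_const q).const_add p
  have k1 : ∀ (p q : E) (s : ℝ), p + s • q ∈ ball x ε →
      HasDerivAt (fun s : ℝ => Φ (p + s • q)) (Φ1 (p + s • q) q) s := fun p q s hm =>
    HasFDerivAt.comp_hasDerivAt (f := fun s : ℝ => p + s • q) s (h.d1 _ hm) (hd p q s)
  have k2 : ∀ (p q : E) (s : ℝ), p + s • q ∈ ball x ε →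
      HasDerivAt (fun s : ℝ => Φ1 (p + s • q) q) (Φ2 (p + s • q) q q) s := fun p q s hm =>
    (ContinuousLinearMap.apply ℝ ℝ q).hasFDerivAt.comp_hasDerivAt s
      (HasFDerivAt.comp_hasDerivAt (f := fun s : ℝ => p + s • q) s (h.d2 _ hm) (hd p q s))
  have bil : ∀ (L : E →L[ℝ] E →L[ℝ] ℝ) (u v : E), |L u v| ≤ ‖L‖ * ‖u‖ * ‖v‖ := fun L u v =>
    L.le_opNorm₂ u v
  by_cases hxl : ε / 8 ≤ ‖x - x'‖
  · refine ⟨K * ‖w‖ ^ 2 / 2, by positivity, ?_, ?_⟩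
    · have h1 : 1 ≤ 8 / ε * ρ := by
        rw [div_mul_eq_mul_div, le_div_iff₀ hε]; linarith
      have h2 : 0 ≤ 2 * K * ρ * ‖w‖ ^ 2 := by positivity
      have h3 : 0 ≤ K * ‖w‖ ^ 2 / 2 := by positivity
      have h4 : (4 * K / ε) * ρ * ‖w‖ ^ 2 = (8 / ε * ρ) * (K * ‖w‖ ^ 2 / 2) := by ring
      nlinarith
    · have hpos : 0 ≤ ⟪n x, A w⟫ := by
        rw [← hA, A.inner_map_map, ← A'.inner_map_map, hA']
        have := hS x' hx' _ hw
        rw [add_sub_cancel_left] at this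
        exact le_trans (by positivity) this
      have := taylor_lower (k := fun s => Φ (x + s • A w) - s * ⟪n x, A w⟫)
        (k1 := fun s => Φ1 (x + s • A w) (A w) - ⟪n x, A w⟫)
        (k2 := fun s => Φ2 (x + s • A w) (A w) (A w)) (m := -(K * ‖w‖ ^ 2)) ?_ ?_ ?_
        (by simp [h.zero]) (by simp [h.grad])
      · simp only [one_smul, one_mul] at this
        linarith
      · intro s hs
        refine (k1 _ _ _ (hseg s hs)).sub ?_
        simpa using (hasDerivAt_id s).mul_const ⟪n x, A w⟫
      · intro s hs
        exact (k2 _ _ _ (hseg s hs)).sub_const _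
      · intro s hs
        have h1 := bil (Φ2 (x + s • A w)) (A w) (A w)
        have h2 := h.bd _ (hseg s hs)
        rw [A.norm_map] at h1
        have h3 : ‖Φ2 (x + s • A w)‖ * ‖w‖ * ‖w‖ ≤ K * ‖w‖ * ‖w‖ := by gcongr
        have := neg_abs_le (Φ2 (x + s • A w) (A w) (A w))
        nlinarith
  push Not at hxl
  have hseg' : ∀ s ∈ Icc (0:ℝ) 1, x' + s • A' w ∈ ball x ε := by
    intro s hs
    rw [mem_ball, dist_eq_norm]
    have : x' + s • A' w - x = -(x - x') + s • A' w := by abel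
    rw [this]
    refine (norm_add_le _ _).trans_lt ?_
    rw [norm_neg, norm_smul, A'.norm_map, Real.norm_of_nonneg hs.1]
    nlinarith [norm_nonneg w, hs.2]
  have hxb : x' ∈ ball x ε := by simpa using hseg' 0 (by simp)
  set a := ⟪n x', n x⟫ with ha
  have hpar : ∀ v, ⟪n x', v⟫ = a * Φ1 x' v := by
    apply parallel (h.gradN x' hxb)
    intro v hv
    obtain ⟨s, hs1, hs2⟩ := ((h.enter ho hxb hx' hv).and self_mem_nhdsWithin).exists
    have := hS x' hx' _ (subset_closure hs1)
    rw [add_sub_cancel_left, inner_smul_right] at this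
    have h2 : 0 ≤ s * ⟪n x', v⟫ := le_trans (by positivity) this
    exact nonneg_of_mul_nonneg_right h2 hs2
  have ha1 : |1 - a| ≤ α := by
    have e2 : 1 - a = ⟪n x', n x' - n x⟫ := by
      rw [inner_sub_right, real_inner_self_eq_norm_sq, hn x' hx', ha]; norm_num
    rw [e2]
    refine (abs_real_inner_le_norm _ _).trans ?_
    rw [hn x' hx', one_mul, ← hA, ← hA', norm_sub_rev]
    simpa [he1] using hAA e
  have ha0 : 0 ≤ a := by
    have h1 := hpar (n x')
    have h2 : 0 < Φ1 x' (n x) := by rw [h.gradN x' hxb]; norm_num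
    obtain ⟨s, hs1, hs2⟩ := ((h.enter ho hxb hx' h2).and self_mem_nhdsWithin).exists
    have := hS x' hx' _ (subset_closure hs1)
    rw [add_sub_cancel_left, inner_smul_right] at this
    have h2 : 0 ≤ s * ⟪n x', n x⟫ := le_trans (by positivity) this
    exact nonneg_of_mul_nonneg_right h2 hs2
  refine ⟨2 * K * ρ * ‖w‖ ^ 2, by positivity, ?_, ?_⟩
  · have : 0 ≤ 4 * K / ε * ρ * ‖w‖ ^ 2 := by positivity
    linarith
  have hp : 0 ≤ Φ (x' + A' w) := by
    apply h.closure_nonneg _ hw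
    simpa using hseg' 1 (by simp)
  have := taylor_lower (k := fun s => Φ (x + s • A w) - a * Φ (x' + s • A' w))
        (k1 := fun s => Φ1 (x + s • A w) (A w) - a * Φ1 (x' + s • A' w) (A' w))
        (k2 := fun s => Φ2 (x + s • A w) (A w) (A w) - a * Φ2 (x' + s • A' w) (A' w) (A' w))
        (m := -(4 * K * ρ * ‖w‖ ^ 2)) ?_ ?_ ?_
        (by simp [h.zero, h.frontier_zero ho hxb hx']) ?_
  · simp only [one_smul] at this
    have : 0 ≤ a * Φ (x' + A' w) := by positivity
    linarith
  · intro s hs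
    exact (k1 _ _ _ (hseg s hs)).sub ((k1 _ _ _ (hseg' s hs)).const_mul a)
  · intro s hs
    exact (k2 _ _ _ (hseg s hs)).sub ((k2 _ _ _ (hseg' s hs)).const_mul a)
  · intro s hs
    set X := x + s • A w with hX
    set X' := x' + s • A' w with hX'
    have hXX : ‖X - X'‖ ≤ ρ := by
      have : X - X' = (x - x') + s • (A w - A' w) := by rw [hX, hX', smul_sub]; abel
      rw [this]
      refine (norm_add_le _ _).trans ?_
      rw [norm_smul, Real.norm_of_nonneg hs.1, hρ]
      have := hAA w
      have h2 : s * ‖A w - A' w‖ ≤ 1 * ‖A w - A' w‖ := by gcongr; exact hs.2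
      nlinarith
    have b1 : |(Φ2 X - Φ2 X') (A w) (A w)| ≤ K * ρ * ‖w‖ ^ 2 := by
      refine (bil _ _ _).trans ?_
      rw [A.norm_map, mul_assoc, ← sq]
      gcongr
      exact (h.lip _ (hseg s hs) _ (hseg' s hs)).trans (by gcongr)
    have hK2 := h.bd _ (hseg' s hs)
    have hAw : ‖A w - A' w‖ ≤ ρ * ‖w‖ := (hAA w).trans (by gcongr; linarith)
    have b2 : |Φ2 X' (A w - A' w) (A w)| ≤ K * ρ * ‖w‖ ^ 2 := by
      refine (bil _ _ _).trans ?_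
      rw [A.norm_map]
      calc ‖Φ2 X'‖ * ‖A w - A' w‖ * ‖w‖ ≤ K * (ρ * ‖w‖) * ‖w‖ := by gcongr
        _ = _ := by ring
    have b3 : |Φ2 X' (A' w) (A w - A' w)| ≤ K * ρ * ‖w‖ ^ 2 := by
      refine (bil _ _ _).trans ?_
      rw [A'.norm_map]
      calc ‖Φ2 X'‖ * ‖w‖ * ‖A w - A' w‖ ≤ K * ‖w‖ * (ρ * ‖w‖) := by gcongr
        _ = _ := by ring
    have b4 : |(1 - a) * Φ2 X' (A' w) (A' w)| ≤ K * ρ * ‖w‖ ^ 2 := by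
      rw [abs_mul]
      have := bil (Φ2 X') (A' w) (A' w)
      rw [A'.norm_map] at this
      calc |1 - a| * |Φ2 X' (A' w) (A' w)| ≤ ρ * (K * ‖w‖ * ‖w‖) := by
            gcongr
            · linarith
            · exact this.trans (by gcongr)
        _ = _ := by ring
    have e3 : Φ2 X (A w) (A w) - a * Φ2 X' (A' w) (A' w) =
      (Φ2 X - Φ2 X') (A w) (A w) + Φ2 X' (A w - A' w) (A w) + Φ2 X' (A' w) (A w - A' w)
        + (1 - a) * Φ2 X' (A' w) (A' w) := by
      simp only [map_sub, sub_apply]; ring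
    rw [e3]
    have := neg_le_of_abs_le b1
    have := neg_le_of_abs_le b2
    have := neg_le_of_abs_le b3
    have := neg_le_of_abs_le b4
    linarith
  · simp only [zero_smul, add_zero, h.grad]
    rw [← hpar, ← hA, ← hA', A.inner_map_map, A'.inner_map_map, sub_self]

end geo

section fin
variable {E : Type*} [NormedAddCommGroup E] [InnerProductSpace ℝ E]

theorem ball_in {D : Set E} (ho : IsOpen D) {p : E} (hp : p ∈ closure D) {r : ℝ} (hr : 0 < r)
    (h : ∀ β ∈ frontier D, r ≤ ‖p - β‖) : ball p r ⊆ D := by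
  have hpD : p ∈ D := by
    by_contra hn
    have : p ∈ frontier D := by rw [ho.frontier_eq]; exact ⟨hp, hn⟩
    have := h p this
    simp at this; linarith
  refine (convex_ball p r).isPreconnected.subset_left_of_subset_union ho
    (isClosed_closure (s := D)).isOpen_compl ?_ ?_ ⟨p, mem_ball_self hr, hpD⟩
  · exact disjoint_compl_right.mono_left subset_closure
  · intro q hq
    by_contra hn
    simp only [mem_union, mem_compl_iff, not_or, not_not] at hn
    have : q ∈ frontier D := by rw [ho.frontier_eq]; exact ⟨hn.2, hn.1⟩
    have := h q this
    rw [mem_ball, dist_comm, dist_eq_norm] at hq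
    linarith

theorem mid_far {D : Set E} {n : E → E} {c : ℝ} (hc : 0 < c)
    (hn : ∀ x ∈ frontier D, ‖n x‖ = 1)
    (hS : ∀ x ∈ frontier D, ∀ w ∈ closure D, c * ‖w - x‖ ^ 2 ≤ ⟪n x, w - x⟫)
    {a b : E} (ha : a ∈ closure D) (hb : b ∈ closure D) {β : E} (hβ : β ∈ frontier D) :
    c * ‖a - b‖ ^ 2 / 4 ≤ ‖(2⁻¹ : ℝ) • (a + b) - β‖ := by
  have h1 := hS β hβ a ha
  have h2 := hS β hβ b hb
  have h3 := real_inner_le_norm (n β) ((2⁻¹ : ℝ) • (a + b) - β)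
  have e : (2⁻¹ : ℝ) • (a + b) - β = (2⁻¹ : ℝ) • ((a - β) + (b - β)) := by
    rw [smul_add, smul_add, smul_sub, smul_sub]
    have : β = (2⁻¹ : ℝ) • β + (2⁻¹ : ℝ) • β := by rw [← add_smul]; norm_num
    nth_rw 1 [this]; abel
  rw [hn β hβ, one_mul] at h3
  refine le_trans ?_ h3
  rw [e, inner_smul_right, inner_add_right]
  have h4 : ‖a - b‖ ≤ ‖a - β‖ + ‖b - β‖ := by
    have := norm_sub_le (a - β) (b - β)
    simpa using this
  have h5 : ‖a - b‖ ^ 2 ≤ 2 * (‖a - β‖ ^ 2 + ‖b - β‖ ^ 2) := by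
    nlinarith [norm_nonneg (a - b), sq_nonneg (‖a - β‖ - ‖b - β‖)]
  nlinarith

theorem core {D : Set E} [FiniteDimensional ℝ E] {n : E → E} {c κ B : ℝ} (ho : IsOpen D)
    (hcv : Convex ℝ D)
    (hc : 0 < c) (hc1 : c ≤ 1) (hκ : 0 ≤ κ) (hB1 : 1 ≤ B)
    (hB : ∀ p ∈ closure D, ∀ q ∈ closure D, ‖p - q‖ ≤ B)
    (hn : ∀ x ∈ frontier D, ‖n x‖ = 1)
    (hS : ∀ x ∈ frontier D, ∀ w ∈ closure D, c * ‖w - x‖ ^ 2 ≤ ⟪n x, w - x⟫)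
    (hI : ∀ b ∈ frontier D, ∀ v, 0 < ⟪n b, v⟫ →
      ∀ᶠ s in nhdsWithin (0:ℝ) (Ioi 0), b + s • v ∈ D)
    {x x' : E} (A A' : E →ₗᵢ[ℝ] E)
    (hF : ∀ v, x' + A' v ∈ closure D → ∃ g ∈ closure D, ‖x + A v - g‖ ≤ κ * ‖v‖ ^ 2)
    {y w : E} {t t' : ℝ} (ht : 0 ≤ t) (htt : t < t')
    (hb : x + A (y + t • w) ∈ frontier D)
    (hmax : ∀ s, t < s → s ≤ t' → x + A (y + s • w) ∉ D)
    (hl' : x' + A' (y + t' • w) ∈ closure D) (hy' : x' + A' y ∈ closure D)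
    (hy : x + A y ∈ closure D) :
    (∀ R, ‖y‖ ≤ R → ‖y + t' • w‖ ≤ R →
      c * ((t' - t) * ‖w‖) * (t' * ‖w‖) ≤ 16 * (κ * (1 + B) ^ 2 * R ^ 2)) ∧
    (∀ δ, 0 < δ → (∀ β ∈ frontier D, δ ≤ ‖x + A y - β‖) →
      ((t' - t) * ‖w‖) * δ ≤ 2 * κ * ‖y + t' • w‖ ^ 2 * (t * ‖w‖)) := by
  set b := x + A (y + t • w) with hbdef
  set q := ⟪n b, A w⟫ with hq
  have hnb := hn b hb
  have hφ : ∀ v, x' + A' v ∈ closure D → -(κ * ‖v‖ ^ 2) ≤ ⟪n b, x + A v - b⟫ := by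
    intro v hv
    obtain ⟨g, hg, hg2⟩ := hF v hv
    have h1 := hS b hb g hg
    have h2 := real_inner_le_norm (n b) (g - (x + A v))
    rw [hnb, one_mul, norm_sub_rev] at h2
    have e : x + A v - b = (g - b) - (g - (x + A v)) := by abel
    rw [e, inner_sub_right]
    have : 0 ≤ c * ‖g - b‖ ^ 2 := by positivity
    linarith
  have hline : ∀ s : ℝ, ⟪n b, x + A (y + s • w) - b⟫ = (s - t) * q := by
    intro s
    have e : x + A (y + s • w) - b = (s - t) • A w := by
      rw [hbdef]; simp only [map_add, map_smul, sub_smul]; abel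
    rw [e, inner_smul_right]
  have hq0 : q ≤ 0 := by
    by_contra hpos
    push Not at hpos
    have h1 := hI b hb (A w) hpos
    have h2 : ∀ᶠ s in nhdsWithin (0:ℝ) (Ioi 0), s < t' - t :=
      Filter.Eventually.filter_mono nhdsWithin_le_nhds (eventually_lt_nhds (by linarith))
    obtain ⟨s, ⟨hs1, hs2⟩, hs3⟩ := ((h1.and h2).and self_mem_nhdsWithin).exists
    have hs3 : 0 < s := hs3
    apply hmax (t + s) (by linarith) (by linarith)
    convert hs1 using 1
    rw [hbdef]; simp only [map_add, map_smul, add_smul]; abel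
  have hlam := hφ _ hl'
  rw [hline] at hlam
  have hd0 : 0 < t' - t := by linarith
  have ht'0 : 0 < t' := by linarith
  constructor
  · intro R hR1 hR2
    have hR0 : 0 ≤ R := (norm_nonneg _).trans hR1
    by_cases hw0 : w = 0
    · simp [hw0]; positivity
    have hwp : 0 < ‖w‖ := norm_pos_iff.2 hw0
    have hab : (x' + A' y) - (x' + A' (y + t' • w)) = -(t' • A' w) := by
      simp only [map_add, map_smul]; abel
    have habn : ‖(x' + A' y) - (x' + A' (y + t' • w))‖ = t' * ‖w‖ := by
      rw [hab, norm_neg, norm_smul, A'.norm_map, Real.norm_of_nonneg ht'0.le]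
    have hBt := hB _ hy' _ hl'
    rw [habn] at hBt
    have h2R : t' * ‖w‖ ≤ 2 * R := by
      have : t' * ‖w‖ = ‖(y + t' • w) - y‖ := by
        rw [add_sub_cancel_left, norm_smul, Real.norm_of_nonneg ht'0.le]
      rw [this]
      exact (norm_sub_le _ _).trans (by linarith)
    set r := c * (t' * ‖w‖) ^ 2 / 8 with hr
    have hr0 : 0 < r := by positivity
    have emid : (2⁻¹ : ℝ) • ((x' + A' y) + (x' + A' (y + t' • w))) =
        x' + A' (y + (t' / 2) • w) := by
      simp only [map_add, map_smul]; module
    obtain ⟨u, hu⟩ : ∃ u, A u = n b := by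
      have := LinearMap.surjective_of_injective (f := A.toLinearMap) A.injective (n b)
      simpa using this
    have hun : ‖u‖ = 1 := by rw [← A.norm_map, hu, hnb]
    have hmc : x' + A' (y + (t' / 2) • w) ∈ closure D := by
      rw [← emid, smul_add]
      exact hcv.closure hy' hl' (by norm_num) (by norm_num) (by norm_num)
    have hin := ball_in ho hmc (r := 2 * r) (by positivity) (fun β hβ => by
      have := mid_far hc hn hS hy' hl' hβ
      rw [habn, emid] at this
      rw [hr]; linarith)
    have hv : x' + A' (y + (t' / 2) • w - r • u) ∈ closure D := by
      apply subset_closure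
      apply hin
      have : x' + A' (y + (t' / 2) • w - r • u) - (x' + A' (y + (t' / 2) • w)) = -(r • A' u) := by
        simp only [map_add, map_smul, map_sub]; abel
      rw [mem_ball, dist_eq_norm, this, norm_neg, norm_smul, A'.norm_map, hun,
        Real.norm_of_nonneg hr0.le]
      linarith
    have hv2 := hφ _ hv
    have e4 : x + A (y + (t' / 2) • w - r • u) - b =
        (x + A (y + (t' / 2) • w) - b) - r • n b := by
      rw [← hu]; simp only [map_add, map_smul, map_sub]; abel
    rw [e4, inner_sub_right, hline, inner_smul_right, real_inner_self_eq_norm_sq, hnb] at hv2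
    have hvn : ‖y + (t' / 2) • w - r • u‖ ≤ (1 + B) * R := by
      have e5 : y + (t' / 2) • w - r • u = (2⁻¹ : ℝ) • y + (2⁻¹ : ℝ) • (y + t' • w) - r • u := by
        module
      rw [e5]
      have h1 := norm_sub_le ((2⁻¹ : ℝ) • y + (2⁻¹ : ℝ) • (y + t' • w)) (r • u)
      have h2 := norm_add_le ((2⁻¹ : ℝ) • y) ((2⁻¹ : ℝ) • (y + t' • w))
      rw [norm_smul, norm_smul] at h2
      rw [norm_smul r, hun, Real.norm_of_nonneg hr0.le] at h1
      rw [Real.norm_of_nonneg (by norm_num : (0:ℝ) ≤ 2⁻¹)] at h2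
      have h3 : r ≤ B * R := by
        have h4 : (t' * ‖w‖) ^ 2 ≤ B * (2 * R) := by
          rw [sq]; gcongr
        have h5 : c * (t' * ‖w‖) ^ 2 ≤ 1 * (t' * ‖w‖) ^ 2 := by gcongr
        have : 0 ≤ B * R := by positivity
        rw [hr]; linarith
      linarith
    set k2 := κ * (1 + B) ^ 2 * R ^ 2 with hk2
    have hk20 : 0 ≤ k2 := by positivity
    have g1 : κ * ‖y + (t' / 2) • w - r • u‖ ^ 2 ≤ k2 := by
      calc κ * ‖y + (t' / 2) • w - r • u‖ ^ 2 ≤ κ * ((1 + B) * R) ^ 2 := by gcongr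
        _ = k2 := by rw [hk2]; ring
    have g2 : κ * ‖y + t' • w‖ ^ 2 ≤ k2 := by
      calc κ * ‖y + t' • w‖ ^ 2 ≤ κ * R ^ 2 := by gcongr
        _ ≤ κ * ((1 + B) * R) ^ 2 := by gcongr; nlinarith
        _ = k2 := by rw [hk2]; ring
    set p := -((t' - t) * q) with hp
    have hp1 : p ≤ k2 := by linarith
    have hp0 : 0 ≤ p := by rw [hp]; nlinarith
    have g3 : (t' - t) * r ≤ (t' - t) * (k2 + (t' / 2 - t) * q) := by
      gcongr; linarith
    have g4 : (t - t' / 2) * p ≤ (t' / 2) * k2 := by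
      calc (t - t' / 2) * p ≤ (t' / 2) * p := by gcongr; linarith
        _ ≤ _ := by gcongr
    have g5 : (t' - t) * (k2 + (t' / 2 - t) * q) = (t' - t) * k2 + (t - t' / 2) * p := by
      rw [hp]; ring
    have g6 : (t' - t) * k2 ≤ t' * k2 := by gcongr; linarith
    have g7 : t' * (c * ((t' - t) * ‖w‖) * (t' * ‖w‖)) ≤ t' * (16 * k2) := by
      have : t' * (c * ((t' - t) * ‖w‖) * (t' * ‖w‖)) = 8 * ((t' - t) * r) := by
        rw [hr]; ring
      rw [this]
      have : 0 ≤ t' * k2 := by positivity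
      linarith
    exact le_of_mul_le_mul_left g7 ht'0
  · intro δ hδ hβ
    have hin := ball_in ho hy hδ hβ
    have h1 : x + A y - (δ / 2) • n b ∈ D := by
      apply hin
      rw [mem_ball, dist_eq_norm]
      have : x + A y - (δ / 2) • n b - (x + A y) = -((δ / 2) • n b) := by abel
      rw [this, norm_neg, norm_smul, hnb, Real.norm_of_nonneg (by positivity)]
      linarith
    have h2 := hS b hb _ (subset_closure h1)
    have h3 : 0 ≤ ⟪n b, x + A y - (δ / 2) • n b - b⟫ := le_trans (by positivity) h2
    have e : x + A y - (δ / 2) • n b - b = (x + A (y + (0:ℝ) • w) - b) - (δ / 2) • n b := by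
      simp only [zero_smul, add_zero]; abel
    rw [e, inner_sub_right, hline, inner_smul_right, real_inner_self_eq_norm_sq, hnb] at h3
    have h4 : δ / 2 ≤ t * (-q) := by linarith
    have h5 : (t' - t) * (δ / 2) ≤ t * (κ * ‖y + t' • w‖ ^ 2) := by
      calc (t' - t) * (δ / 2) ≤ (t' - t) * (t * (-q)) := by gcongr
        _ = t * (-((t' - t) * q)) := by ring
        _ ≤ _ := by gcongr; linarith
    nlinarith [norm_nonneg w]

theorem lam_spec {d : ℕ} {D : Set (EuclideanSpace ℝ (Fin d))} (ho : IsOpen D)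
    {y z : EuclideanSpace ℝ (Fin d)} (hy : y ∈ closure D) (hz : z ∉ D) :
    0 ≤ lamT D y z ∧ lamT D y z ≤ 1 ∧ Lam D y z ∈ frontier D ∧
    ∀ s, lamT D y z < s → s ≤ 1 → y + s • (z - y) ∉ closure D := by
  have hcomp : IsCompact {t : ℝ | t ∈ Set.Icc (0 : ℝ) 1 ∧ y + t • (z - y) ∈ closure D} := by
    apply isCompact_Icc.inter_right
    exact isClosed_closure.preimage (by fun_prop)
  have hmem := hcomp.sSup_mem ⟨0, by simp [hy]⟩
  have hle : ∀ s ∈ {t : ℝ | t ∈ Set.Icc (0 : ℝ) 1 ∧ y + t • (z - y) ∈ closure D},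
    s ≤ lamT D y z := fun s hs => le_csSup hcomp.bddAbove hs
  change lamT D y z ∈ _ at hmem
  obtain ⟨⟨h0, h1⟩, h2⟩ := hmem
  refine ⟨h0, h1, ?_, ?_⟩
  · rw [ho.frontier_eq]
    refine ⟨h2, fun hD => ?_⟩
    rcases h1.eq_or_lt with h | h
    · apply hz
      rw [Lam, h] at hD
      simpa using hD
    · have hcont : Continuous fun s : ℝ => y + s • (z - y) := by fun_prop
      have e1 : ∀ᶠ s in nhdsWithin (lamT D y z) (Ioi (lamT D y z)), y + s • (z - y) ∈ D :=
        Filter.Eventually.filter_mono nhdsWithin_le_nhds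
          (hcont.continuousAt.eventually (ho.mem_nhds hD))
      have e2 : ∀ᶠ s in nhdsWithin (lamT D y z) (Ioi (lamT D y z)), s < 1 :=
        Filter.Eventually.filter_mono nhdsWithin_le_nhds (eventually_lt_nhds h)
      obtain ⟨s, ⟨hs1, hs2⟩, hs3⟩ := ((e1.and e2).and self_mem_nhdsWithin).exists
      have hs3 : lamT D y z < s := hs3
      have := hle s ⟨⟨by linarith, hs2.le⟩, subset_closure hs1⟩
      linarith
  · intro s hs hs1 hcl
    have := hle s ⟨⟨by linarith, hs1⟩, hcl⟩
    linarith

end fin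

theorem chart_of_assumption {d : ℕ} {D : Set (EuclideanSpace ℝ (Fin d))} {ε₀ η : ℝ}
    {n : EuclideanSpace ℝ (Fin d) → EuclideanSpace ℝ (Fin d)}
    (hD : AssumptionD d D ε₀ η n) {x : EuclideanSpace ℝ (Fin d)} (hx : x ∈ frontier D) :
    ∃ Φ Φ1 Φ2, LChart D x (n x) ε₀ η⁻¹ (min 1 (η / 2) / 2) Φ Φ1 Φ2 := by
  obtain ⟨A₀, hA, ψ, hψ, -, h0, h1, hl, hu, hm⟩ := hD.chart x hx
  obtain ⟨k, rfl⟩ : ∃ k, d = k + 1 := ⟨d - 1, by have := hD.dim_ge; omega⟩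
  let Q : EuclideanSpace ℝ (Fin (k + 1)) →ₗ[ℝ] EuclideanSpace ℝ (Fin (k + 1 - 1)) :=
    { toFun := projTail (k + 1)
      map_add' := fun u v => by ext i; simp [projTail]
      map_smul' := fun c u => by ext i; simp [projTail] }
  let Ae := A₀.toLinearIsometryEquiv rfl
  have hAe : ∀ u, Ae u = A₀ u := fun u => rfl
  have he1 : ∀ u : EuclideanSpace ℝ (Fin (k + 1)), ⟪u, e1 (k + 1)⟫ = u 0 := by
    intro u
    simp [e1, EuclideanSpace.inner_single_right]
  have hsplit : ∀ u : EuclideanSpace ℝ (Fin (k + 1)),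
      ‖u‖ ^ 2 = (u 0) ^ 2 + ‖projTail (k + 1) u‖ ^ 2 := by
    intro u
    rw [EuclideanSpace.real_norm_sq_eq, EuclideanSpace.real_norm_sq_eq, Fin.sum_univ_succ]
    rfl
  refine lchart_of_psi D x (n x) ε₀ η hD.eps_pos hD.eps_lt_one hD.eta_pos (hD.normal_norm x hx)
    ((LinearMap.toContinuousLinearMap Q).comp
      (Ae.symm.toContinuousLinearEquiv : _ →L[ℝ] _)) ?_ ψ hψ h0 h1 hl hu ?_
  · intro u
    obtain ⟨v, rfl⟩ := Ae.surjective u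
    have : ⟪n x, Ae v⟫ = v 0 := by
      rw [← hA, ← hAe, Ae.inner_map_map, real_inner_comm, he1]
    rw [this, Ae.norm_map, hsplit]
    simp [Q]
  · intro w hw
    obtain ⟨v, hv⟩ := Ae.surjective (w - x)
    have hwv : w = x + A₀ v := by rw [← hAe, hv]; abel
    have e2 : ⟪n x, w - x⟫ = ⟪v, e1 (k + 1)⟫ := by
      rw [← hv, ← hA, ← hAe, Ae.inner_map_map, real_inner_comm]
    have e3 : ((LinearMap.toContinuousLinearMap Q).comp
      (Ae.symm.toContinuousLinearEquiv : _ →L[ℝ] _)) (w - x) = projTail (k + 1) v := by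
      rw [← hv]; simp [Q]
    rw [e2, e3]
    have hvb : v ∈ ball (0 : EuclideanSpace ℝ (Fin (k + 1))) ε₀ := by
      rw [mem_ball, dist_eq_norm] at hw
      rw [mem_ball_zero_iff, ← Ae.norm_map, hv]; exact hw
    constructor
    · intro hwD
      have : w ∈ D ∩ ball x ε₀ := ⟨hwD, hw⟩
      rw [hm] at this
      obtain ⟨u, ⟨-, hu2⟩, hu3⟩ := this
      have : u = v := by
        apply A₀.injective
        have hu3 : x + A₀ u = w := hu3
        rw [hwv] at hu3
        exact add_left_cancel hu3
      rwa [← this]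
    · intro hlt
      have : w ∈ D ∩ ball x ε₀ := by
        rw [hm]
        exact ⟨v, ⟨hvb, hlt⟩, hwv.symm⟩
      exact this.1

theorem q_bound {E : Type*} [NormedAddCommGroup E] [NormedSpace ℝ E] {y z : E} {s δ B : ℝ}
    (hs : s ∈ Icc (0:ℝ) 1) (hB1 : 1 ≤ B) (hB : ‖y + s • (z - y)‖ ≤ B) (hδ : 0 < δ)
    (hδy : δ ≤ ‖y‖) :
    ‖y + s • (z - y)‖ ≤ B * (min ‖z‖ 1 + ‖y‖ * min ‖y - z‖ 1 / δ) := by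
  have h1 : 1 ≤ ‖y‖ / δ := (one_le_div hδ).2 hδy
  have h2 : ‖y‖ * min ‖y - z‖ 1 / δ = ‖y‖ / δ * min ‖y - z‖ 1 := by ring
  rw [h2]
  have hm0 : 0 ≤ min ‖y - z‖ 1 := by positivity
  have hm1 : 0 ≤ min ‖z‖ 1 := by positivity
  have h3 : min ‖y - z‖ 1 ≤ ‖y‖ / δ * min ‖y - z‖ 1 := by nlinarith
  have h4 : ‖y + s • (z - y)‖ ≤ B * (min ‖z‖ 1 + min ‖y - z‖ 1) := by
    rcases le_total 1 ‖z‖ with hz | hz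
    · rw [min_eq_right hz]; nlinarith
    rcases le_total 1 ‖y - z‖ with hyz | hyz
    · rw [min_eq_right hyz]; nlinarith
    rw [min_eq_left hz, min_eq_left hyz]
    have e : y + s • (z - y) = z + (1 - s) • (y - z) := by module
    have : ‖y + s • (z - y)‖ ≤ ‖z‖ + ‖y - z‖ := by
      rw [e]
      refine (norm_add_le _ _).trans ?_
      rw [norm_smul, Real.norm_of_nonneg (by linarith [hs.2])]
      nlinarith [norm_nonneg (y - z), hs.1]
    nlinarith [norm_nonneg (y - z), norm_nonneg z]
  nlinarith

/-- arithmetic: near case. -/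
theorem near_bound {E : Type*} [NormedAddCommGroup E] [NormedSpace ℝ E] {y w : E}
    {t t' c k : ℝ} (hc : 0 < c) (hk : 0 ≤ k) (ht : 0 ≤ t) (htt : t < t')
    (hy : ‖y‖ ≤ ‖y + t' • w‖ / 4)
    (h : c * ((t' - t) * ‖w‖) * (t' * ‖w‖) ≤ 16 * (k * ‖y + t' • w‖ ^ 2)) :
    (t' - t) * ‖w‖ ≤ 22 / c * k * ‖y + t' • w‖ := by
  set L := ‖y + t' • w‖ with hL
  have ht' : 0 ≤ t' := by linarith
  have hL0 : 0 ≤ L := norm_nonneg _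
  have e : t' * ‖w‖ = ‖(y + t' • w) - y‖ := by
    rw [add_sub_cancel_left, norm_smul, Real.norm_of_nonneg ht']
  have h1 : 3 / 4 * L ≤ t' * ‖w‖ := by
    rw [e]
    have := norm_sub_norm_le (y + t' • w) y
    linarith
  have h2 : t' * ‖w‖ ≤ 5 / 4 * L := by
    rw [e]
    have := norm_sub_le (y + t' • w) y
    linarith
  have hd0 : 0 ≤ (t' - t) * ‖w‖ := mul_nonneg (by linarith) (norm_nonneg _)
  rcases hL0.eq_or_lt with h0 | h0
  · rw [← h0] at h2 ⊢
    nlinarith [norm_nonneg w, mul_nonneg ht (norm_nonneg w)]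
  · have h3 : L * (c * ((t' - t) * ‖w‖) * (3 / 4)) ≤ L * (16 * (k * L)) := by
      calc L * (c * ((t' - t) * ‖w‖) * (3 / 4)) = c * ((t' - t) * ‖w‖) * (3 / 4 * L) := by ring
        _ ≤ c * ((t' - t) * ‖w‖) * (t' * ‖w‖) := by gcongr
        _ ≤ _ := h
        _ = _ := by ring
    have h4 := le_of_mul_le_mul_left h3 h0
    have h5 : 22 / c * k * L = 22 * k * L / c := by ring
    rw [h5, le_div_iff₀ hc]
    have : 0 ≤ k * L := by positivity
    linarith

/-- geometric inequalities (i) and (iii): under Assumption (D) there is a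
constant `C > 0` such that for all `x, x' ∈ ∂D`, `A ∈ I_x`, `A' ∈ I_{x'}`:
(i) for `y, z` with `x+Ay ∈ D`, `x'+A'y ∈ D`, `x+Az ∉ D`, `x'+A'z ∉ D`,
`| |Λ(x+Ay,x+Az) − Λ(x'+A'y,x'+A'z)| − |x−x'| |`
`  ≤ C ρ(x,x',A,A') (min(|z|,1) + |y| min(|y−z|,1) / min(δ(x+Ay), δ(x'+A'y)))`;
(iii) for `z` with `x+Az ∉ D`, `x'+A'z ∉ D`,
`| |Λ(x,x+Az) − Λ(x',x'+A'z)| − |x−x'| | ≤ C ρ(x,x',A,A')`. -/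
theorem stmt_14 (d : ℕ) (D : Set (EuclideanSpace ℝ (Fin d))) (ε₀ η : ℝ)
    (n : EuclideanSpace ℝ (Fin d) → EuclideanSpace ℝ (Fin d))
    (hD : AssumptionD d D ε₀ η n) :
    ∃ C : ℝ, 0 < C ∧
      ∀ x ∈ frontier D, ∀ x' ∈ frontier D,
      ∀ A : EuclideanSpace ℝ (Fin d) →ₗᵢ[ℝ] EuclideanSpace ℝ (Fin d), A (e1 d) = n x →
      ∀ A' : EuclideanSpace ℝ (Fin d) →ₗᵢ[ℝ] EuclideanSpace ℝ (Fin d), A' (e1 d) = n x' →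
        (∀ y z : EuclideanSpace ℝ (Fin d),
          x + A y ∈ D → x' + A' y ∈ D → x + A z ∉ D → x' + A' z ∉ D →
          |‖Lam D (x + A y) (x + A z) - Lam D (x' + A' y) (x' + A' z)‖ - ‖x - x'‖| ≤
            C * (‖x - x'‖ + ‖A.toContinuousLinearMap - A'.toContinuousLinearMap‖) *
              (min ‖z‖ 1 + ‖y‖ * min ‖y - z‖ 1 /
                min (Metric.infDist (x + A y) (frontier D))
                    (Metric.infDist (x' + A' y) (frontier D)))) ∧
        (∀ z : EuclideanSpace ℝ (Fin d), x + A z ∉ D → x' + A' z ∉ D →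
          |‖Lam D x (x + A z) - Lam D x' (x' + A' z)‖ - ‖x - x'‖| ≤
            C * (‖x - x'‖ + ‖A.toContinuousLinearMap - A'.toContinuousLinearMap‖)) := by
  obtain ⟨B, hB1, hB⟩ : ∃ B : ℝ, 1 ≤ B ∧ ∀ p ∈ closure D, ∀ q ∈ closure D, ‖p - q‖ ≤ B := by
    obtain ⟨B, hB⟩ := Metric.isBounded_iff.1 hD.isBounded.closure
    refine ⟨max B 1, le_max_right _ _, fun p hp q hq => ?_⟩
    rw [← dist_eq_norm]
    exact (hB hp hq).trans (le_max_left _ _)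
  have hε := hD.eps_pos
  have hε1 := hD.eps_lt_one
  have hη := hD.eta_pos
  have ho := hD.isOpen
  have hcv := hD.convex
  have hn := hD.normal_norm
  obtain ⟨c, hc⟩ : ∃ c, c = min 1 (η / 2) / 2 * (ε₀ / (2 * B)) := ⟨_, rfl⟩
  have hc0 : 0 < c := by rw [hc]; positivity
  have hc1 : c ≤ 1 := by
    have h1 : min 1 (η / 2) / 2 ≤ 1 := by linarith [min_le_left 1 (η / 2)]
    have h2 : ε₀ / (2 * B) ≤ 1 := by rw [div_le_one (by positivity)]; linarith
    rw [hc]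
    exact mul_le_one₀ h1 (by positivity) h2
  have hS : ∀ x ∈ frontier D, ∀ w ∈ closure D, c * ‖w - x‖ ^ 2 ≤ ⟪n x, w - x⟫ := by
    intro x hx w hw
    obtain ⟨Φ, Φ1, Φ2, h⟩ := chart_of_assumption hD hx
    rw [hc]
    exact supp_global ho hcv hε hε1 hB1 hB hx h hw
  have hI : ∀ b ∈ frontier D, ∀ v, 0 < ⟪n b, v⟫ →
      ∀ᶠ s in nhdsWithin (0:ℝ) (Ioi 0), b + s • v ∈ D := by
    intro b hb v hv
    obtain ⟨Φ, Φ1, Φ2, h⟩ := chart_of_assumption hD hb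
    exact h.enter ho (mem_ball_self hε) hb (by rwa [h.grad])
  obtain ⟨K, hK⟩ : ∃ K, K = 128 / ε₀ ^ 2 + 4 * η⁻¹ / ε₀ + 2 * η⁻¹ := ⟨_, rfl⟩
  have hK0 : 0 < K := by rw [hK]; positivity
  obtain ⟨M, hM⟩ : ∃ M, M = K * (22 / c * (1 + B) ^ 2 * B + 8 * B ^ 2) := ⟨_, rfl⟩
  have hM0 : 0 < M := by rw [hM]; positivity
  have hM1 : K * (22 / c * (1 + B) ^ 2 * B) ≤ M := by
    rw [hM]; gcongr; linarith [sq_nonneg B]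
  have hM2 : K * (8 * B ^ 2) ≤ M := by
    rw [hM]; gcongr
    have : 0 ≤ 22 / c * (1 + B) ^ 2 * B := by positivity
    linarith
  -- one-sided estimates
  have dir : ∀ x ∈ frontier D, ∀ x' ∈ frontier D,
      ∀ A : EuclideanSpace ℝ (Fin d) →ₗᵢ[ℝ] EuclideanSpace ℝ (Fin d), A (e1 d) = n x →
      ∀ A' : EuclideanSpace ℝ (Fin d) →ₗᵢ[ℝ] EuclideanSpace ℝ (Fin d), A' (e1 d) = n x' →
      ∀ (y w : EuclideanSpace ℝ (Fin d)) (t t' : ℝ), 0 ≤ t → t < t' → t' ≤ 1 →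
      x + A y ∈ closure D → x' + A' y ∈ closure D →
      x + A (y + t • w) ∈ frontier D → x' + A' (y + t' • w) ∈ closure D →
      (∀ s, t < s → s ≤ 1 → x + A (y + s • w) ∉ closure D) →
      (‖y‖ ≤ ‖y + t' • w‖ / 4 → (t' - t) * ‖w‖ ≤ M *
        (‖x - x'‖ + ‖A.toContinuousLinearMap - A'.toContinuousLinearMap‖) *
        (‖y + t' • w‖ / B)) ∧
      (∀ δ, 0 < δ → (∀ β ∈ frontier D, δ ≤ ‖x + A y - β‖) → ‖y + t' • w‖ / 4 ≤ ‖y‖ →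
        (t' - t) * ‖w‖ ≤ M *
        (‖x - x'‖ + ‖A.toContinuousLinearMap - A'.toContinuousLinearMap‖) *
        (‖y‖ * min ‖w‖ 1 / δ)) := by
    intro x hx x' hx' A hA A' hA' y w t t' ht htt ht1 hy hy' hb hl' hmax
    obtain ⟨ρ, hρ⟩ : ∃ ρ, ρ = ‖x - x'‖ + ‖A.toContinuousLinearMap - A'.toContinuousLinearMap‖ :=
      ⟨_, rfl⟩
    have hρ0 : 0 ≤ ρ := by rw [hρ]; positivity
    rw [← hρ]
    have hc := core (κ := K * ρ) ho hcv hc0 hc1 (by positivity) hB1 hB hn hS hI A A' ?_ ht htt hb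
      (fun s h1 h2 h3 => hmax s h1 (h2.trans ht1) (subset_closure h3)) hl' hy' hy
    · constructor
      · intro hyl
        have h1 := hc.1 ‖y + t' • w‖ (by linarith [norm_nonneg (y + t' • w)]) le_rfl
        have h2 := near_bound (k := K * ρ * (1 + B) ^ 2) hc0 (by positivity) ht htt hyl h1
        refine h2.trans ?_
        calc 22 / c * (K * ρ * (1 + B) ^ 2) * ‖y + t' • w‖
            = K * (22 / c * (1 + B) ^ 2 * B) * ρ * (‖y + t' • w‖ / B) := by
              field_simp
          _ ≤ _ := by gcongr
      · intro δ hδ hβ hyl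
        have h1 := hc.2 δ hδ hβ
        have hlB : ‖y + t' • w‖ ≤ B := by
          have := hB _ hl' _ (frontier_subset_closure hx')
          rwa [add_sub_cancel_left, A'.norm_map] at this
        have htw : t * ‖w‖ ≤ B := by
          have := hB _ (frontier_subset_closure hb) _ hy
          have e : x + A (y + t • w) - (x + A y) = t • A w := by
            simp only [map_add, map_smul]; abel
          rwa [e, norm_smul, A.norm_map, Real.norm_of_nonneg ht] at this
        have htm : t * ‖w‖ ≤ B * min ‖w‖ 1 := by
          rcases le_total ‖w‖ 1 with h | h
          · rw [min_eq_left h]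
            have : t ≤ B := by linarith
            gcongr
          · rw [min_eq_right h, mul_one]; exact htw
        have h2 : (t' - t) * ‖w‖ ≤ K * (8 * B ^ 2) * ρ * (‖y‖ * min ‖w‖ 1 / δ) := by
          have e : K * (8 * B ^ 2) * ρ * (‖y‖ * min ‖w‖ 1 / δ) =
            (2 * (K * ρ) * (B * (4 * ‖y‖)) * (B * min ‖w‖ 1)) / δ := by ring
          rw [e, le_div_iff₀ hδ]
          refine h1.trans ?_
          have : 0 ≤ t * ‖w‖ := by positivity
          rw [sq]
          gcongr
          linarith
        refine h2.trans ?_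
        gcongr
    · intro v hv
      obtain ⟨Φ, Φ1, Φ2, h⟩ := chart_of_assumption hD hx
      have := fact2 ho hε hε1 (inv_pos.2 hη) hc0 hn hS hx h hx' A A' hA hA' hv
      rwa [← hK, ← hρ] at this
  -- two-sided reduction
  have red : ∀ x ∈ frontier D, ∀ x' ∈ frontier D,
      ∀ A : EuclideanSpace ℝ (Fin d) →ₗᵢ[ℝ] EuclideanSpace ℝ (Fin d), A (e1 d) = n x →
      ∀ A' : EuclideanSpace ℝ (Fin d) →ₗᵢ[ℝ] EuclideanSpace ℝ (Fin d), A' (e1 d) = n x' →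
      ∀ (y z : EuclideanSpace ℝ (Fin d)),
      x + A y ∈ closure D → x' + A' y ∈ closure D → x + A z ∉ D → x' + A' z ∉ D →
      ∀ Q : ℝ, 0 ≤ Q →
      (∀ s ∈ Icc (0:ℝ) 1, ‖y + s • (z - y)‖ ≤ B → ‖y + s • (z - y)‖ ≤ B * Q) →
      (y = 0 ∨ ∃ δ, 0 < δ ∧ (∀ β ∈ frontier D, δ ≤ ‖x + A y - β‖) ∧
        (∀ β ∈ frontier D, δ ≤ ‖x' + A' y - β‖) ∧ ‖y‖ * min ‖z - y‖ 1 / δ ≤ Q) →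
      |‖Lam D (x + A y) (x + A z) - Lam D (x' + A' y) (x' + A' z)‖ - ‖x - x'‖| ≤
        (B + M) * (‖x - x'‖ + ‖A.toContinuousLinearMap - A'.toContinuousLinearMap‖) * Q := by
    intro x hx x' hx' A hA A' hA' y z hy hy' hz hz' Q hQ0 hQ hδ
    obtain ⟨w, hw⟩ : ∃ w, w = z - y := ⟨_, rfl⟩
    rw [← hw] at hQ hδ
    have e : ∀ s : ℝ, x + A y + s • (x + A z - (x + A y)) = x + A (y + s • w) := by
      intro s; rw [hw]; simp only [map_add, map_smul, map_sub]; module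
    have e' : ∀ s : ℝ, x' + A' y + s • (x' + A' z - (x' + A' y)) = x' + A' (y + s • w) := by
      intro s; rw [hw]; simp only [map_add, map_smul, map_sub]; module
    obtain ⟨a0, a1, a2, a3⟩ := lam_spec ho hy hz
    obtain ⟨b0, b1, b2, b3⟩ := lam_spec ho hy' hz'
    simp only [Lam] at a2 b2 ⊢
    simp only [e] at a2 a3 ⊢
    simp only [e'] at b2 b3 ⊢
    obtain ⟨t, ht⟩ : ∃ t, t = lamT D (x + A y) (x + A z) := ⟨_, rfl⟩
    obtain ⟨t', ht'⟩ : ∃ t', t' = lamT D (x' + A' y) (x' + A' z) := ⟨_, rfl⟩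
    rw [← ht] at a0 a1 a2 a3 ⊢
    rw [← ht'] at b0 b1 b2 b3 ⊢
    have hlB : ‖y + t • w‖ ≤ B := by
      have := hB _ (frontier_subset_closure a2) _ (frontier_subset_closure hx)
      rwa [add_sub_cancel_left, A.norm_map] at this
    have hlB' : ‖y + t' • w‖ ≤ B := by
      have := hB _ (frontier_subset_closure b2) _ (frontier_subset_closure hx')
      rwa [add_sub_cancel_left, A'.norm_map] at this
    have hl := hQ t ⟨a0, a1⟩ hlB
    have hl' := hQ t' ⟨b0, b1⟩ hlB'
    have hlQ : ‖y + t • w‖ / B ≤ Q := by rw [div_le_iff₀ (by linarith)]; linarith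
    have hlQ' : ‖y + t' • w‖ / B ≤ Q := by rw [div_le_iff₀ (by linarith)]; linarith
    obtain ⟨α, hα⟩ : ∃ α, α = ‖A.toContinuousLinearMap - A'.toContinuousLinearMap‖ := ⟨_, rfl⟩
    have hα0 : 0 ≤ α := by rw [hα]; positivity
    have hr0 := norm_nonneg (x - x')
    have key : |t - t'| * ‖w‖ ≤ M * (‖x - x'‖ + α) * Q := by
      have hMr : 0 ≤ M * (‖x - x'‖ + α) := by positivity
      rcases lt_trichotomy t t' with h | h | h
      · have hd := dir x hx x' hx' A hA A' hA' y w t t' a0 h b1 hy hy' a2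
          (frontier_subset_closure b2) a3
        rw [← hα] at hd
        rw [abs_sub_comm, abs_of_pos (sub_pos.2 h)]
        rcases hδ with h0 | ⟨δ, hδ, hβ, hβ', hq⟩
        · refine (hd.1 (by rw [h0, norm_zero]; positivity)).trans ?_
          gcongr
        · rcases le_total ‖y‖ (‖y + t' • w‖ / 4) with hh | hh
          · exact (hd.1 hh).trans (by gcongr)
          · exact (hd.2 δ hδ hβ hh).trans (by gcongr)
      · rw [h]; simp; positivity
      · have hd := dir x' hx' x hx A' hA' A hA y w t' t b0 h a1 hy' hy b2
          (frontier_subset_closure a2) b3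
        rw [norm_sub_rev x', norm_sub_rev A'.toContinuousLinearMap, ← hα] at hd
        rw [abs_of_pos (sub_pos.2 h)]
        rcases hδ with h0 | ⟨δ, hδ, hβ, hβ', hq⟩
        · refine (hd.1 (by rw [h0, norm_zero]; positivity)).trans ?_
          gcongr
        · rcases le_total ‖y‖ (‖y + t • w‖ / 4) with hh | hh
          · exact (hd.1 hh).trans (by gcongr)
          · exact (hd.2 δ hδ hβ' hh).trans (by gcongr)
    rw [← hα]
    have hAA : ‖A (y + t • w) - A' (y + t • w)‖ ≤ α * ‖y + t • w‖ := by
      rw [hα]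
      exact (A.toContinuousLinearMap - A'.toContinuousLinearMap).le_opNorm _
    have e3 : x + A (y + t • w) - (x' + A' (y + t' • w)) - (x - x') =
        (A (y + t • w) - A' (y + t • w)) + (t - t') • A' w := by
      simp only [map_add, map_smul]; module
    refine (abs_norm_sub_norm_le _ _).trans ?_
    rw [e3]
    refine (norm_add_le _ _).trans ?_
    rw [norm_smul, A'.norm_map, Real.norm_eq_abs]
    have h5 : α * ‖y + t • w‖ ≤ (‖x - x'‖ + α) * (B * Q) := by
      gcongr
      linarith
    linarith
  refine ⟨B + M, by linarith, ?_⟩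
  intro x hx x' hx' A hA A' hA'
  constructor
  · intro y z hy hy' hz hz'
    have hfne : (frontier D).Nonempty := ⟨x, hx⟩
    have hpos : ∀ p ∈ D, 0 < infDist p (frontier D) := by
      intro p hp
      refine (isClosed_frontier.notMem_iff_infDist_pos hfne).1 fun h => ?_
      rw [ho.frontier_eq] at h
      exact h.2 hp
    have hδ0 := lt_min (hpos _ hy) (hpos _ hy')
    have hδ1 : ∀ β ∈ frontier D, min (infDist (x + A y) (frontier D))
        (infDist (x' + A' y) (frontier D)) ≤ ‖x + A y - β‖ := by
      intro β hβ
      rw [← dist_eq_norm]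
      exact (min_le_left _ _).trans (infDist_le_dist_of_mem hβ)
    have hδ2 : ∀ β ∈ frontier D, min (infDist (x + A y) (frontier D))
        (infDist (x' + A' y) (frontier D)) ≤ ‖x' + A' y - β‖ := by
      intro β hβ
      rw [← dist_eq_norm]
      exact (min_le_right _ _).trans (infDist_le_dist_of_mem hβ)
    have hδy := hδ1 x hx
    rw [add_sub_cancel_left, A.norm_map] at hδy
    refine red x hx x' hx' A hA A' hA' y z (subset_closure hy) (subset_closure hy') hz hz' _
      (by positivity) (fun s hs hsB => q_bound hs hB1 hsB hδ0 hδy)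
      (Or.inr ⟨_, hδ0, hδ1, hδ2, ?_⟩)
    rw [norm_sub_rev z y]
    have : 0 ≤ min ‖z‖ 1 := by positivity
    linarith
  · intro z hz hz'
    have := red x hx x' hx' A hA A' hA' 0 z (by simpa using frontier_subset_closure hx)
      (by simpa using frontier_subset_closure hx') hz hz' 1 zero_le_one
      (fun s hs hsB => by rwa [mul_one]) (Or.inl rfl)
    simpa using this
end
end
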